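/- Let 0 < R₁ < R₂ ≤ R and A = { x ∈ ℝ^d : R₁ < ‖x‖ < R₂ } ⊂ B_R. There exists a constant c > 0 and, for every β > 1, a constant c_β > 0 (with c_β → ∞ as β → 1), such that for every T > 0, every μ > 0, every ε ∈ (0,1], and every solution y of the harmonic heat equation with parameter μ on [0,T], one has ∫_{B_R} |y(T,·)|² ≤ (c/ε⁶) (1+μ) e^{μ(R₁+ε)²} e^{2 c_β / T^β} ∫₀^T ∫_A |y|². -/

import Mathlib

open MeasureTheory Metric Set Filter

/-- The Euclidean Laplacian of `f : ℝ^n → ℝ` at `x`. -/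
noncomputable def lapl {n : ℕ} (f : EuclideanSpace ℝ (Fin n) → ℝ)
    (x : EuclideanSpace ℝ (Fin n)) : ℝ :=
  ∑ i, fderiv ℝ (fun z => fderiv ℝ f z (EuclideanSpace.single i 1)) x (EuclideanSpace.single i 1)

/-- `y` is a solution of the harmonic heat equation `∂ₜy − Δy + μ²‖x‖² y = 0`
on `(0,T) × B_R`, continuous on `[0,T] × closedBall 0 R`, smooth on `(0,T) × B_R`,
vanishing on `(0,T) × ∂B_R`. -/
structure IsHarmonicHeatSolution (n : ℕ) (R μ T : ℝ)
    (y : ℝ → EuclideanSpace ℝ (Fin n) → ℝ) : Prop where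
  continuousOn : ContinuousOn (fun p : ℝ × EuclideanSpace ℝ (Fin n) => y p.1 p.2)
    (Icc 0 T ×ˢ closedBall (0 : EuclideanSpace ℝ (Fin n)) R)
  smoothOn : ContDiffOn ℝ (⊤ : ℕ∞) (fun p : ℝ × EuclideanSpace ℝ (Fin n) => y p.1 p.2)
    (Ioo 0 T ×ˢ ball (0 : EuclideanSpace ℝ (Fin n)) R)
  eqn : ∀ t ∈ Ioo (0:ℝ) T, ∀ x ∈ ball (0 : EuclideanSpace ℝ (Fin n)) R,
    deriv (fun s => y s x) t - lapl (y t) x + μ ^ 2 * ‖x‖ ^ 2 * y t x = 0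
  boundary : ∀ t ∈ Ioo (0:ℝ) T, ∀ x ∈ sphere (0 : EuclideanSpace ℝ (Fin n)) R, y t x = 0

/-! ### Partial derivatives and the carré du champ -/

/-- The `i`-th partial derivative. -/
noncomputable def pd {n : ℕ} (i : Fin n) (f : EuclideanSpace ℝ (Fin n) → ℝ)
    (x : EuclideanSpace ℝ (Fin n)) : ℝ :=
  fderiv ℝ f x (EuclideanSpace.single i 1)

/-- The inner product of the gradients of `f` and `g`. -/
noncomputable def gr {n : ℕ} (f g : EuclideanSpace ℝ (Fin n) → ℝ)
    (x : EuclideanSpace ℝ (Fin n)) : ℝ :=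
  ∑ i, pd i f x * pd i g x

section Calculus

variable {n : ℕ} {f g h : EuclideanSpace ℝ (Fin n) → ℝ} {x : EuclideanSpace ℝ (Fin n)}
  {U : Set (EuclideanSpace ℝ (Fin n))}

theorem lapl_eq_sum_pd (f : EuclideanSpace ℝ (Fin n) → ℝ) (x : EuclideanSpace ℝ (Fin n)) :
    lapl f x = ∑ i, pd i (pd i f) x := rfl

theorem pd_congr (i : Fin n) (hfg : f =ᶠ[nhds x] g) : pd i f x = pd i g x := by
  unfold pd; rw [hfg.fderiv_eq]

theorem lapl_congr (hfg : f =ᶠ[nhds x] g) : lapl f x = lapl g x := by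
  simp only [lapl_eq_sum_pd]
  refine Finset.sum_congr rfl fun i _ => pd_congr i ?_
  filter_upwards [hfg.eventuallyEq_nhds] with z hz using pd_congr i hz

theorem gr_comm (f g : EuclideanSpace ℝ (Fin n) → ℝ) (x : EuclideanSpace ℝ (Fin n)) :
    gr f g x = gr g f x := by
  simp only [gr, mul_comm]

theorem gr_self_nonneg (f : EuclideanSpace ℝ (Fin n) → ℝ) (x : EuclideanSpace ℝ (Fin n)) :
    0 ≤ gr f f x :=
  Finset.sum_nonneg fun _ _ => mul_self_nonneg _

theorem gr_sq_le (f g : EuclideanSpace ℝ (Fin n) → ℝ) (x : EuclideanSpace ℝ (Fin n)) :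
    gr f g x ^ 2 ≤ gr f f x * gr g g x := by
  have := Finset.sum_mul_sq_le_sq_mul_sq Finset.univ (fun i => pd i f x) (fun i => pd i g x)
  simpa only [gr, ← sq] using this

theorem pd_mul (i : Fin n) (hf : DifferentiableAt ℝ f x) (hg : DifferentiableAt ℝ g x) :
    pd i (fun z => f z * g z) x = f x * pd i g x + g x * pd i f x := by
  unfold pd
  rw [show (fun z => f z * g z) = f * g from rfl, fderiv_mul hf hg]
  simp

theorem pd_add (i : Fin n) (hf : DifferentiableAt ℝ f x) (hg : DifferentiableAt ℝ g x) :
    pd i (fun z => f z + g z) x = pd i f x + pd i g x := by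
  unfold pd
  rw [show (fun z => f z + g z) = f + g from rfl, fderiv_add hf hg]
  simp

theorem pd_const_mul (i : Fin n) (c : ℝ) (f : EuclideanSpace ℝ (Fin n) → ℝ) :
    pd i (fun z => c * f z) x = c * pd i f x := by
  unfold pd
  rw [show (fun z => c * f z) = c • f from rfl, fderiv_const_smul_field]
  simp

theorem pd_const (i : Fin n) (c : ℝ) : pd i (fun _ => c) x = 0 := by
  unfold pd; simp

theorem pd_comp (i : Fin n) {k : ℝ → ℝ} {k' : ℝ} (hk : HasDerivAt k k' (f x))
    (hf : DifferentiableAt ℝ f x) : pd i (fun z => k (f z)) x = k' * pd i f x := by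
  unfold pd
  have := (hk.comp_hasFDerivAt x hf.hasFDerivAt).fderiv
  rw [show (fun z => k (f z)) = k ∘ f from rfl, this]
  simp

theorem gr_mul_left (hf : DifferentiableAt ℝ f x) (hg : DifferentiableAt ℝ g x) :
    gr (fun z => f z * g z) h x = f x * gr g h x + g x * gr f h x := by
  simp only [gr, pd_mul _ hf hg, Finset.mul_sum, ← Finset.sum_add_distrib]
  exact Finset.sum_congr rfl fun i _ => by ring

theorem gr_mul_right (hf : DifferentiableAt ℝ f x) (hg : DifferentiableAt ℝ g x) :
    gr h (fun z => f z * g z) x = f x * gr h g x + g x * gr h f x := by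
  rw [gr_comm, gr_mul_left hf hg, gr_comm g, gr_comm f]

theorem gr_comp_left {k : ℝ → ℝ} {k' : ℝ} (hk : HasDerivAt k k' (f x))
    (hf : DifferentiableAt ℝ f x) : gr (fun z => k (f z)) h x = k' * gr f h x := by
  simp only [gr, pd_comp _ hk hf, Finset.mul_sum, mul_assoc]

theorem gr_comp_right {k : ℝ → ℝ} {k' : ℝ} (hk : HasDerivAt k k' (f x))
    (hf : DifferentiableAt ℝ f x) : gr h (fun z => k (f z)) x = k' * gr h f x := by
  rw [gr_comm, gr_comp_left hk hf, gr_comm]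

theorem contDiffAt_pd {m k : WithTop ℕ∞} (hf : ContDiffAt ℝ k f x) (hm : m + 1 ≤ k)
    (i : Fin n) : ContDiffAt ℝ m (pd i f) x :=
  (hf.fderiv_right hm).clm_apply contDiffAt_const

theorem contDiff_pd {m k : WithTop ℕ∞} (hf : ContDiff ℝ k f) (hm : m + 1 ≤ k)
    (i : Fin n) : ContDiff ℝ m (pd i f) :=
  (hf.fderiv_right hm).clm_apply contDiff_const

theorem contDiffOn_pd {m k : WithTop ℕ∞} (hf : ContDiffOn ℝ k f U) (hU : IsOpen U)
    (hm : m + 1 ≤ k) (i : Fin n) : ContDiffOn ℝ m (pd i f) U :=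
  fun _ hz => (contDiffAt_pd (hf.contDiffAt (hU.mem_nhds hz)) hm i).contDiffWithinAt

theorem lapl_mul (hf : ContDiffAt ℝ 2 f x) (hg : ContDiffAt ℝ 2 g x) :
    lapl (fun z => f z * g z) x = f x * lapl g x + 2 * gr f g x + g x * lapl f x := by
  have hf' : ∀ᶠ z in nhds x, DifferentiableAt ℝ f z :=
    (hf.eventually (by simp)).mono fun _ hz => hz.differentiableAt (by simp)
  have hg' : ∀ᶠ z in nhds x, DifferentiableAt ℝ g z :=
    (hg.eventually (by simp)).mono fun _ hz => hz.differentiableAt (by simp)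
  have hdf := hf.differentiableAt (by simp)
  have hdg := hg.differentiableAt (by simp)
  have h2f : ∀ i, DifferentiableAt ℝ (pd i f) x := fun i =>
    (contDiffAt_pd (m := 1) hf (by norm_num) i).differentiableAt (by simp)
  have h2g : ∀ i, DifferentiableAt ℝ (pd i g) x := fun i =>
    (contDiffAt_pd (m := 1) hg (by norm_num) i).differentiableAt (by simp)
  simp only [lapl_eq_sum_pd, gr, Finset.mul_sum, ← Finset.sum_add_distrib]
  refine Finset.sum_congr rfl fun i _ => ?_
  have : pd i (fun z => f z * g z) =ᶠ[nhds x]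
      fun z => f z * pd i g z + g z * pd i f z := by
    filter_upwards [hf', hg'] with z h1 h2 using pd_mul i h1 h2
  rw [pd_congr i this, pd_add (f := fun z => f z * pd i g z) (g := fun z => g z * pd i f z) i
    (hdf.mul (h2g i)) (hdg.mul (h2f i)), pd_mul i hdf (h2g i),
    pd_mul i hdg (h2f i)]
  ring

theorem lapl_comp {k k' k'' : ℝ → ℝ} (hk : ∀ s, HasDerivAt k (k' s) s)
    (hk' : ∀ s, HasDerivAt k' (k'' s) s) (hf : ContDiffAt ℝ 2 f x) :
    lapl (fun z => k (f z)) x = k' (f x) * lapl f x + k'' (f x) * gr f f x := by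
  have hf' : ∀ᶠ z in nhds x, DifferentiableAt ℝ f z :=
    (hf.eventually (by simp)).mono fun _ hz => hz.differentiableAt (by simp)
  have hdf := hf.differentiableAt (by simp)
  simp only [lapl_eq_sum_pd, gr, Finset.mul_sum, ← Finset.sum_add_distrib]
  refine Finset.sum_congr rfl fun i _ => ?_
  have : pd i (fun z => k (f z)) =ᶠ[nhds x] fun z => k' (f z) * pd i f z := by
    filter_upwards [hf'] with z h1 using pd_comp i (hk _) h1
  rw [pd_congr i this, pd_mul (f := fun z => k' (f z)) i
    ((hk' _).differentiableAt.comp x hdf)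
    ((contDiffAt_pd (m := 1) hf (by norm_num) i).differentiableAt (by simp)),
    pd_comp i (hk' _) hdf]
  ring

theorem lapl_add (hf : ContDiffAt ℝ 2 f x) (hg : ContDiffAt ℝ 2 g x) :
    lapl (fun z => f z + g z) x = lapl f x + lapl g x := by
  have hf' : ∀ᶠ z in nhds x, DifferentiableAt ℝ f z :=
    (hf.eventually (by simp)).mono fun _ hz => hz.differentiableAt (by simp)
  have hg' : ∀ᶠ z in nhds x, DifferentiableAt ℝ g z :=
    (hg.eventually (by simp)).mono fun _ hz => hz.differentiableAt (by simp)
  simp only [lapl_eq_sum_pd, ← Finset.sum_add_distrib]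
  refine Finset.sum_congr rfl fun i _ => ?_
  have : pd i (fun z => f z + g z) =ᶠ[nhds x] fun z => pd i f z + pd i g z := by
    filter_upwards [hf', hg'] with z h1 h2 using pd_add i h1 h2
  rw [pd_congr i this, pd_add i ((contDiffAt_pd (m := 1) hf (by norm_num) i).differentiableAt (by simp))
    ((contDiffAt_pd (m := 1) hg (by norm_num) i).differentiableAt (by simp))]

theorem lapl_const_mul (c : ℝ) (f : EuclideanSpace ℝ (Fin n) → ℝ) :
    lapl (fun z => c * f z) x = c * lapl f x := by
  simp only [lapl_eq_sum_pd, Finset.mul_sum]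
  refine Finset.sum_congr rfl fun i _ => ?_
  rw [show pd i (fun z => c * f z) = fun z => c * pd i f z from
    funext fun z => pd_const_mul i c f, pd_const_mul]

theorem lapl_const (c : ℝ) : lapl (fun _ => c) x = 0 := by
  have := lapl_const_mul (x := x) 0 (fun _ => c)
  simp only [lapl_eq_sum_pd]
  refine Finset.sum_eq_zero fun i _ => ?_
  rw [show pd i (fun _ : EuclideanSpace ℝ (Fin n) => c) = fun _ => 0 from
    funext fun z => pd_const i c, pd_const]

theorem gr_const_mul_left (c : ℝ) : gr (fun z => c * f z) g x = c * gr f g x := by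
  simp only [gr, pd_const_mul, Finset.mul_sum, mul_assoc]

theorem gr_const_mul_right (c : ℝ) : gr f (fun z => c * g z) x = c * gr f g x := by
  rw [gr_comm, gr_const_mul_left, gr_comm]

theorem gr_const_left (c : ℝ) : gr (fun _ => c) g x = 0 := by
  simp [gr, pd_const]

theorem gr_const_right (c : ℝ) : gr g (fun _ => c) x = 0 := by
  simp [gr, pd_const]

theorem gr_add_left (hf : DifferentiableAt ℝ f x) (hg : DifferentiableAt ℝ g x) :
    gr (fun z => f z + g z) h x = gr f h x + gr g h x := by
  simp only [gr, pd_add _ hf hg, ← Finset.sum_add_distrib, add_mul]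

theorem gr_add_right (hf : DifferentiableAt ℝ f x) (hg : DifferentiableAt ℝ g x) :
    gr h (fun z => f z + g z) x = gr h f x + gr h g x := by
  rw [gr_comm, gr_add_left hf hg, gr_comm f, gr_comm g]

/-- The squared distance to `a`. -/
noncomputable def sqd (a x : EuclideanSpace ℝ (Fin n)) : ℝ := ‖x - a‖ ^ 2

theorem contDiff_sqd (a : EuclideanSpace ℝ (Fin n)) {k : WithTop ℕ∞} : ContDiff ℝ k (sqd a) :=
  (contDiff_id.sub contDiff_const).norm_sq ℝ

theorem sqd_nonneg (a x : EuclideanSpace ℝ (Fin n)) : 0 ≤ sqd a x := sq_nonneg _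

theorem pd_sqd (i : Fin n) (a x : EuclideanSpace ℝ (Fin n)) :
    pd i (sqd a) x = 2 * (x i - a i) := by
  unfold pd
  have h : HasFDerivAt (sqd a) (2 • (innerSL ℝ (x - a)).comp
      (ContinuousLinearMap.id ℝ (EuclideanSpace ℝ (Fin n)))) x :=
    ((hasFDerivAt_id x).sub_const a).norm_sq
  rw [h.fderiv]
  simp [EuclideanSpace.inner_single_right]

theorem pd_coord (i : Fin n) (c : ℝ) : pd i (fun z : EuclideanSpace ℝ (Fin n) => z i - c) x = 1 := by
  unfold pd
  have : HasFDerivAt (fun z : EuclideanSpace ℝ (Fin n) => z i - c)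
    (EuclideanSpace.proj i : EuclideanSpace ℝ (Fin n) →L[ℝ] ℝ) x :=
      (EuclideanSpace.proj i : EuclideanSpace ℝ (Fin n) →L[ℝ] ℝ).hasFDerivAt.sub_const c
  rw [this.fderiv]
  simp

theorem lapl_sqd (a x : EuclideanSpace ℝ (Fin n)) : lapl (sqd a) x = 2 * n := by
  have : ∀ i : Fin n, pd i (sqd a) = fun z => 2 * (z i - a i) := fun i => funext fun z => pd_sqd i a z
  simp only [lapl_eq_sum_pd, this, pd_const_mul, pd_coord]
  simp [mul_comm]

theorem gr_sqd_sqd (a x : EuclideanSpace ℝ (Fin n)) : gr (sqd a) (sqd a) x = 4 * sqd a x := by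
  simp only [gr, pd_sqd, sqd, EuclideanSpace.norm_sq_eq, Finset.mul_sum]
  refine Finset.sum_congr rfl fun i _ => ?_
  simp only [PiLp.sub_apply, Real.norm_eq_abs, sq_abs]
  ring

theorem fderiv_eq_sum_pd (f : EuclideanSpace ℝ (Fin n) → ℝ) (x v : EuclideanSpace ℝ (Fin n)) :
    fderiv ℝ f x v = ∑ i, v i * pd i f x := by
  have hv : v = ∑ i, v i • EuclideanSpace.single i (1:ℝ) := by
    ext j
    simp [Pi.single_apply, Finset.sum_apply]
  conv_lhs => rw [hv]
  simp [map_sum, pd]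

theorem gr_sqd_left (a : EuclideanSpace ℝ (Fin n)) (f : EuclideanSpace ℝ (Fin n) → ℝ)
    (x : EuclideanSpace ℝ (Fin n)) : gr (sqd a) f x = 2 * fderiv ℝ f x (x - a) := by
  rw [fderiv_eq_sum_pd, gr, Finset.mul_sum]
  refine Finset.sum_congr rfl fun i _ => ?_
  rw [pd_sqd]; simp; ring

end Calculus

/-! ### Vanishing integrals and the divergence theorem -/

/-- `g` is integrable on `U` with vanishing integral. -/
def IZ {n : ℕ} (U : Set (EuclideanSpace ℝ (Fin n))) (g : EuclideanSpace ℝ (Fin n) → ℝ) : Prop :=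
  IntegrableOn g U ∧ ∫ x in U, g x = 0

section IZ

variable {n : ℕ} {U : Set (EuclideanSpace ℝ (Fin n))} {f g : EuclideanSpace ℝ (Fin n) → ℝ}

theorem IZ.add (hf : IZ U f) (hg : IZ U g) : IZ U (fun x => f x + g x) :=
  ⟨hf.1.add hg.1, by rw [integral_add hf.1 hg.1, hf.2, hg.2, add_zero]⟩

theorem IZ.const_mul (c : ℝ) (hf : IZ U f) : IZ U (fun x => c * f x) :=
  ⟨hf.1.const_mul c, by rw [integral_const_mul, hf.2, mul_zero]⟩

theorem IZ.congr (hU : MeasurableSet U) (hf : IZ U f) (h : ∀ x ∈ U, f x = g x) : IZ U g :=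
  ⟨hf.1.congr_fun h hU, by rw [← setIntegral_congr_fun hU h, hf.2]⟩

theorem IZ.sum {ι : Type*} (s : Finset ι) {F : ι → EuclideanSpace ℝ (Fin n) → ℝ}
    (hF : ∀ i ∈ s, IZ U (F i)) : IZ U (fun x => ∑ i ∈ s, F i x) :=
  ⟨integrable_finsetSum s fun i hi => (hF i hi).1, by
    rw [integral_finsetSum s fun i hi => (hF i hi).1]
    exact Finset.sum_eq_zero fun i hi => (hF i hi).2⟩

theorem IZ.integral_add_eq (hf : IZ U f) (hg : IntegrableOn g U) :
    ∫ x in U, (f x + g x) = ∫ x in U, g x := by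
  rw [integral_add hf.1 hg, hf.2, zero_add]

end IZ

section Divergence

variable {n : ℕ} {U : Set (EuclideanSpace ℝ (Fin n))}

theorem integral_pd_eq_zero {g : EuclideanSpace ℝ (Fin n) → ℝ} (hg : ContDiff ℝ 1 g)
    (hc : HasCompactSupport g) (i : Fin n) : Integrable (pd i g) ∧ ∫ x, pd i g x = 0 := by
  have hcont : Continuous (pd i g) := (contDiff_pd (m := 0) hg (by norm_num) i).continuous
  have hcs : HasCompactSupport (pd i g) := hc.fderiv_apply (𝕜 := ℝ) _
  have hi := hcont.integrable_of_hasCompactSupport (μ := volume) hcs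
  refine ⟨hi, ?_⟩
  have hgi := hg.continuous.integrable_of_hasCompactSupport (μ := volume) hc
  have := integral_mul_fderiv_eq_neg_fderiv_mul_of_integrable (𝕜 := ℝ)
    (μ := (volume : Measure (EuclideanSpace ℝ (Fin n))))
    (f := fun _ => (1:ℝ)) (g := g) (v := EuclideanSpace.single i (1:ℝ)) (by simp)
    (by simp only [one_mul]; exact hi) (by simpa using hgi) (fun _ _ => differentiableAt_const _)
    (fun x _ => hg.differentiable (by simp) x)
  simpa [pd] using this

theorem contDiff_mul_of_tsupport_subset {v w : EuclideanSpace ℝ (Fin n) → ℝ} {k : WithTop ℕ∞}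
    (hv : ContDiff ℝ k v) (hU : IsOpen U) (hsub : tsupport v ⊆ U) (hw : ContDiffOn ℝ k w U) :
    ContDiff ℝ k (fun x => v x * w x) := by
  rw [contDiff_iff_contDiffAt]
  intro x
  by_cases hx : x ∈ tsupport v
  · exact hv.contDiffAt.mul (hw.contDiffAt (hU.mem_nhds (hsub hx)))
  · have : (fun x => v x * w x) =ᶠ[nhds x] fun _ => 0 := by
      filter_upwards [(isClosed_tsupport v).isOpen_compl.mem_nhds hx] with z hz
      rw [image_eq_zero_of_notMem_tsupport hz, zero_mul]
    exact contDiffAt_const.congr_of_eventuallyEq this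

theorem IZ.of_tsupport {g : EuclideanSpace ℝ (Fin n) → ℝ} (hg : ContDiff ℝ 1 g)
    (hc : HasCompactSupport g) (hsub : tsupport g ⊆ U) (i : Fin n) : IZ U (pd i g) := by
  obtain ⟨h1, h2⟩ := integral_pd_eq_zero hg hc i
  refine ⟨h1.integrableOn, ?_⟩
  rw [setIntegral_eq_integral_of_forall_compl_eq_zero, h2]
  intro x hx
  have hx' : x ∉ tsupport g := fun h => hx (hsub h)
  have : g =ᶠ[nhds x] fun _ => 0 := by
    filter_upwards [(isClosed_tsupport g).isOpen_compl.mem_nhds hx'] with z hz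
      using image_eq_zero_of_notMem_tsupport hz
  rw [pd_congr i this, pd_const]

theorem IZ.div_of_tsupport (hU : IsOpen U) {v : EuclideanSpace ℝ (Fin n) → ℝ}
    (hv : ContDiff ℝ 1 v) (hc : HasCompactSupport v) (hsub : tsupport v ⊆ U)
    {W : Fin n → EuclideanSpace ℝ (Fin n) → ℝ} (hW : ∀ i, ContDiffOn ℝ 1 (W i) U) :
    IZ U (fun x => v x * ∑ i, pd i (W i) x + ∑ i, pd i v x * W i x) := by
  have h : ∀ i ∈ Finset.univ, IZ U (pd i fun x => v x * W i x) := fun i _ =>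
    IZ.of_tsupport (contDiff_mul_of_tsupport_subset hv hU hsub (hW i)) hc.mul_right
      ((tsupport_mul_subset_left).trans hsub) i
  refine (IZ.sum Finset.univ h).congr hU.measurableSet fun x hx => ?_
  rw [Finset.mul_sum, ← Finset.sum_add_distrib]
  refine Finset.sum_congr rfl fun i _ => ?_
  rw [pd_mul i (hv.differentiable (by simp) x)
    (((hW i).contDiffAt (hU.mem_nhds hx)).differentiableAt (by simp))]
  ring

end Divergence

/-! ### Truncation -/

/-- A smooth truncation of the identity, vanishing near `0`. -/
noncomputable def tau (δ s : ℝ) : ℝ := s * Real.smoothTransition (s ^ 2 / δ ^ 2 - 1)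

theorem contDiff_tau (δ : ℝ) {k : ℕ∞} : ContDiff ℝ k (tau δ) :=
  contDiff_id.mul (Real.smoothTransition.contDiff.comp
    (((contDiff_id.pow 2).div_const _).sub contDiff_const))

theorem abs_tau_le (δ s : ℝ) : |tau δ s| ≤ |s| := by
  rw [tau, abs_mul, abs_of_nonneg (Real.smoothTransition.nonneg _)]
  exact mul_le_of_le_one_right (abs_nonneg _) (Real.smoothTransition.le_one _)

theorem tau_eq_zero {δ s : ℝ} (hδ : 0 < δ) (h : |s| ≤ δ) : tau δ s = 0 := by
  rw [tau, Real.smoothTransition.zero_of_nonpos, mul_zero]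
  rw [sub_nonpos, div_le_one (by positivity), ← sq_abs]
  gcongr

theorem tau_eq_self {δ s : ℝ} (hδ : 0 < δ) (h : 2 * δ ^ 2 ≤ s ^ 2) : tau δ s = s := by
  rw [tau, Real.smoothTransition.one_of_one_le, mul_one]
  rw [le_sub_iff_add_le, le_div_iff₀ (by positivity)]
  linarith

theorem deriv_smoothTransition_nonneg (s : ℝ) : 0 ≤ deriv Real.smoothTransition s := by
  have : Monotone Real.smoothTransition := by
    intro a b hab
    unfold Real.smoothTransition
    have h1 : expNegInvGlue a ≤ expNegInvGlue b := expNegInvGlue.monotone hab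
    have h2 : expNegInvGlue (1 - b) ≤ expNegInvGlue (1 - a) :=
      expNegInvGlue.monotone (by linarith)
    rw [div_le_div_iff₀ (Real.smoothTransition.pos_denom a) (Real.smoothTransition.pos_denom b)]
    nlinarith [expNegInvGlue.nonneg a, expNegInvGlue.nonneg b, expNegInvGlue.nonneg (1 - a),
      expNegInvGlue.nonneg (1 - b)]
  exact this.deriv_nonneg

theorem deriv_smoothTransition_of_one_lt {s : ℝ} (hs : 1 < s) :
    deriv Real.smoothTransition s = 0 := by
  have : Real.smoothTransition =ᶠ[nhds s] fun _ => 1 := by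
    filter_upwards [lt_mem_nhds hs] with z hz using Real.smoothTransition.one_of_one_le hz.le
  rw [this.deriv_eq, deriv_const]

theorem hasDerivAt_tau (δ s : ℝ) : HasDerivAt (tau δ)
    (Real.smoothTransition (s ^ 2 / δ ^ 2 - 1) +
      2 * (s ^ 2 / δ ^ 2) * deriv Real.smoothTransition (s ^ 2 / δ ^ 2 - 1)) s := by
  have hst : HasDerivAt Real.smoothTransition (deriv Real.smoothTransition (s ^ 2 / δ ^ 2 - 1))
      (s ^ 2 / δ ^ 2 - 1) :=
    ((Real.smoothTransition.contDiff (n := 1)).differentiable (by simp) _).hasDerivAt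
  have h1 : HasDerivAt (fun s : ℝ => s ^ 2 / δ ^ 2 - 1) (2 * s / δ ^ 2) s := by
    simpa using ((hasDerivAt_pow 2 s).div_const (δ ^ 2)).sub_const 1
  have := (hasDerivAt_id s).mul (hst.comp s h1)
  refine this.congr_deriv ?_
  simp only [id, Function.comp]
  ring

theorem deriv_tau_nonneg (δ s : ℝ) : 0 ≤ deriv (tau δ) s := by
  rw [(hasDerivAt_tau δ s).deriv]
  have := deriv_smoothTransition_nonneg (s ^ 2 / δ ^ 2 - 1)
  have := Real.smoothTransition.nonneg (s ^ 2 / δ ^ 2 - 1)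
  positivity

theorem exists_deriv_tau_le : ∃ M : ℝ, 0 < M ∧ ∀ δ s : ℝ, |deriv (tau δ) s| ≤ M := by
  have hc : Continuous fun r : ℝ => deriv Real.smoothTransition (r - 1) :=
    ((Real.smoothTransition.contDiff (n := 1)).continuous_deriv (by simp)).comp (by fun_prop)
  obtain ⟨M, hM⟩ := (isCompact_Icc (a := (0:ℝ)) (b := 2)).exists_bound_of_continuousOn
    hc.continuousOn
  have hM0 : 0 ≤ M := (norm_nonneg _).trans (hM 0 (by simp))
  refine ⟨1 + 4 * M, by positivity, fun δ s => ?_⟩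
  rw [abs_of_nonneg (deriv_tau_nonneg δ s), (hasDerivAt_tau δ s).deriv]
  set r := s ^ 2 / δ ^ 2
  have hr : 0 ≤ r := by positivity
  have h1 := Real.smoothTransition.le_one (r - 1)
  rcases le_or_gt r 2 with h | h
  · have h2 := hM r ⟨hr, h⟩
    rw [Real.norm_eq_abs, abs_of_nonneg (deriv_smoothTransition_nonneg _)] at h2
    have : r * deriv Real.smoothTransition (r - 1) ≤ 2 * M :=
      mul_le_mul h h2 (deriv_smoothTransition_nonneg _) (by norm_num)
    linarith
  · rw [deriv_smoothTransition_of_one_lt (by linarith)]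
    linarith

theorem tau_zero (δ : ℝ) : tau δ 0 = 0 := by simp [tau]

/-- The truncation parameters `1/(k+1)`. -/
noncomputable def tdel (k : ℕ) : ℝ := 1 / (k + 1)

theorem tdel_pos (k : ℕ) : 0 < tdel k := by unfold tdel; positivity

theorem eventually_tdel_lt {a : ℝ} (ha : a ≠ 0) : ∀ᶠ k in atTop, 2 * tdel k ^ 2 < a ^ 2 := by
  have h : Tendsto (fun k => 2 * tdel k ^ 2) atTop (nhds (2 * 0 ^ 2)) :=
    (tendsto_one_div_add_atTop_nhds_zero_nat.pow 2).const_mul 2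
  exact h.eventually (gt_mem_nhds (by have := sq_pos_of_ne_zero ha; simpa using this))

theorem tendsto_tau (s : ℝ) : Tendsto (fun k => tau (tdel k) s) atTop (nhds s) := by
  rcases eq_or_ne s 0 with rfl | hs
  · simp [tau_zero]
  · refine tendsto_const_nhds.congr' ?_
    filter_upwards [eventually_tdel_lt hs] with k hk using (tau_eq_self (tdel_pos k) hk.le).symm

theorem tendsto_deriv_tau {s : ℝ} (hs : s ≠ 0) :
    Tendsto (fun k => deriv (tau (tdel k)) s) atTop (nhds 1) := by
  refine tendsto_const_nhds.congr' ?_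
  filter_upwards [eventually_tdel_lt hs] with k hk
  have : tau (tdel k) =ᶠ[nhds s] id := by
    have : ∀ᶠ z in nhds s, 2 * tdel k ^ 2 < z ^ 2 :=
      (continuous_pow 2).continuousAt.eventually (lt_mem_nhds hk)
    filter_upwards [this] with z hz using tau_eq_self (tdel_pos k) hz.le
  rw [this.deriv_eq, deriv_id]

section Truncation

variable {n : ℕ} {U : Set (EuclideanSpace ℝ (Fin n))} {v : EuclideanSpace ℝ (Fin n) → ℝ}

theorem tau_comp_support (hb : Bornology.IsBounded U) (hv : Continuous v)
    (hv0 : ∀ x ∉ U, v x = 0) {δ : ℝ} (hδ : 0 < δ) :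
    HasCompactSupport (fun x => tau δ (v x)) ∧ tsupport (fun x => tau δ (v x)) ⊆ U := by
  have hcl : IsClosed {x | δ ≤ |v x|} := isClosed_le continuous_const hv.abs
  have h1 : tsupport (fun x => tau δ (v x)) ⊆ {x | δ ≤ |v x|} := by
    refine closure_minimal (fun x hx => ?_) hcl
    by_contra h
    exact hx (tau_eq_zero hδ (not_le.1 h).le)
  have h2 : {x | δ ≤ |v x|} ⊆ U := by
    intro x hx
    by_contra h
    have : δ ≤ |v x| := hx
    rw [hv0 x h, abs_zero] at this
    linarith
  refine ⟨?_, h1.trans h2⟩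
  exact isCompact_of_isClosed_isBounded (isClosed_tsupport _) (hb.subset (h1.trans h2))

theorem contDiff_tau_comp (hU : IsOpen U) (hv : Continuous v)
    (hv0 : ∀ x ∉ U, v x = 0) {k : ℕ∞} (hv1 : ContDiffOn ℝ k v U) {δ : ℝ} (hδ : 0 < δ) :
    ContDiff ℝ k (fun x => tau δ (v x)) := by
  rw [contDiff_iff_contDiffAt]
  intro x
  by_cases hx : x ∈ U
  · exact (contDiff_tau δ).contDiffAt.comp x (hv1.contDiffAt (hU.mem_nhds hx))
  · have : ∀ᶠ z in nhds x, |v z| < δ :=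
      hv.abs.continuousAt.eventually (gt_mem_nhds (by simpa [hv0 x hx] using hδ))
    have : (fun x => tau δ (v x)) =ᶠ[nhds x] fun _ => 0 := by
      filter_upwards [this] with z hz using tau_eq_zero hδ hz.le
    exact contDiffAt_const.congr_of_eventuallyEq this

/-- The gradient vanishes almost everywhere on a level set. -/
theorem ae_pd_eq_zero_of_eq_zero (hU : IsOpen U) (hv : Continuous v) (hv1 : ContDiffOn ℝ 1 v U) :
    ∀ᵐ x ∂volume.restrict U, v x = 0 → ∀ i, pd i v x = 0 := by
  rcases Nat.eq_zero_or_pos n with h0 | hn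
  · subst h0
    exact Eventually.of_forall fun x _ i => i.elim0
  let e : EuclideanSpace ℝ (Fin n) := EuclideanSpace.single ⟨0, hn⟩ 1
  have hs : MeasurableSet ({x | v x = 0} ∩ U) :=
    (hv.measurable (measurableSet_singleton 0)).inter hU.measurableSet
  have hA : ApproximatesLinearOn (fun x => v x • e)
      (0 : EuclideanSpace ℝ (Fin n) →L[ℝ] EuclideanSpace ℝ (Fin n)) ({x | v x = 0} ∩ U) 0 := by
    intro x hx y hy
    simp [show v x = 0 from hx.1, show v y = 0 from hy.1]
  have hf' : ∀ x ∈ {x | v x = 0} ∩ U, HasFDerivWithinAt (fun x => v x • e)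
      ((fderiv ℝ v x).smulRight e) ({x | v x = 0} ∩ U) x := fun x hx =>
    ((((hv1.contDiffAt (hU.mem_nhds hx.2)).differentiableAt (by simp)).hasFDerivAt).smul_const
      e).hasFDerivWithinAt
  have := hA.norm_fderiv_sub_le volume hs (fun x => (fderiv ℝ v x).smulRight e) hf'
  rw [ae_restrict_iff' hs] at this
  rw [ae_restrict_iff' hU.measurableSet]
  filter_upwards [this] with x hx hxU hvx i
  have h := hx ⟨hvx, hxU⟩
  have h' : (fderiv ℝ v x).smulRight e = 0 := by
    simpa only [sub_zero, nonpos_iff_eq_zero, nnnorm_eq_zero] using h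
  have h2 := congrArg (fun L => L (EuclideanSpace.single i 1)) h'
  simpa [e, pd] using h2

end Truncation

/-- Fatou's lemma for real-valued nonnegative functions. -/
theorem integrable_and_integral_le_of_tendsto {α : Type*} [MeasurableSpace α] {μ : Measure α}
    {G : ℕ → α → ℝ} {f : α → ℝ} {C : ℕ → ℝ} {c : ℝ} (hnn : ∀ k, 0 ≤ᵐ[μ] G k)
    (hG : ∀ k, Integrable (G k) μ)
    (hlim : ∀ᵐ x ∂μ, Tendsto (fun k => G k x) atTop (nhds (f x)))
    (hC : ∀ k, ∫ x, G k x ∂μ ≤ C k) (hc : Tendsto C atTop (nhds c)) :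
    Integrable f μ ∧ ∫ x, f x ∂μ ≤ c := by
  have hfm : AEStronglyMeasurable f μ :=
    aestronglyMeasurable_of_tendsto_ae _ (fun k => (hG k).aestronglyMeasurable) hlim
  have hf0 : 0 ≤ᵐ[μ] f := by
    filter_upwards [hlim, ae_all_iff.2 hnn] with x hx h0
    exact ge_of_tendsto' hx h0
  have hc0 : 0 ≤ c := ge_of_tendsto' hc fun k => (integral_nonneg_of_ae (hnn k)).trans (hC k)
  have key : ∫⁻ x, ENNReal.ofReal (f x) ∂μ ≤ ENNReal.ofReal c := by
    calc ∫⁻ x, ENNReal.ofReal (f x) ∂μ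
        = ∫⁻ x, liminf (fun k => ENNReal.ofReal (G k x)) atTop ∂μ := by
          refine lintegral_congr_ae ?_
          filter_upwards [hlim] with x hx
          exact ((ENNReal.continuous_ofReal.tendsto _).comp hx).liminf_eq.symm
      _ ≤ liminf (fun k => ∫⁻ x, ENNReal.ofReal (G k x) ∂μ) atTop :=
          lintegral_liminf_le' fun k => (hG k).aestronglyMeasurable.aemeasurable.ennreal_ofReal
      _ ≤ liminf (fun k => ENNReal.ofReal (C k)) atTop := by
          refine liminf_le_liminf (Eventually.of_forall fun k => ?_)
          rw [← ofReal_integral_eq_lintegral_ofReal (hG k) (hnn k)]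
          exact ENNReal.ofReal_le_ofReal (hC k)
      _ = ENNReal.ofReal c := ((ENNReal.continuous_ofReal.tendsto _).comp hc).liminf_eq
  have hfi : Integrable f μ := by
    refine ⟨hfm, ?_⟩
    rw [hasFiniteIntegral_iff_ofReal hf0]
    exact key.trans_lt ENNReal.ofReal_lt_top
  refine ⟨hfi, ?_⟩
  rw [← ofReal_integral_eq_lintegral_ofReal hfi hf0] at key
  exact (ENNReal.ofReal_le_ofReal_iff hc0).1 key

/-- Square integrability on a set. -/
def L2 {n : ℕ} (U : Set (EuclideanSpace ℝ (Fin n))) (f : EuclideanSpace ℝ (Fin n) → ℝ) : Prop :=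
  MemLp f 2 (volume.restrict U)

section L2

variable {n : ℕ} {U : Set (EuclideanSpace ℝ (Fin n))} {f g v : EuclideanSpace ℝ (Fin n) → ℝ}

theorem L2.mul (hf : L2 U f) (hg : L2 U g) : IntegrableOn (fun x => f x * g x) U :=
  MemLp.integrable_mul hf hg

theorem L2.add (hf : L2 U f) (hg : L2 U g) : L2 U (fun x => f x + g x) := MemLp.add hf hg

theorem L2.sub (hf : L2 U f) (hg : L2 U g) : L2 U (fun x => f x - g x) := MemLp.sub hf hg

theorem L2.const_mul (hf : L2 U f) (c : ℝ) : L2 U (fun x => c * f x) := MemLp.const_mul hf c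

theorem L2.sum {ι : Type*} (s : Finset ι) {F : ι → EuclideanSpace ℝ (Fin n) → ℝ}
    (hF : ∀ i, L2 U (F i)) : L2 U (fun x => ∑ i ∈ s, F i x) :=
  memLp_finsetSum s fun i _ => hF i

theorem L2.congr (hU : MeasurableSet U) (hf : L2 U f) (h : ∀ x ∈ U, f x = g x) : L2 U g :=
  (memLp_congr_ae ((ae_restrict_iff' hU).2 (Eventually.of_forall h))).1 hf

theorem exists_bound_of_isBounded (hb : Bornology.IsBounded U) (hf : Continuous f) :
    ∃ C, 0 ≤ C ∧ ∀ x ∈ U, |f x| ≤ C := by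
  obtain ⟨C, hC⟩ := (hb.isCompact_closure).exists_bound_of_continuousOn hf.continuousOn
  exact ⟨max C 0, le_max_right _ _, fun x hx => (hC x (subset_closure hx)).trans (le_max_left _ _)⟩

theorem ContinuousOn.L2_of_bound (hU : IsOpen U) (hb : Bornology.IsBounded U)
    (hf : ContinuousOn f U) {C : ℝ} (hC : ∀ x ∈ U, |f x| ≤ C) : L2 U f := by
  have : IsFiniteMeasure (volume.restrict U) := ⟨by simpa using hb.measure_lt_top⟩
  exact MemLp.of_bound (hf.aestronglyMeasurable hU.measurableSet) C
    ((ae_restrict_iff' hU.measurableSet).2 (Eventually.of_forall hC))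

theorem Continuous.L2 (hU : IsOpen U) (hb : Bornology.IsBounded U) (hf : Continuous f) :
    L2 U f := by
  obtain ⟨C, -, hC⟩ := exists_bound_of_isBounded hb hf
  exact hf.continuousOn.L2_of_bound hU hb hC

theorem L2.bdd_mul (hU : IsOpen U) (hb : Bornology.IsBounded U) (hf : Continuous f)
    (hg : L2 U g) : L2 U (fun x => f x * g x) := by
  obtain ⟨C, -, hC⟩ := exists_bound_of_isBounded hb hf
  refine MemLp.of_le_mul (c := C) hg
    (hf.aestronglyMeasurable.mul hg.aestronglyMeasurable) ?_
  rw [ae_restrict_iff' hU.measurableSet]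
  refine Eventually.of_forall fun x hx => ?_
  rw [norm_mul]
  exact mul_le_mul_of_nonneg_right (hC x hx) (norm_nonneg _)

theorem integrableOn_bdd_mul (hU : IsOpen U) (hb : Bornology.IsBounded U) (hf : Continuous f)
    (hg : IntegrableOn g U) : IntegrableOn (fun x => f x * g x) U := by
  obtain ⟨C, -, hC⟩ := exists_bound_of_isBounded hb hf
  refine Integrable.bdd_mul hg hf.aestronglyMeasurable (c := C) ?_
  rw [ae_restrict_iff' hU.measurableSet]
  exact Eventually.of_forall hC

theorem L2.integrableOn_gr (hf : ∀ i, L2 U (pd i f)) (hg : ∀ i, L2 U (pd i g)) : IntegrableOn (gr f g) U :=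
  integrable_finsetSum _ fun i _ => (hf i).mul (hg i)

theorem pd_sq_le_gr (f : EuclideanSpace ℝ (Fin n) → ℝ) (x : EuclideanSpace ℝ (Fin n)) (i : Fin n) :
    pd i f x ^ 2 ≤ gr f f x := by
  rw [sq]
  exact Finset.single_le_sum (f := fun i => pd i f x * pd i f x)
    (fun i _ => mul_self_nonneg _) (Finset.mem_univ i)

theorem pd_tau_comp {δ : ℝ} {x : EuclideanSpace ℝ (Fin n)} (hf : DifferentiableAt ℝ f x) (i : Fin n) :
    pd i (fun z => tau δ (f z)) x = deriv (tau δ) (f x) * pd i f x :=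
  pd_comp i ((hasDerivAt_tau δ _).differentiableAt.hasDerivAt) hf

theorem continuous_deriv_tau (δ : ℝ) : Continuous (deriv (tau δ)) :=
  (contDiff_tau δ (k := 1)).continuous_deriv (by simp)

/-- The divergence theorem for a function vanishing off a bounded open set. -/
theorem IZ.div (hU : IsOpen U) (hb : Bornology.IsBounded U) (hv : Continuous v)
    (hv0 : ∀ x ∉ U, v x = 0) (hv1 : ContDiffOn ℝ 1 v U) (hvg : ∀ i, L2 U (pd i v))
    {W : Fin n → EuclideanSpace ℝ (Fin n) → ℝ} (hW : ∀ i, ContDiffOn ℝ 1 (W i) U)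
    (hW2 : ∀ i, L2 U (W i)) (hd : L2 U (fun x => ∑ i, pd i (W i) x)) :
    IZ U (fun x => v x * ∑ i, pd i (W i) x + ∑ i, pd i v x * W i x) := by
  obtain ⟨M, hM0, hM⟩ := exists_deriv_tau_le
  have hvd : ∀ x ∈ U, DifferentiableAt ℝ v x := fun x hx =>
    (hv1.contDiffAt (hU.mem_nhds hx)).differentiableAt (by simp)
  have i1 : IntegrableOn (fun x => v x * ∑ i, pd i (W i) x) U := (hv.L2 hU hb).mul hd
  have i2 : IntegrableOn (fun x => ∑ i, pd i v x * W i x) U :=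
    integrable_finsetSum _ fun i _ => (hvg i).mul (hW2 i)
  refine ⟨i1.add i2, ?_⟩
  have hz : ∀ k, IZ U (fun x => tau (tdel k) (v x) * ∑ i, pd i (W i) x +
      deriv (tau (tdel k)) (v x) * ∑ i, pd i v x * W i x) := fun k => by
    obtain ⟨h1, h2⟩ := tau_comp_support hb hv hv0 (tdel_pos k)
    refine (IZ.div_of_tsupport hU (contDiff_tau_comp (k := 1) hU hv hv0 hv1 (tdel_pos k)) h1 h2
      hW).congr hU.measurableSet fun x hx => ?_
    simp only [pd_tau_comp (hvd x hx), Finset.mul_sum, mul_assoc]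
  have hlim : Tendsto (fun k => ∫ x in U, (tau (tdel k) (v x) * ∑ i, pd i (W i) x +
      deriv (tau (tdel k)) (v x) * ∑ i, pd i v x * W i x)) atTop
      (nhds (∫ x in U, (v x * ∑ i, pd i (W i) x + ∑ i, pd i v x * W i x))) := by
    refine tendsto_integral_of_dominated_convergence
      (fun x => ‖v x * ∑ i, pd i (W i) x‖ + M * ‖∑ i, pd i v x * W i x‖)
      (fun k => (hz k).1.aestronglyMeasurable) (i1.norm.add (i2.norm.const_mul M)) ?_ ?_
    · refine fun k => Eventually.of_forall fun x => (norm_add_le _ _).trans ?_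
      rw [norm_mul, norm_mul, norm_mul]
      gcongr
      · exact abs_tau_le _ _
      · exact hM _ _
    · filter_upwards [ae_pd_eq_zero_of_eq_zero hU hv hv1] with x hx
      by_cases h0 : v x = 0
      · simp [hx h0, h0, tau_zero]
      · simpa using ((tendsto_tau (v x)).mul_const _).add
          ((tendsto_deriv_tau h0).mul_const (∑ i, pd i v x * W i x))
  simp only [(hz _).2] at hlim
  exact tendsto_nhds_unique hlim tendsto_const_nhds |>.symm ▸ rfl

theorem contDiffOn_lapl (hU : IsOpen U) (hf : ContDiffOn ℝ 2 f U) : ContinuousOn (lapl f) U := by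
  have : lapl f = fun x => ∑ i, pd i (pd i f) x := rfl
  rw [this]
  exact continuousOn_finsetSum _ fun i _ => (contDiffOn_pd (m := 0)
    (contDiffOn_pd (m := 1) hf hU (by norm_num) i) hU (by norm_num) i).continuousOn

theorem continuousOn_pd (hU : IsOpen U) (hf : ContDiffOn ℝ 1 f U) (i : Fin n) :
    ContinuousOn (pd i f) U :=
  (contDiffOn_pd (m := 0) hf hU (by norm_num) i).continuousOn

theorem L2.pd_of_lapl (hU : IsOpen U) (hb : Bornology.IsBounded U) (hv : Continuous v)
    (hv0 : ∀ x ∉ U, v x = 0) (hv2 : ContDiffOn ℝ 2 v U)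
    (hi : IntegrableOn (fun x => v x * lapl v x) U) (i : Fin n) : L2 U (pd i v) := by
  have hv1 : ContDiffOn ℝ 1 v U := hv2.of_le (by norm_num)
  have hvd : ∀ x ∈ U, DifferentiableAt ℝ v x := fun x hx =>
    (hv1.contDiffAt (hU.mem_nhds hx)).differentiableAt (by simp)
  have hz : ∀ k, IZ U (fun x => tau (tdel k) (v x) * lapl v x +
      deriv (tau (tdel k)) (v x) * gr v v x) := fun k => by
    obtain ⟨h1, h2⟩ := tau_comp_support hb hv hv0 (tdel_pos k)
    refine (IZ.div_of_tsupport (W := fun i => pd i v) hU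
      (contDiff_tau_comp (k := 1) hU hv hv0 hv1 (tdel_pos k)) h1 h2
      fun i => contDiffOn_pd hv2 hU (by norm_num) i).congr hU.measurableSet fun x hx => ?_
    simp only [pd_tau_comp (hvd x hx), Finset.mul_sum, mul_assoc, lapl_eq_sum_pd, gr]
  have i1 : ∀ k, IntegrableOn (fun x => tau (tdel k) (v x) * lapl v x) U := fun k => by
    refine Integrable.mono hi ?_ (Eventually.of_forall fun x => ?_)
    · exact (((contDiff_tau _ (k := 0)).continuous.comp hv).continuousOn.mul
        (contDiffOn_lapl hU hv2)).aestronglyMeasurable hU.measurableSet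
    · rw [norm_mul, norm_mul]
      exact mul_le_mul_of_nonneg_right (abs_tau_le _ _) (norm_nonneg _)
  have i2 : ∀ k, IntegrableOn (fun x => deriv (tau (tdel k)) (v x) * gr v v x) U := fun k =>
    ((hz k).1.sub (i1 k)).congr (Eventually.of_forall fun x => by simp)
  have hle : ∀ k, ∫ x in U, deriv (tau (tdel k)) (v x) * gr v v x ≤
      ∫ x in U, ‖v x * lapl v x‖ := fun k => by
    have h1 := (hz k).2
    rw [integral_add (i1 k) (i2 k)] at h1
    have h2 : -∫ x in U, tau (tdel k) (v x) * lapl v x ≤ ∫ x in U, ‖v x * lapl v x‖ := by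
      rw [← integral_neg]
      refine integral_mono (i1 k).neg hi.norm fun x => ?_
      refine (neg_le_abs _).trans ?_
      rw [abs_mul, norm_mul]
      exact mul_le_mul_of_nonneg_right (abs_tau_le _ _) (abs_nonneg _)
    linarith
  have hgr : IntegrableOn (gr v v) U := by
    refine (integrable_and_integral_le_of_tendsto
      (fun k => Eventually.of_forall fun x => mul_nonneg (deriv_tau_nonneg _ _)
        (gr_self_nonneg v x)) i2 ?_ hle tendsto_const_nhds).1
    filter_upwards [ae_pd_eq_zero_of_eq_zero hU hv hv1] with x hx
    by_cases h0 : v x = 0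
    · simp [gr, hx h0]
    · simpa using (tendsto_deriv_tau h0).mul_const (gr v v x)
  have hm : AEStronglyMeasurable (pd i v) (volume.restrict U) :=
    (continuousOn_pd hU hv1 i).aestronglyMeasurable hU.measurableSet
  refine (memLp_two_iff_integrable_sq hm).2 (Integrable.mono hgr (hm.pow 2) (Eventually.of_forall fun x => ?_))
  rw [Real.norm_of_nonneg (sq_nonneg _), Real.norm_of_nonneg (gr_self_nonneg v x)]
  exact pd_sq_le_gr v x i

end L2

/-- Functions vanishing off `U`, twice continuously differentiable in `U`, with square integrable
gradient and Laplacian. -/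
structure H10 {n : ℕ} (U : Set (EuclideanSpace ℝ (Fin n))) (f : EuclideanSpace ℝ (Fin n) → ℝ) :
    Prop where
  cont : Continuous f
  zero : ∀ x ∉ U, f x = 0
  c2 : ContDiffOn ℝ 2 f U
  grad : ∀ i, L2 U (pd i f)
  lap : L2 U (lapl f)

section H10

variable {n : ℕ} {U : Set (EuclideanSpace ℝ (Fin n))} {f g u v w m : EuclideanSpace ℝ (Fin n) → ℝ}

theorem H10.contDiffAt (hf : H10 U f) (hU : IsOpen U) {x} (hx : x ∈ U) : ContDiffAt ℝ 2 f x :=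
  hf.c2.contDiffAt (hU.mem_nhds hx)

theorem H10.differentiableAt (hf : H10 U f) (hU : IsOpen U) {x} (hx : x ∈ U) :
    DifferentiableAt ℝ f x :=
  (hf.contDiffAt hU hx).differentiableAt (by simp)

theorem H10.differentiableAt_pd (hf : H10 U f) (hU : IsOpen U) {x} (hx : x ∈ U) (i : Fin n) :
    DifferentiableAt ℝ (pd i f) x :=
  (contDiffAt_pd (m := 1) (hf.contDiffAt hU hx) (by norm_num) i).differentiableAt (by simp)

theorem H10.of_lapl (hU : IsOpen U) (hb : Bornology.IsBounded U) (hf : Continuous f)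
    (hf0 : ∀ x ∉ U, f x = 0) (hf2 : ContDiffOn ℝ 2 f U) (hl : L2 U (lapl f)) : H10 U f :=
  ⟨hf, hf0, hf2, fun i => L2.pd_of_lapl hU hb hf hf0 hf2 ((hf.L2 hU hb).mul hl) i, hl⟩

theorem continuous_pd (hm : ContDiff ℝ 1 m) (i : Fin n) : Continuous (pd i m) :=
  (contDiff_pd (m := 0) hm (by norm_num) i).continuous

theorem continuous_lapl (hm : ContDiff ℝ 2 m) : Continuous (lapl m) := by
  have : lapl m = fun x => ∑ i, pd i (pd i m) x := rfl
  rw [this]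
  exact continuous_finsetSum _ fun i _ => continuous_pd (contDiff_pd (m := 1) hm (by norm_num) i) i

theorem continuous_gr (hf : ContDiff ℝ 1 f) (hg : ContDiff ℝ 1 g) : Continuous (gr f g) :=
  continuous_finsetSum _ fun i _ => (continuous_pd hf i).mul (continuous_pd hg i)

theorem H10.L2_gr_left (hf : H10 U f) (hU : IsOpen U) (hb : Bornology.IsBounded U)
    (hm : ContDiff ℝ 1 m) : L2 U (gr m f) :=
  L2.sum _ fun i => L2.bdd_mul hU hb (continuous_pd hm i) (hf.grad i)

theorem H10.L2 (hf : H10 U f) (hU : IsOpen U) (hb : Bornology.IsBounded U) : L2 U f :=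
  hf.cont.L2 hU hb

theorem H10.mul (hf : H10 U f) (hU : IsOpen U) (hb : Bornology.IsBounded U)
    (hm : ContDiff ℝ 2 m) : H10 U (fun x => m x * f x) := by
  have hm1 : ContDiff ℝ 1 m := hm.of_le (by norm_num)
  refine ⟨hm.continuous.mul hf.cont, fun x hx => by rw [hf.zero x hx, mul_zero],
    hm.contDiffOn.mul hf.c2, fun i => ?_, ?_⟩
  · refine L2.congr hU.measurableSet ((L2.bdd_mul hU hb hm.continuous (hf.grad i)).add
      (L2.bdd_mul hU hb hf.cont ((continuous_pd hm1 i).L2 hU hb))) fun x hx => ?_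
    exact (pd_mul i (hm1.differentiable (by simp) x) (hf.differentiableAt hU hx)).symm
  · refine L2.congr hU.measurableSet (((L2.bdd_mul hU hb hm.continuous hf.lap).add
      ((hf.L2_gr_left hU hb hm1).const_mul 2)).add
      (L2.bdd_mul hU hb hf.cont ((continuous_lapl hm).L2 hU hb))) fun x hx => ?_
    exact (lapl_mul hm.contDiffAt (hf.contDiffAt hU hx)).symm

/-- Green's formula with a weight. -/
theorem H10.green (hu : H10 U u) (hv : H10 U v) (hU : IsOpen U) (hb : Bornology.IsBounded U)
    (hm : ContDiff ℝ 2 m) :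
    IZ U (fun x => u x * (m x * lapl v x) + m x * gr u v x + u x * gr m v x) := by
  have hm1 : ContDiff ℝ 1 m := hm.of_le (by norm_num)
  have key : ∀ x ∈ U, ∑ i, pd i (fun z => m z * pd i v z) x = m x * lapl v x + gr m v x := by
    intro x hx
    rw [lapl_eq_sum_pd, gr, Finset.mul_sum, ← Finset.sum_add_distrib]
    refine Finset.sum_congr rfl fun i _ => ?_
    rw [pd_mul i (hm1.differentiable (by simp) x) (hv.differentiableAt_pd hU hx i)]
    ring
  refine (IZ.div (W := fun i x => m x * pd i v x) hU hb hu.cont hu.zero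
    (hu.c2.of_le (by norm_num)) hu.grad
    (fun i => hm1.contDiffOn.mul (contDiffOn_pd hv.c2 hU (by norm_num) i))
    (fun i => L2.bdd_mul hU hb hm.continuous (hv.grad i)) ?_).congr hU.measurableSet ?_
  · exact L2.congr hU.measurableSet ((L2.bdd_mul hU hb hm.continuous hv.lap).add
      (hv.L2_gr_left hU hb hm1)) fun x hx => (key x hx).symm
  · intro x hx
    have : ∑ i, pd i u x * (m x * pd i v x) = m x * gr u v x := by
      rw [gr, Finset.mul_sum]
      exact Finset.sum_congr rfl fun i _ => by ring
    simp only [key x hx, this]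
    ring

/-- Integration by parts along the gradient of a smooth function. -/
theorem H10.div_smooth (hu : H10 U u) (hw : H10 U w) (hU : IsOpen U) (hb : Bornology.IsBounded U)
    (hm : ContDiff ℝ 2 m) (hg : ContDiff ℝ 2 g) :
    IZ U (fun x => u x * w x * (m x * lapl g x + gr m g x) + m x * (u x * gr g w x)
      + m x * (w x * gr g u x)) := by
  have hm1 : ContDiff ℝ 1 m := hm.of_le (by norm_num)
  have hg1 : ContDiff ℝ 1 g := hg.of_le (by norm_num)
  have hp : ∀ i, ContDiff ℝ 1 (fun z => m z * pd i g z) := fun i =>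
    hm1.mul (contDiff_pd hg (by norm_num) i)
  have key : ∀ x ∈ U, ∑ i, pd i (fun z => w z * (m z * pd i g z)) x =
      w x * (m x * lapl g x + gr m g x) + m x * gr g w x := by
    intro x hx
    simp only [lapl_eq_sum_pd, gr, Finset.mul_sum, ← Finset.sum_add_distrib]
    refine Finset.sum_congr rfl fun i _ => ?_
    rw [pd_mul (g := fun z => m z * pd i g z) i (hw.differentiableAt hU hx)
      ((hp i).differentiable (by simp) x),
      pd_mul i (hm1.differentiable (by simp) x)
        ((contDiff_pd (m := 1) hg (by norm_num) i).differentiable (by simp) x)]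
    ring
  refine (IZ.div (W := fun i x => w x * (m x * pd i g x)) hU hb hu.cont hu.zero
    (hu.c2.of_le (by norm_num)) hu.grad
    (fun i => (hw.c2.of_le (by norm_num)).mul (hp i).contDiffOn)
    (fun i => (hw.cont.mul (hp i).continuous).L2 hU hb) ?_).congr hU.measurableSet ?_
  · refine L2.congr hU.measurableSet (L2.add (f := fun x => w x * (m x * lapl g x + gr m g x))
      (Continuous.L2 hU hb ?_) (L2.bdd_mul hU hb hm.continuous
      (hw.L2_gr_left hU hb hg1))) fun x hx => (key x hx).symm
    exact hw.cont.mul ((hm.continuous.mul (continuous_lapl hg)).add (continuous_gr hm1 hg1))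
  · intro x hx
    have : ∑ i, pd i u x * (w x * (m x * pd i g x)) = m x * (w x * gr g u x) := by
      simp only [gr, Finset.mul_sum]
      exact Finset.sum_congr rfl fun i _ => by ring
    simp only [key x hx, this]
    ring

theorem contDiff_one {k : WithTop ℕ∞} : ContDiff ℝ k (fun _ : EuclideanSpace ℝ (Fin n) => (1:ℝ)) :=
  contDiff_const

theorem H10.mul_lapl (hf : H10 U f) (hU : IsOpen U) (hb : Bornology.IsBounded U)
    (hm : ContDiff ℝ 2 m) :
    IZ U (fun x => m x * (f x * lapl f x) + m x * gr f f x - 1 / 2 * lapl m x * f x ^ 2) := by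
  refine ((hf.green hf hU hb hm).add ((hf.div_smooth hf hU hb contDiff_one hm).const_mul
    (-1 / 2))).congr hU.measurableSet fun x _ => ?_
  simp only [gr_const_left]
  ring

theorem H10.integrableOn_gr (hu : H10 U u) (hv : H10 U v) : IntegrableOn (gr u v) U :=
  L2.integrableOn_gr hu.grad hv.grad

theorem H10.integrableOn_weight_gr (hu : H10 U u) (hv : H10 U v) (hU : IsOpen U)
    (hb : Bornology.IsBounded U) (hm : Continuous m) : IntegrableOn (fun x => m x * gr u v x) U :=
  integrableOn_bdd_mul hU hb hm (hu.integrableOn_gr hv)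

theorem Continuous.integrableOn_of_isBounded (hU : IsOpen U) (hb : Bornology.IsBounded U)
    (hf : Continuous f) : IntegrableOn f U := by
  have h1 : _root_.L2 U (fun _ => (1:ℝ)) := continuous_const.L2 hU hb
  simpa using h1.mul (hf.L2 hU hb)

theorem H10.integrableOn_sq (hf : H10 U f) (hU : IsOpen U) (hb : Bornology.IsBounded U) :
    IntegrableOn (fun x => f x ^ 2) U :=
  (hf.cont.pow 2).integrableOn_of_isBounded hU hb

/-- Poincaré's inequality in a ball. -/
theorem H10.poincare {R : ℝ} (hn : 2 ≤ n) (hf : H10 (ball 0 R) f) :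
    ∫ x in ball 0 R, f x ^ 2 ≤ R ^ 2 * ∫ x in ball 0 R, gr f f x := by
  have hb : Bornology.IsBounded (ball (0 : EuclideanSpace ℝ (Fin n)) R) := isBounded_ball
  have hU : IsOpen (ball (0 : EuclideanSpace ℝ (Fin n)) R) := isOpen_ball
  have h := hf.div_smooth hf hU hb contDiff_one (contDiff_sqd 0)
  have hi := hf.integrableOn_sq hU hb
  have hg := hf.integrableOn_gr hf
  have h2 : (2:ℝ) ≤ n := by exact_mod_cast hn
  have e : ∫ x in ball 0 R, (f x ^ 2 - R ^ 2 * gr f f x) ≤ 0 := by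
    have h' := (h.const_mul (1 / n))
    rw [← h'.2]
    refine setIntegral_mono_on (hi.sub (hg.const_mul _)) h'.1 hU.measurableSet fun x hx => ?_
    simp only [gr_const_left, lapl_sqd]
    have hc := gr_sq_le (sqd 0) f x
    rw [gr_sqd_sqd] at hc
    have hx' : sqd 0 x ≤ R ^ 2 := by
      have : ‖x‖ < R := by simpa using hx
      simp only [sqd, sub_zero]
      gcongr
    have hgn := gr_self_nonneg f x
    have hc2 : gr (sqd 0) f x ^ 2 ≤ 4 * R ^ 2 * gr f f x :=
      hc.trans (by gcongr)
    have h3 : -2 * (f x * gr (sqd 0) f x) ≤ n * f x ^ 2 + n * (R ^ 2 * gr f f x) := by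
      have hs : 0 ≤ (2 * f x + gr (sqd 0) f x) ^ 2 := sq_nonneg _
      have : 0 ≤ (n - 2) * (f x ^ 2 + R ^ 2 * gr f f x) :=
        mul_nonneg (by linarith) (by positivity)
      nlinarith
    have : 1 / (n:ℝ) * (f x * f x * (1 * (2 * n) + 0) + 1 * (f x * gr (sqd 0) f x)
      + 1 * (f x * gr (sqd 0) f x)) = 2 * f x ^ 2 + 2 * (f x * gr (sqd 0) f x) / n := by
        field_simp
        ring
    rw [this, sub_le_iff_le_add, ← sub_le_iff_le_add']
    have h4 : -(f x ^ 2 + R ^ 2 * gr f f x) ≤ 2 * (f x * gr (sqd 0) f x) / n := by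
      rw [le_div_iff₀ (by linarith)]
      linarith
    linarith
  rw [integral_sub hi (hg.const_mul _), integral_const_mul] at e
  linarith

end H10

/-! ### Dilations and the boundary Rellich inequality -/

/-- The dilation of ratio `r` centred at `a`. -/
noncomputable def dil {n : ℕ} (a : EuclideanSpace ℝ (Fin n)) (r : ℝ)
    (x : EuclideanSpace ℝ (Fin n)) : EuclideanSpace ℝ (Fin n) := a + r • (x - a)

section Dilation

variable {n : ℕ} {a : EuclideanSpace ℝ (Fin n)} {R : ℝ} {G : EuclideanSpace ℝ (Fin n) → ℝ}

theorem dil_one (a x : EuclideanSpace ℝ (Fin n)) : dil a 1 x = x := by simp [dil]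

theorem dil_dil (a x : EuclideanSpace ℝ (Fin n)) (r s : ℝ) :
    dil a r (dil a s x) = dil a (r * s) x := by
  simp [dil, smul_smul]

theorem continuous_dil : Continuous fun p : ℝ × EuclideanSpace ℝ (Fin n) => dil a p.1 p.2 := by
  unfold dil; fun_prop

theorem continuous_dil_left (x : EuclideanSpace ℝ (Fin n)) : Continuous fun r => dil a r x := by
  unfold dil; fun_prop

theorem hasFDerivAt_dil (r : ℝ) (x : EuclideanSpace ℝ (Fin n)) :
    HasFDerivAt (dil a r) (r • ContinuousLinearMap.id ℝ (EuclideanSpace ℝ (Fin n))) x :=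
  (((hasFDerivAt_id x).sub_const a).const_smul r).const_add a

theorem contDiff_dil (r : ℝ) {k : WithTop ℕ∞} : ContDiff ℝ k (dil a r) :=
  contDiff_const.add ((contDiff_id.sub contDiff_const).const_smul r)

theorem hasDerivAt_dil (r : ℝ) (x : EuclideanSpace ℝ (Fin n)) :
    HasDerivAt (fun r => dil a r x) (x - a) r := by
  simpa [dil] using ((hasDerivAt_id r).smul_const (x - a)).const_add a

theorem mem_ball_of_dil {r : ℝ} (hr : 1 ≤ r) (ha : a ∈ ball (0 : EuclideanSpace ℝ (Fin n)) R)
    {x : EuclideanSpace ℝ (Fin n)} (hx : dil a r x ∈ ball (0 : EuclideanSpace ℝ (Fin n)) R) :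
    x ∈ ball (0 : EuclideanSpace ℝ (Fin n)) R := by
  have hr0 : 0 < r := by linarith
  have : x = (1 - r⁻¹) • a + r⁻¹ • dil a r x := by
    simp only [dil, smul_add, smul_smul, inv_mul_cancel₀ hr0.ne', one_smul, sub_smul]
    abel
  rw [this]
  exact convex_ball 0 R ha hx (sub_nonneg.2 (inv_le_one_of_one_le₀ hr)) (by positivity) (by ring)

theorem dil_eq (r : ℝ) (x : EuclideanSpace ℝ (Fin n)) : dil a r x = r • x + (a - r • a) := by
  simp only [dil, smul_sub]; abel

theorem integral_comp_dil {r : ℝ} (hr : 0 < r) :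
    ∫ x, G (dil a r x) = (r ^ n)⁻¹ * ∫ x, G x := by
  simp only [dil_eq]
  have := Measure.integral_comp_smul (volume : Measure (EuclideanSpace ℝ (Fin n)))
    (fun x => G (x + (a - r • a))) r
  rw [this, integral_add_right_eq_self G]
  simp [abs_of_pos hr]

theorem integrable_comp_dil {r : ℝ} (hr : 0 < r) (hG : Integrable G) :
    Integrable fun x => G (dil a r x) := by
  simp only [dil_eq]
  exact (hG.comp_add_right (a - r • a)).comp_smul hr.ne'

theorem sq_intervalIntegral_le {φ : ℝ → ℝ} (hφ : Continuous φ) {b c : ℝ} (hbc : b < c) :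
    (∫ r in b..c, φ r) ^ 2 ≤ (c - b) * ∫ r in b..c, φ r ^ 2 := by
  set I := ∫ r in b..c, φ r with hI
  have hcb : 0 < c - b := by linarith
  have h0 : 0 ≤ ∫ r in b..c, (φ r - I / (c - b)) ^ 2 :=
    intervalIntegral.integral_nonneg hbc.le fun _ _ => sq_nonneg _
  have h1 : ∫ r in b..c, (φ r - I / (c - b)) ^ 2 =
      (∫ r in b..c, φ r ^ 2) - I ^ 2 / (c - b) := by
    have e : ∀ r, (φ r - I / (c - b)) ^ 2 =
        φ r ^ 2 - 2 * (I / (c - b)) * φ r + (I / (c - b)) ^ 2 := fun r => by ring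
    simp only [e]
    rw [intervalIntegral.integral_add, intervalIntegral.integral_sub,
      intervalIntegral.integral_const_mul, intervalIntegral.integral_const, ← hI, smul_eq_mul]
    · field_simp; ring
    all_goals exact Continuous.intervalIntegrable (by fun_prop) _ _
  rw [h1, sub_nonneg, div_le_iff₀ hcb] at h0
  linarith

/-- The `L²` bound of dilation difference quotients of compactly supported functions. -/
theorem integral_dil_sub_sq_le {F : EuclideanSpace ℝ (Fin n) → ℝ}
    (hF : ContDiff ℝ 1 F) (hs : tsupport F ⊆ ball (0 : EuclideanSpace ℝ (Fin n)) R)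
    {r : ℝ} (hr : 1 < r) :
    ∫ x in ball 0 R, (F (dil a r x) - F x) ^ 2 ≤
      (r - 1) ^ 2 * ∫ x in ball 0 R, (fderiv ℝ F x (x - a)) ^ 2 := by
  set D : EuclideanSpace ℝ (Fin n) → ℝ := fun x => fderiv ℝ F x (x - a) with hD
  have hDc : Continuous D := (hF.continuous_fderiv (by simp)).clm_apply (by fun_prop)
  have hDs : ∀ x ∉ ball (0 : EuclideanSpace ℝ (Fin n)) R, D x = 0 := by
    intro x hx
    have : F =ᶠ[nhds x] fun _ => 0 := by
      filter_upwards [(isClosed_tsupport F).isOpen_compl.mem_nhds fun h => hx (hs h)] with z hz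
        using image_eq_zero_of_notMem_tsupport hz
    simp [hD, this.fderiv_eq]
  have hD2 : Integrable fun x => D x ^ 2 := by
    refine (hDc.pow 2).integrable_of_hasCompactSupport ?_
    refine HasCompactSupport.intro (isCompact_closedBall 0 R) fun x hx => ?_
    rw [Pi.pow_apply, hDs x fun h => hx (ball_subset_closedBall h)]
    norm_num
  have hball : ∫ x in ball 0 R, D x ^ 2 = ∫ x, D x ^ 2 :=
    setIntegral_eq_integral_of_forall_compl_eq_zero fun x hx => by simp [hDs x hx]
  have hftc : ∀ x, F (dil a r x) - F x = ∫ s in (1:ℝ)..r, s⁻¹ * D (dil a s x) := by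
    intro x
    have h1 : ∀ s ∈ uIcc 1 r, HasDerivAt (fun s => F (dil a s x)) (s⁻¹ * D (dil a s x)) s := by
      intro s hs
      rw [uIcc_of_le hr.le] at hs
      have hs0 : 0 < s := by linarith [hs.1]
      have := ((hF.differentiable (by simp)) (dil a s x)).hasFDerivAt.comp_hasDerivAt s
        (hasDerivAt_dil s x)
      refine this.congr_deriv ?_
      simp only [hD]
      rw [show dil a s x - a = s • (x - a) by simp [dil], map_smul, smul_eq_mul]
      field_simp
    rw [intervalIntegral.integral_eq_sub_of_hasDerivAt h1, dil_one]
    refine ContinuousOn.intervalIntegrable ?_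
    rw [uIcc_of_le hr.le]
    refine ContinuousOn.mul (continuousOn_inv₀.mono fun s hs => ?_) (Continuous.continuousOn ?_)
    · exact (by linarith [hs.1] : (0:ℝ) < s).ne'
    · exact hDc.comp (continuous_dil_left x)
  have hpt : ∀ x, (F (dil a r x) - F x) ^ 2 ≤ (r - 1) * ∫ s in Ioc (1:ℝ) r, D (dil a s x) ^ 2 := by
    intro x
    have hcont : Continuous fun s => D (dil a s x) := hDc.comp (continuous_dil_left x)
    set φ : ℝ → ℝ := fun s => (max s 1)⁻¹ * D (dil a s x) with hφ
    have hφc : Continuous φ :=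
      ((continuous_id.max continuous_const).inv₀ fun s =>
        (lt_of_lt_of_le one_pos (le_max_right s 1)).ne').mul hcont
    have e : F (dil a r x) - F x = ∫ s in (1:ℝ)..r, φ s := by
      rw [hftc]
      refine intervalIntegral.integral_congr fun s hs => ?_
      rw [uIcc_of_le hr.le] at hs
      simp only [hφ, max_eq_left hs.1]
    rw [e]
    refine (sq_intervalIntegral_le hφc hr).trans ?_
    rw [← intervalIntegral.integral_of_le hr.le]
    refine mul_le_mul_of_nonneg_left (intervalIntegral.integral_mono_on hr.le
      ((hφc.pow 2).intervalIntegrable _ _) ((hcont.pow 2).intervalIntegrable _ _) fun s _ => ?_)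
      (by linarith)
    simp only [hφ, mul_pow]
    refine mul_le_of_le_one_left (sq_nonneg _) (pow_le_one₀ (by positivity) ?_)
    exact inv_le_one_of_one_le₀ (le_max_right s 1)
  have hjoint : Continuous fun p : EuclideanSpace ℝ (Fin n) × ℝ => D (dil a p.2 p.1) ^ 2 :=
    (hDc.comp (continuous_dil.comp (by fun_prop : Continuous fun
      p : EuclideanSpace ℝ (Fin n) × ℝ => (p.2, p.1)))).pow 2
  have hint : Integrable (fun p : EuclideanSpace ℝ (Fin n) × ℝ => D (dil a p.2 p.1) ^ 2)
      ((volume.restrict (ball 0 R)).prod (volume.restrict (Ioc 1 r))) := by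
    rw [Measure.prod_restrict]
    have : IntegrableOn (fun p : EuclideanSpace ℝ (Fin n) × ℝ => D (dil a p.2 p.1) ^ 2)
      (closedBall 0 R ×ˢ Icc 1 r) (volume.prod volume) :=
        hjoint.continuousOn.integrableOn_compact ((isCompact_closedBall 0 R).prod isCompact_Icc)
    exact this.mono_set (prod_mono ball_subset_closedBall Ioc_subset_Icc_self)
  calc ∫ x in ball 0 R, (F (dil a r x) - F x) ^ 2
      ≤ ∫ x in ball 0 R, (r - 1) * ∫ s in Ioc (1:ℝ) r, D (dil a s x) ^ 2 := by
        refine integral_mono ?_ (hint.integral_prod_left.const_mul _) hpt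
        exact Continuous.integrableOn_of_isBounded isOpen_ball isBounded_ball
          (((hF.continuous.comp (contDiff_dil r (k := 0)).continuous).sub hF.continuous).pow 2)
    _ = (r - 1) * ∫ s in Ioc (1:ℝ) r, ∫ x in ball 0 R, D (dil a s x) ^ 2 := by
        rw [integral_const_mul, integral_integral_swap hint]
    _ ≤ (r - 1) * ∫ s in Ioc (1:ℝ) r, ∫ x, D x ^ 2 := by
        refine mul_le_mul_of_nonneg_left (setIntegral_mono_on hint.integral_prod_right
          (by simp) measurableSet_Ioc fun s hs => ?_) (by linarith)
        have hs0 : 0 < s := by linarith [hs.1]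
        have h1 : ∫ x in ball 0 R, D (dil a s x) ^ 2 ≤ ∫ x, D (dil a s x) ^ 2 :=
          setIntegral_le_integral (integrable_comp_dil hs0 hD2)
            (Eventually.of_forall fun _ => sq_nonneg _)
        rw [integral_comp_dil (G := fun x => D x ^ 2) hs0] at h1
        refine h1.trans (mul_le_of_le_one_left (integral_nonneg fun _ => sq_nonneg _) ?_)
        exact inv_le_one_of_one_le₀ (one_le_pow₀ hs.1.le)
    _ = (r - 1) ^ 2 * ∫ x in ball 0 R, D x ^ 2 := by
        rw [hball, setIntegral_const]
        simp only [Real.volume_real_Ioc_of_le hr.le, smul_eq_mul]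
        ring

end Dilation

section Rellich

variable {n : ℕ} {a : EuclideanSpace ℝ (Fin n)} {R : ℝ} {f q : EuclideanSpace ℝ (Fin n) → ℝ}

theorem fderiv_apply_sub (a : EuclideanSpace ℝ (Fin n)) (f : EuclideanSpace ℝ (Fin n) → ℝ)
    (x : EuclideanSpace ℝ (Fin n)) : fderiv ℝ f x (x - a) = 1 / 2 * gr (sqd a) f x := by
  rw [gr_sqd_left]; ring

theorem H10.L2_radial (hf : H10 (ball 0 R) f) (a : EuclideanSpace ℝ (Fin n)) :
    _root_.L2 (ball 0 R) (fun x => fderiv ℝ f x (x - a)) := by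
  simp only [fderiv_apply_sub]
  exact (hf.L2_gr_left isOpen_ball isBounded_ball (contDiff_sqd a)).const_mul _

theorem H10.integral_dil_sub_sq_le (hf : H10 (ball 0 R) f) {r : ℝ} (hr : 1 < r) :
    ∫ x in ball 0 R, (f (dil a r x) - f x) ^ 2 ≤
      (r - 1) ^ 2 * ∫ x in ball 0 R, (fderiv ℝ f x (x - a)) ^ 2 := by
  obtain ⟨M, hM0, hM⟩ := exists_deriv_tau_le
  have hU : IsOpen (ball (0 : EuclideanSpace ℝ (Fin n)) R) := isOpen_ball
  have hb : Bornology.IsBounded (ball (0 : EuclideanSpace ℝ (Fin n)) R) := isBounded_ball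
  have hD := hf.L2_radial a
  have hv1 : ContDiffOn ℝ 1 f (ball 0 R) := hf.c2.of_le (by norm_num)
  have hDt : ∀ k, ∀ x ∈ ball (0 : EuclideanSpace ℝ (Fin n)) R,
      fderiv ℝ (fun z => tau (tdel k) (f z)) x (x - a) =
        deriv (tau (tdel k)) (f x) * fderiv ℝ f x (x - a) := by
    intro k x hx
    rw [fderiv_eq_sum_pd, fderiv_eq_sum_pd f, Finset.mul_sum]
    refine Finset.sum_congr rfl fun i _ => ?_
    rw [pd_tau_comp (hf.differentiableAt hU hx)]
    ring
  refine (integrable_and_integral_le_of_tendsto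
    (G := fun k x => (tau (tdel k) (f (dil a r x)) - tau (tdel k) (f x)) ^ 2)
    (C := fun k => (r - 1) ^ 2 * ∫ x in ball 0 R,
      (deriv (tau (tdel k)) (f x) * fderiv ℝ f x (x - a)) ^ 2)
    (fun k => Eventually.of_forall fun x => sq_nonneg _) (fun k => ?_)
    (Eventually.of_forall fun x => ((tendsto_tau _).sub (tendsto_tau _)).pow 2) (fun k => ?_) ?_).2
  · have h1 : Continuous (tau (tdel k)) := (contDiff_tau _ (k := 0)).continuous
    exact Continuous.integrableOn_of_isBounded hU hb
      (((h1.comp (hf.cont.comp (contDiff_dil r (k := 0)).continuous)).sub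
        (h1.comp hf.cont)).pow 2)
  · have := _root_.integral_dil_sub_sq_le (a := a)
      (contDiff_tau_comp (k := 1) hU hf.cont hf.zero hv1 (tdel_pos k))
      (tau_comp_support hb hf.cont hf.zero (tdel_pos k)).2 hr
    refine this.trans_eq ?_
    congr 1
    exact setIntegral_congr_fun hU.measurableSet fun x hx => congrArg (· ^ 2) (hDt k x hx)
  · refine Tendsto.const_mul _ (tendsto_integral_of_dominated_convergence
      (fun x => M ^ 2 * (fderiv ℝ f x (x - a)) ^ 2) (fun k => ?_) ?_ (fun k => ?_) ?_)
    · exact ((((continuous_deriv_tau _).comp hf.cont).aestronglyMeasurable).mul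
        hD.aestronglyMeasurable).pow 2
    · exact hD.integrable_sq.const_mul _
    · refine Eventually.of_forall fun x => ?_
      rw [Real.norm_of_nonneg (sq_nonneg _), mul_pow]
      refine mul_le_mul_of_nonneg_right ?_ (sq_nonneg _)
      rw [← sq_abs]
      exact pow_le_pow_left₀ (abs_nonneg _) (hM _ _) 2
    · filter_upwards [ae_pd_eq_zero_of_eq_zero hU hf.cont hv1] with x hx
      by_cases h0 : f x = 0
      · have : fderiv ℝ f x (x - a) = 0 := by
          rw [fderiv_eq_sum_pd]; simp [hx h0]
        simp [this]
      · simpa using ((tendsto_deriv_tau h0).mul_const (fderiv ℝ f x (x - a))).pow 2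

theorem H10.integral_dil_mul (hf : H10 (ball 0 R) f)
    (ha : a ∈ ball (0 : EuclideanSpace ℝ (Fin n)) R) (hq : ContDiff ℝ 2 q) {r : ℝ} (hr : 1 < r)
    (hq0 : ∀ x, 0 ≤ q x) :
    -∫ x in ball 0 R, (f (dil a r x) - f x) * (q x * lapl f x + gr q f x) ≤
      r * ∫ x in ball 0 R, ((1 / 2 - r⁻¹) * q x + 1 / 2 * r⁻¹ ^ n * q (dil a r⁻¹ x)) *
        gr f f x := by
  have hU : IsOpen (ball (0 : EuclideanSpace ℝ (Fin n)) R) := isOpen_ball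
  have hb : Bornology.IsBounded (ball (0 : EuclideanSpace ℝ (Fin n)) R) := isBounded_ball
  have hr0 : 0 < r := by linarith
  have hq1 : ContDiff ℝ 1 q := hq.of_le (by norm_num)
  have hdc : Continuous (dil a r) := (contDiff_dil r (k := 0)).continuous
  set V : Set (EuclideanSpace ℝ (Fin n)) := dil a r ⁻¹' ball 0 R with hV
  have hVo : IsOpen V := hU.preimage hdc
  have hVB : V ⊆ ball 0 R := fun x hx => mem_ball_of_dil hr.le ha hx
  set p : Fin n → EuclideanSpace ℝ (Fin n) → ℝ := fun i => (ball 0 R).indicator (pd i f) with hp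
  have hpB : ∀ i, ∀ x ∈ ball (0 : EuclideanSpace ℝ (Fin n)) R, p i x = pd i f x := fun i x hx =>
    indicator_of_mem hx _
  have hpn : ∀ i, ∀ x ∉ ball (0 : EuclideanSpace ℝ (Fin n)) R, p i x = 0 := fun i x hx =>
    indicator_of_notMem hx _
  have hp2 : ∀ i, MemLp (p i) 2 volume := fun i =>
    (memLp_indicator_iff_restrict hU.measurableSet).2 (hf.grad i)
  have hp1 : ∀ i, Integrable (p i) := fun i => by
    refine (integrable_indicator_iff hU.measurableSet).2 ?_
    have h1 : _root_.L2 (ball (0 : EuclideanSpace ℝ (Fin n)) R) (fun _ => (1:ℝ)) :=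
      continuous_const.L2 hU hb
    simpa using h1.mul (hf.grad i)
  have hpd : ∀ i, MemLp (fun x => p i (dil a r x)) 2 volume := fun i => by
    refine (memLp_two_iff_integrable_sq (integrable_comp_dil hr0 (hp1 i)).aestronglyMeasurable).2 ?_
    exact integrable_comp_dil (G := fun x => p i x ^ 2) hr0 (hp2 i).integrable_sq
  have hfd : ∀ x ∈ V, DifferentiableAt ℝ f (dil a r x) := fun x hx => hf.differentiableAt hU hx
  have hpdr : ∀ x ∈ V, ∀ i, pd i (fun z => f (dil a r z)) x = r * p i (dil a r x) := by
    intro x hx i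
    have := ((hfd x hx).hasFDerivAt.comp x (hasFDerivAt_dil (a := a) r x)).fderiv
    rw [hpB i _ hx, pd, show (fun z => f (dil a r z)) = f ∘ dil a r from rfl, this]
    simp [pd]
  have hΨ : ∀ x ∈ ball (0 : EuclideanSpace ℝ (Fin n)) R,
      ∑ i, pd i (fun z => q z * pd i f z) x = q x * lapl f x + gr q f x := by
    intro x hx
    rw [lapl_eq_sum_pd, gr, Finset.mul_sum, ← Finset.sum_add_distrib]
    refine Finset.sum_congr rfl fun i _ => ?_
    rw [pd_mul i (hq1.differentiable (by simp) x) (hf.differentiableAt_pd hU hx i)]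
    ring
  have hΨ2 : _root_.L2 (ball 0 R) (fun x => q x * lapl f x + gr q f x) :=
    (L2.bdd_mul hU hb hq.continuous hf.lap).add (hf.L2_gr_left hU hb hq1)
  have hmono : ∀ {g : EuclideanSpace ℝ (Fin n) → ℝ}, _root_.L2 (ball 0 R) g → _root_.L2 V g :=
    fun h => MemLp.mono_measure (Measure.restrict_mono hVB le_rfl) h
  have hbV : Bornology.IsBounded V := hb.subset hVB
  have hz := IZ.div (U := V) (v := fun x => f (dil a r x)) (W := fun i x => q x * pd i f x) hVo
    hbV (hf.cont.comp hdc) (fun x hx => hf.zero _ hx)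
    ((hf.c2.of_le (by norm_num)).comp (contDiff_dil r).contDiffOn fun x hx => hx)
    (fun i => L2.congr hVo.measurableSet (((hpd i).restrict V).const_mul r)
      fun x hx => (hpdr x hx i).symm)
    (fun i => hq1.contDiffOn.mul ((contDiffOn_pd hf.c2 hU (by norm_num) i).mono hVB))
    (fun i => hmono (L2.bdd_mul hU hb hq.continuous (hf.grad i)))
    (L2.congr hVo.measurableSet (hmono hΨ2) fun x hx => (hΨ x (hVB hx)).symm)
  set P : EuclideanSpace ℝ (Fin n) → ℝ := fun x => ∑ i, p i x * p i (dil a r x) with hP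
  have hPi : Integrable P := integrable_finsetSum _ fun i _ => (hp2 i).integrable_mul (hpd i)
  set g : EuclideanSpace ℝ (Fin n) → ℝ := fun x => ∑ i, p i x ^ 2 with hg
  have hgi : Integrable g := integrable_finsetSum _ fun i _ => (hp2 i).integrable_sq
  have hgB : ∀ x ∈ ball (0 : EuclideanSpace ℝ (Fin n)) R, g x = gr f f x := fun x hx => by
    simp only [hg, gr, hpB _ x hx, sq]
  have hgn : ∀ x ∉ ball (0 : EuclideanSpace ℝ (Fin n)) R, g x = 0 := fun x hx => by
    simp [hg, hpn _ x hx]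
  have hPg : ∀ x, P x ≤ 1 / 2 * g x + 1 / 2 * g (dil a r x) := fun x => by
    simp only [hP, hg, Finset.mul_sum, ← Finset.sum_add_distrib]
    refine Finset.sum_le_sum fun i _ => ?_
    nlinarith [sq_nonneg (p i x - p i (dil a r x))]
  have iΨ : IntegrableOn (fun x => f (dil a r x) * (q x * lapl f x + gr q f x)) (ball 0 R) :=
    ((hf.cont.comp hdc).L2 hU hb).mul hΨ2
  have iΨ' : IntegrableOn (fun x => f x * (q x * lapl f x + gr q f x)) (ball 0 R) :=
    (hf.L2 hU hb).mul hΨ2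
  have iqP : IntegrableOn (fun x => q x * P x) (ball 0 R) :=
    integrableOn_bdd_mul hU hb hq.continuous hPi.integrableOn
  have iqg : IntegrableOn (fun x => q x * g x) (ball 0 R) :=
    integrableOn_bdd_mul hU hb hq.continuous hgi.integrableOn
  have iqgd : IntegrableOn (fun x => q x * g (dil a r x)) (ball 0 R) :=
    integrableOn_bdd_mul hU hb hq.continuous (integrable_comp_dil hr0 hgi).integrableOn
  have e1 : ∫ x in ball 0 R, f (dil a r x) * (q x * lapl f x + gr q f x) =
      -(r * ∫ x in ball 0 R, q x * P x) := by
    have h0 : ∫ x in ball 0 R, (f (dil a r x) * (q x * lapl f x + gr q f x) + r * (q x * P x)) =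
        0 := by
      rw [setIntegral_eq_of_subset_of_forall_sdiff_eq_zero hU.measurableSet hVB]
      · rw [← hz.2]
        refine setIntegral_congr_fun hVo.measurableSet fun x hx => ?_
        simp only [hΨ x (hVB hx), hpdr x hx, hP, Finset.mul_sum]
        congr 1
        refine Finset.sum_congr rfl fun i _ => ?_
        rw [hpB i x (hVB hx)]
        ring
      · intro x hx
        have hx' : dil a r x ∉ ball (0 : EuclideanSpace ℝ (Fin n)) R := hx.2
        simp [hf.zero _ hx', hP, hpn _ _ hx']
    rw [integral_add iΨ (iqP.const_mul r), integral_const_mul] at h0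
    linarith
  have e2 : ∫ x in ball 0 R, f x * (q x * lapl f x + gr q f x) = -∫ x in ball 0 R, q x * g x := by
    have h0 : ∫ x in ball 0 R, (f x * (q x * lapl f x + gr q f x) + q x * g x) = 0 := by
      rw [← (hf.green hf hU hb hq).2]
      refine setIntegral_congr_fun hU.measurableSet fun x hx => ?_
      simp only [hgB x hx]
      ring
    rw [integral_add iΨ' iqg] at h0
    linarith
  have e3 : ∫ x in ball 0 R, q x * g (dil a r x) =
      r⁻¹ ^ n * ∫ x in ball 0 R, q (dil a r⁻¹ x) * g x := by
    rw [setIntegral_eq_integral_of_forall_compl_eq_zero,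
      setIntegral_eq_integral_of_forall_compl_eq_zero]
    · have := integral_comp_dil (a := a) (G := fun x => q (dil a r⁻¹ x) * g x) hr0
      simp only [dil_dil, inv_mul_cancel₀ hr0.ne', dil_one] at this
      rw [this, inv_pow]
    · intro x hx
      rw [hgn x hx, mul_zero]
    · intro x hx
      rw [hgn _ fun h => hx (mem_ball_of_dil hr.le ha h), mul_zero]
  have iqd : IntegrableOn (fun x => q (dil a r⁻¹ x) * g x) (ball 0 R) :=
    integrableOn_bdd_mul hU hb (hq.continuous.comp (contDiff_dil r⁻¹ (k := 0)).continuous)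
      hgi.integrableOn
  have e4 : ∫ x in ball 0 R, q x * P x ≤
      1 / 2 * (∫ x in ball 0 R, q x * g x) + 1 / 2 * ∫ x in ball 0 R, q x * g (dil a r x) := by
    rw [← integral_const_mul, ← integral_const_mul, ← integral_add (iqg.const_mul _)
      (iqgd.const_mul _)]
    refine integral_mono iqP ((iqg.const_mul _).add (iqgd.const_mul _)) fun x => ?_
    have := mul_le_mul_of_nonneg_left (hPg x) (hq0 x)
    linarith
  have e5 : ∫ x in ball 0 R, ((1 / 2 - r⁻¹) * q x + 1 / 2 * r⁻¹ ^ n * q (dil a r⁻¹ x)) *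
        gr f f x = (1 / 2 - r⁻¹) * (∫ x in ball 0 R, q x * g x) +
          1 / 2 * (r⁻¹ ^ n * ∫ x in ball 0 R, q (dil a r⁻¹ x) * g x) := by
    rw [← integral_const_mul, ← integral_const_mul, ← integral_const_mul,
      ← integral_add (iqg.const_mul _) ((iqd.const_mul _).const_mul _)]
    refine setIntegral_congr_fun hU.measurableSet fun x hx => ?_
    simp only [hgB x hx]
    ring
  simp only [sub_mul]
  rw [integral_sub iΨ iΨ', e1, e2]
  simp only [← sub_mul]
  rw [e5, ← e3]
  have h6 := mul_le_mul_of_nonneg_left e4 hr0.le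
  have h7 : r * r⁻¹ = 1 := mul_inv_cancel₀ hr0.ne'
  have h8 : ∀ A : ℝ, r * ((1 / 2 - r⁻¹) * A) = r / 2 * A - A := fun A => by
    rw [← mul_assoc, mul_sub, h7]; ring
  rw [mul_add, h8]
  linarith

end Rellich

section Linear

variable {α : Type*} [MeasurableSpace α] {μ : Measure α} {f g h : α → ℝ}

theorem integral_lin_two (hf : Integrable f μ) (hg : Integrable g μ) (a b : ℝ) :
    ∫ x, (a * f x + b * g x) ∂μ = a * ∫ x, f x ∂μ + b * ∫ x, g x ∂μ := by
  rw [integral_add (hf.const_mul a) (hg.const_mul b), integral_const_mul, integral_const_mul]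

theorem integral_lin_three (hf : Integrable f μ) (hg : Integrable g μ) (hh : Integrable h μ)
    (a b c : ℝ) : ∫ x, (a * f x + b * g x + c * h x) ∂μ =
      a * ∫ x, f x ∂μ + b * ∫ x, g x ∂μ + c * ∫ x, h x ∂μ := by
  have h1 : Integrable (fun x => a * f x + b * g x) μ := (hf.const_mul a).add (hg.const_mul b)
  rw [integral_add h1 (hh.const_mul c), integral_lin_two hf hg, integral_const_mul]

theorem integral_half_sub_sq (hf : MemLp f 2 μ) (hg : MemLp g 2 μ) :
    ∫ x, 1 / 2 * (f x - g x) ^ 2 ∂μ =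
      1 / 2 * (∫ x, f x ^ 2 ∂μ) - (∫ x, f x * g x ∂μ) + 1 / 2 * ∫ x, g x ^ 2 ∂μ := by
  have := integral_lin_three hf.integrable_sq (MemLp.integrable_mul hf hg) hg.integrable_sq
    (1 / 2) (-1) (1 / 2)
  simp only [Pi.mul_apply] at this
  rw [sub_eq_add_neg, ← neg_one_mul (∫ x, f x * g x ∂μ), ← this]
  congr 1
  ext x
  ring

end Linear

section Rellich

variable {n : ℕ} {a : EuclideanSpace ℝ (Fin n)} {R : ℝ} {f q : EuclideanSpace ℝ (Fin n) → ℝ}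

theorem hasDerivAt_integral_dil_weight {g : EuclideanSpace ℝ (Fin n) → ℝ} (hq : ContDiff ℝ 1 q)
    (hg : IntegrableOn g (ball 0 R)) :
    HasDerivAt (fun ρ : ℝ => ∫ x in ball 0 R,
        ((1 / 2 - ρ) * q x + 1 / 2 * ρ ^ n * q (dil a ρ x)) * g x)
      (∫ x in ball 0 R, (-q x + 1 / 2 * (n * q x) + 1 / 2 * (1 / 2 * gr (sqd a) q x)) * g x) 1 := by
  have hU : IsOpen (ball (0 : EuclideanSpace ℝ (Fin n)) R) := isOpen_ball
  have hb : Bornology.IsBounded (ball (0 : EuclideanSpace ℝ (Fin n)) R) := isBounded_ball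
  set χ' : ℝ → EuclideanSpace ℝ (Fin n) → ℝ := fun ρ x =>
    -q x + 1 / 2 * (n * ρ ^ (n - 1) * q (dil a ρ x) +
      ρ ^ n * fderiv ℝ q (dil a ρ x) (x - a)) with hχ'
  have hc : Continuous fun p : ℝ × EuclideanSpace ℝ (Fin n) => χ' p.1 p.2 := by
    have h1 : Continuous fun p : ℝ × EuclideanSpace ℝ (Fin n) => q (dil a p.1 p.2) :=
      hq.continuous.comp continuous_dil
    have h2 : Continuous fun p : ℝ × EuclideanSpace ℝ (Fin n) =>
        fderiv ℝ q (dil a p.1 p.2) (p.2 - a) :=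
      ((hq.continuous_fderiv (by simp)).comp continuous_dil).clm_apply (by fun_prop)
    have h3 : Continuous fun p : ℝ × EuclideanSpace ℝ (Fin n) => q p.2 :=
      hq.continuous.comp continuous_snd
    have h4 : Continuous fun p : ℝ × EuclideanSpace ℝ (Fin n) => p.1 := continuous_fst
    exact h3.neg.add (continuous_const.mul
      (((continuous_const.mul (h4.pow _)).mul h1).add ((h4.pow _).mul h2)))
  obtain ⟨M, hM⟩ := ((isCompact_Icc (a := (0:ℝ)) (b := 2)).prod
    (isCompact_closedBall (0 : EuclideanSpace ℝ (Fin n)) R)).exists_bound_of_continuousOn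
      hc.continuousOn
  have hcont : ∀ ρ : ℝ, Continuous fun x =>
      (1 / 2 - ρ) * q x + 1 / 2 * ρ ^ n * q (dil a ρ x) := fun ρ =>
    (continuous_const.mul hq.continuous).add (continuous_const.mul
      (hq.continuous.comp (contDiff_dil ρ (k := 0)).continuous))
  have hint := fun ρ => integrableOn_bdd_mul hU hb (hcont ρ) hg
  have hd : ∀ ρ x, HasDerivAt (fun ρ : ℝ =>
      ((1 / 2 - ρ) * q x + 1 / 2 * ρ ^ n * q (dil a ρ x)) * g x) (χ' ρ x * g x) ρ := by
    intro ρ x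
    have h1 : HasDerivAt (fun ρ => q (dil a ρ x)) (fderiv ℝ q (dil a ρ x) (x - a)) ρ :=
      ((hq.differentiable (by simp) _).hasFDerivAt).comp_hasDerivAt ρ (hasDerivAt_dil ρ x)
    have h2 := ((((hasDerivAt_id ρ).const_sub (1 / 2)).mul_const (q x)).add
      (((hasDerivAt_pow n ρ).const_mul (1 / 2)).mul h1)).mul_const (g x)
    refine h2.congr_deriv ?_
    simp only [hχ']
    ring
  have := (hasDerivAt_integral_of_dominated_loc_of_deriv_le (μ := volume.restrict (ball 0 R))
    (F := fun (ρ : ℝ) x => ((1 / 2 - ρ) * q x + 1 / 2 * ρ ^ n * q (dil a ρ x)) * g x)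
    (F' := fun ρ x => χ' ρ x * g x) (x₀ := 1) (bound := fun x => M * |g x|)
    (s := Icc 0 2) (Icc_mem_nhds (by norm_num) (by norm_num))
    (Eventually.of_forall fun ρ => (hint ρ).aestronglyMeasurable) (hint 1) ?_ ?_
    (hg.abs.const_mul M) (Eventually.of_forall fun x ρ _ => hd ρ x)).2
  · refine this.congr_deriv (setIntegral_congr_fun hU.measurableSet fun x _ => ?_)
    simp only [hχ', one_pow, dil_one, fderiv_apply_sub]
    ring
  · exact ((hc.comp (by fun_prop : Continuous fun x : EuclideanSpace ℝ (Fin n) =>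
      ((1:ℝ), x))).aestronglyMeasurable).mul hg.aestronglyMeasurable
  · rw [ae_restrict_iff' hU.measurableSet]
    refine Eventually.of_forall fun x hx ρ hρ => ?_
    rw [norm_mul, Real.norm_eq_abs (g x)]
    exact mul_le_mul_of_nonneg_right (hM (ρ, x) ⟨hρ, ball_subset_closedBall hx⟩) (abs_nonneg _)

/-- Rellich's inequality in a ball: the boundary term has a sign. -/
theorem H10.rellich (hf : H10 (ball 0 R) f) (ha : a ∈ ball (0 : EuclideanSpace ℝ (Fin n)) R)
    (hq : ContDiff ℝ 2 q) (hq0 : ∀ x, 0 ≤ q x) :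
    IntegrableOn (fun x => gr (sqd a) f x * (q x * lapl f x + gr q f x) +
      ((2 - n) * q x - 1 / 2 * gr (sqd a) q x) * gr f f x) (ball 0 R) ∧
    0 ≤ ∫ x in ball 0 R, (gr (sqd a) f x * (q x * lapl f x + gr q f x) +
      ((2 - n) * q x - 1 / 2 * gr (sqd a) q x) * gr f f x) := by
  have hU : IsOpen (ball (0 : EuclideanSpace ℝ (Fin n)) R) := isOpen_ball
  have hb : Bornology.IsBounded (ball (0 : EuclideanSpace ℝ (Fin n)) R) := isBounded_ball
  have hq1 : ContDiff ℝ 1 q := hq.of_le (by norm_num)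
  set Ψ : EuclideanSpace ℝ (Fin n) → ℝ := fun x => q x * lapl f x + gr q f x with hΨ
  set D : EuclideanSpace ℝ (Fin n) → ℝ := fun x => fderiv ℝ f x (x - a) with hD
  have hΨ2 : _root_.L2 (ball 0 R) Ψ :=
    (L2.bdd_mul hU hb hq.continuous hf.lap).add (hf.L2_gr_left hU hb hq1)
  have hD2 : _root_.L2 (ball 0 R) D := hf.L2_radial a
  have hgr := hf.integrableOn_gr hf
  set ρ : ℕ → ℝ := fun k => 1 - 1 / ((k:ℝ) + 1 + 1) with hρ
  have hk : ∀ k : ℕ, 0 < 1 / ((k:ℝ) + 1 + 1) ∧ 1 / ((k:ℝ) + 1 + 1) < 1 := fun k => by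
    have : (0:ℝ) ≤ k := k.cast_nonneg
    refine ⟨by positivity, ?_⟩
    rw [div_lt_one (by positivity)]
    linarith
  have hρ0 : ∀ k, 0 < ρ k := fun k => by simp only [hρ]; linarith [(hk k).2]
  have hρ1 : ∀ k, ρ k < 1 := fun k => by simp only [hρ]; linarith [(hk k).1]
  have hr1 : ∀ k, 1 < (ρ k)⁻¹ := fun k => (one_lt_inv₀ (hρ0 k)).2 (hρ1 k)
  have hρlim : Tendsto ρ atTop (nhdsWithin 1 {1}ᶜ) := by
    refine tendsto_nhdsWithin_iff.2 ⟨?_, Eventually.of_forall fun k => (hρ1 k).ne⟩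
    have := (tendsto_one_div_add_atTop_nhds_zero_nat (𝕜 := ℝ)).comp (tendsto_add_atTop_nat 1)
    simpa [hρ, Function.comp_def] using this.const_sub 1
  have hrlim : Tendsto (fun k => (ρ k)⁻¹) atTop (nhdsWithin 1 {1}ᶜ) := by
    refine tendsto_nhdsWithin_iff.2 ⟨?_, Eventually.of_forall fun k => (hr1 k).ne'⟩
    simpa using (tendsto_nhds_of_tendsto_nhdsWithin hρlim).inv₀ one_ne_zero
  set H : ℝ → ℝ := fun ρ => ∫ x in ball 0 R,
    ((1 / 2 - ρ) * q x + 1 / 2 * ρ ^ n * q (dil a ρ x)) * gr f f x with hH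
  have hH1 : H 1 = 0 := by
    simp only [hH, one_pow, dil_one]
    rw [← integral_zero (EuclideanSpace ℝ (Fin n)) ℝ (μ := volume.restrict (ball 0 R))]
    congr 1
    ext x
    ring
  have hslope := (hasDerivAt_iff_tendsto_slope.1
    (hasDerivAt_integral_dil_weight (a := a) hq1 hgr)).comp hρlim
  set u : ℕ → EuclideanSpace ℝ (Fin n) → ℝ := fun k x =>
    ((ρ k)⁻¹ - 1)⁻¹ * (f (dil a (ρ k)⁻¹ x) - f x) with hu
  have huc : ∀ k, Continuous (u k) := fun k => continuous_const.mul
    ((hf.cont.comp (contDiff_dil _ (k := 0)).continuous).sub hf.cont)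
  have hu2 : ∀ k, _root_.L2 (ball 0 R) (u k) := fun k => (huc k).L2 hU hb
  have key : ∫ x in ball 0 R, 1 / 2 * (D x - Ψ x) ^ 2 ≤
      1 / 2 * (∫ x in ball 0 R, D x ^ 2) - (∫ x in ball 0 R,
        (-q x + 1 / 2 * (n * q x) + 1 / 2 * (1 / 2 * gr (sqd a) q x)) * gr f f x) +
        1 / 2 * ∫ x in ball 0 R, Ψ x ^ 2 := by
    refine (integrable_and_integral_le_of_tendsto (G := fun k x => 1 / 2 * (u k x - Ψ x) ^ 2)
      (C := fun k => 1 / 2 * (∫ x in ball 0 R, D x ^ 2) - slope H 1 (ρ k) +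
        1 / 2 * ∫ x in ball 0 R, Ψ x ^ 2)
      (fun k => Eventually.of_forall fun x => by positivity)
      (fun k => ((hu2 k).sub hΨ2).integrable_sq.const_mul _) ?_ (fun k => ?_)
      ((hslope.const_sub _).add_const _)).2
    · rw [ae_restrict_iff' hU.measurableSet]
      refine Eventually.of_forall fun x hx => ?_
      have h1 : HasDerivAt (fun r => f (dil a r x)) (D x) 1 := by
        have h2 : HasFDerivAt f (fderiv ℝ f x) (dil a 1 x) := by
          rw [dil_one]; exact (hf.differentiableAt hU hx).hasFDerivAt
        exact h2.comp_hasDerivAt 1 (hasDerivAt_dil 1 x)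
      have h3 := (hasDerivAt_iff_tendsto_slope.1 h1).comp hrlim
      have h4 : Tendsto (fun k => u k x) atTop (nhds (D x)) := by
        refine h3.congr fun k => ?_
        simp [slope_def_field, hu, dil_one, div_eq_inv_mul]
      exact ((h4.sub_const _).pow 2).const_mul _
    · rw [integral_half_sub_sq (hu2 k) hΨ2]
      have hr0 : 0 < (ρ k)⁻¹ - 1 := by linarith [hr1 k]
      have b1 : ∫ x in ball 0 R, u k x ^ 2 ≤ ∫ x in ball 0 R, D x ^ 2 := by
        have := hf.integral_dil_sub_sq_le (a := a) (hr1 k)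
        simp only [hu, mul_pow, inv_pow]
        rw [integral_const_mul, inv_mul_le_iff₀ (by positivity)]
        exact this
      have b2 : -∫ x in ball 0 R, u k x * Ψ x ≤ -slope H 1 (ρ k) := by
        have := hf.integral_dil_mul ha hq (hr1 k) hq0
        simp only [inv_inv] at this
        simp only [hu, mul_assoc]
        rw [integral_const_mul, ← mul_neg, inv_mul_le_iff₀ hr0]
        refine this.trans_eq ?_
        rw [slope_def_field, hH1]
        have h1 := hρ0 k
        have h2 : ρ k - 1 ≠ 0 := by linarith [hρ1 k]
        have h3 : (ρ k)⁻¹ * (1 - ρ k) = (ρ k)⁻¹ - 1 := by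
          rw [mul_sub, inv_mul_cancel₀ h1.ne', mul_one]
        rw [← h3]
        simp only [hH]
        field_simp
        ring
      linarith
  have iDΨ := hD2.mul hΨ2
  have cw : Continuous fun x => -q x + 1 / 2 * (n * q x) + 1 / 2 * (1 / 2 * gr (sqd a) q x) := by
    have h1 := hq.continuous
    have h2 : Continuous (gr (sqd a) q) := continuous_gr (contDiff_sqd a) hq1
    fun_prop
  have iw := integrableOn_bdd_mul hU hb cw hgr
  have e : (fun x => gr (sqd a) f x * (q x * lapl f x + gr q f x) +
      ((2 - n) * q x - 1 / 2 * gr (sqd a) q x) * gr f f x) = fun x => 2 * (D x * Ψ x) + (-2) *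
        ((-q x + 1 / 2 * (n * q x) + 1 / 2 * (1 / 2 * gr (sqd a) q x)) * gr f f x) := by
    ext x
    simp only [hD, hΨ, fderiv_apply_sub]
    ring
  rw [e]
  refine ⟨(iDΨ.const_mul _).add (iw.const_mul _), ?_⟩
  rw [integral_lin_two iDΨ iw]
  rw [integral_half_sub_sq hD2 hΨ2] at key
  linarith

end Rellich

section Weight

variable {n : ℕ} {χ g h : EuclideanSpace ℝ (Fin n) → ℝ} {x : EuclideanSpace ℝ (Fin n)}

/-- The Carleman weight `χ e^{θ g}`. -/
noncomputable def wt {n : ℕ} (χ g : EuclideanSpace ℝ (Fin n) → ℝ) (θ : ℝ)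
    (x : EuclideanSpace ℝ (Fin n)) : ℝ := χ x * Real.exp (θ * g x)

theorem contDiff_wt {k : WithTop ℕ∞} (hχ : ContDiff ℝ k χ) (hg : ContDiff ℝ k g) (θ : ℝ) :
    ContDiff ℝ k (wt χ g θ) :=
  hχ.mul (contDiff_const.mul hg).exp

theorem hasDerivAt_exp_mul (θ s : ℝ) :
    HasDerivAt (fun s => Real.exp (θ * s)) (θ * Real.exp (θ * s)) s := by
  have := ((hasDerivAt_id s).const_mul θ).exp
  refine this.congr_deriv ?_
  simp [mul_comm]

theorem gr_wt_left (hχ : ContDiff ℝ 1 χ) (hg : ContDiff ℝ 1 g) (θ : ℝ) :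
    gr (wt χ g θ) h x = Real.exp (θ * g x) * (gr χ h x + θ * χ x * gr g h x) := by
  have h1 : DifferentiableAt ℝ g x := hg.differentiable (by simp) x
  have h2 : DifferentiableAt ℝ χ x := hχ.differentiable (by simp) x
  have h3 : DifferentiableAt ℝ (fun x => Real.exp (θ * g x)) x := (h1.const_mul θ).exp
  unfold wt
  rw [gr_mul_left h2 h3, gr_comp_left (hasDerivAt_exp_mul θ (g x)) h1]
  ring

theorem lapl_wt (hχ : ContDiff ℝ 2 χ) (hg : ContDiff ℝ 2 g) (θ : ℝ) :
    lapl (wt χ g θ) x = Real.exp (θ * g x) * (lapl χ x + 2 * θ * gr χ g x +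
      χ x * (θ * lapl g x + θ ^ 2 * gr g g x)) := by
  have h3 : ContDiffAt ℝ 2 (fun x => Real.exp (θ * g x)) x :=
    (contDiff_const.mul hg).exp.contDiffAt
  unfold wt
  rw [lapl_mul hχ.contDiffAt h3, gr_comp_right (hasDerivAt_exp_mul θ (g x))
    (hg.differentiable (by simp) x), lapl_comp (k'' := fun s => θ * (θ * Real.exp (θ * s)))
      (hasDerivAt_exp_mul θ) (fun s => (hasDerivAt_exp_mul θ s).const_mul θ) hg.contDiffAt]
  ring

end Weight

/-- A regularised solution of the harmonic heat equation on the time interval `[0, b]`, with its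
first two time derivatives. -/
structure NiceSol {n : ℕ} (R μ b : ℝ) (Y P Z : ℝ → EuclideanSpace ℝ (Fin n) → ℝ) : Prop where
  cY : Continuous fun p : ℝ × EuclideanSpace ℝ (Fin n) => Y p.1 p.2
  cP : Continuous fun p : ℝ × EuclideanSpace ℝ (Fin n) => P p.1 p.2
  cZ : Continuous fun p : ℝ × EuclideanSpace ℝ (Fin n) => Z p.1 p.2
  zY : ∀ t, ∀ x ∉ ball (0 : EuclideanSpace ℝ (Fin n)) R, Y t x = 0
  zP : ∀ t, ∀ x ∉ ball (0 : EuclideanSpace ℝ (Fin n)) R, P t x = 0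
  dY : ∀ t x, HasDerivAt (fun s => Y s x) (P t x) t
  dP : ∀ t x, HasDerivAt (fun s => P s x) (Z t x) t
  sY : ∀ t ∈ Icc 0 b, ContDiffOn ℝ 2 (Y t) (ball 0 R)
  sP : ∀ t ∈ Icc 0 b, ContDiffOn ℝ 2 (P t) (ball 0 R)
  eY : ∀ t ∈ Icc 0 b, ∀ x ∈ ball (0 : EuclideanSpace ℝ (Fin n)) R,
    lapl (Y t) x = P t x + μ ^ 2 * sqd 0 x * Y t x
  eP : ∀ t ∈ Icc 0 b, ∀ x ∈ ball (0 : EuclideanSpace ℝ (Fin n)) R,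
    lapl (P t) x = Z t x + μ ^ 2 * sqd 0 x * P t x

section Dynamic

variable {n : ℕ} {R μ b t : ℝ} {Y P Z : ℝ → EuclideanSpace ℝ (Fin n) → ℝ}
  {χ g η η' u w : EuclideanSpace ℝ (Fin n) → ℝ}

theorem NiceSol.mono (h : NiceSol R μ b Y P Z) {b' : ℝ} (hb : b' ≤ b) : NiceSol R μ b' Y P Z :=
  ⟨h.cY, h.cP, h.cZ, h.zY, h.zP, h.dY, h.dP, fun t ht => h.sY t ⟨ht.1, ht.2.trans hb⟩,
    fun t ht => h.sP t ⟨ht.1, ht.2.trans hb⟩, fun t ht => h.eY t ⟨ht.1, ht.2.trans hb⟩,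
    fun t ht => h.eP t ⟨ht.1, ht.2.trans hb⟩⟩

theorem continuous_of_uncurry {F : ℝ → EuclideanSpace ℝ (Fin n) → ℝ}
    (hF : Continuous fun p : ℝ × EuclideanSpace ℝ (Fin n) => F p.1 p.2) (t : ℝ) :
    Continuous (F t) :=
  hF.comp (by fun_prop : Continuous fun x : EuclideanSpace ℝ (Fin n) => (t, x))

theorem NiceSol.h10Y (h : NiceSol R μ b Y P Z) (ht : t ∈ Icc 0 b) : H10 (ball 0 R) (Y t) := by
  refine H10.of_lapl isOpen_ball isBounded_ball (continuous_of_uncurry h.cY t) (h.zY t)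
    (h.sY t ht) (L2.congr isOpen_ball.measurableSet (Continuous.L2 isOpen_ball isBounded_ball
      (f := fun x => P t x + μ ^ 2 * sqd 0 x * Y t x) ?_) fun x hx => (h.eY t ht x hx).symm)
  exact (continuous_of_uncurry h.cP t).add ((continuous_const.mul
    (contDiff_sqd 0 (k := 0)).continuous).mul (continuous_of_uncurry h.cY t))

theorem NiceSol.h10P (h : NiceSol R μ b Y P Z) (ht : t ∈ Icc 0 b) : H10 (ball 0 R) (P t) := by
  refine H10.of_lapl isOpen_ball isBounded_ball (continuous_of_uncurry h.cP t) (h.zP t)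
    (h.sP t ht) (L2.congr isOpen_ball.measurableSet (Continuous.L2 isOpen_ball isBounded_ball
      (f := fun x => Z t x + μ ^ 2 * sqd 0 x * P t x) ?_) fun x hx => (h.eP t ht x hx).symm)
  exact (continuous_of_uncurry h.cZ t).add ((continuous_const.mul
    (contDiff_sqd 0 (k := 0)).continuous).mul (continuous_of_uncurry h.cP t))

theorem hasDerivAt_integral_of_continuousOn {U : Set (EuclideanSpace ℝ (Fin n))}
    (hU : IsOpen U) (hb : Bornology.IsBounded U) {I : Set ℝ} (hI : IsOpen I)
    {F F' : ℝ → EuclideanSpace ℝ (Fin n) → ℝ} (hF : ∀ t ∈ I, Continuous (F t))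
    (hF' : ContinuousOn (fun p : ℝ × EuclideanSpace ℝ (Fin n) => F' p.1 p.2) (I ×ˢ univ))
    (hd : ∀ t ∈ I, ∀ x, HasDerivAt (fun s => F s x) (F' t x) t) (ht : t ∈ I) :
    HasDerivAt (fun s => ∫ x in U, F s x) (∫ x in U, F' t x) t := by
  obtain ⟨δ, hδ, hδI⟩ := nhds_basis_closedBall.mem_iff.1 (hI.mem_nhds ht)
  have hFt : ∀ s ∈ I, Continuous (F' s) := fun s hs => by
    have := hF'.comp (by fun_prop : Continuous fun x : EuclideanSpace ℝ (Fin n) =>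
      (s, x)).continuousOn (s := univ) fun x _ => ⟨hs, mem_univ _⟩
    exact continuousOn_univ.1 this
  obtain ⟨M, hM⟩ := ((isCompact_closedBall t δ).prod hb.isCompact_closure).exists_bound_of_continuousOn
    (hF'.mono (prod_mono hδI (subset_univ _)))
  refine (hasDerivAt_integral_of_dominated_loc_of_deriv_le (μ := volume.restrict U)
    (bound := fun _ => M) (s := closedBall t δ) (closedBall_mem_nhds t hδ) ?_
    ((hF t ht).integrableOn_of_isBounded hU hb) (hFt t ht).aestronglyMeasurable ?_ ?_ ?_).2
  · filter_upwards [hI.mem_nhds ht] with s hs using (hF s hs).aestronglyMeasurable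
  · rw [ae_restrict_iff' hU.measurableSet]
    exact Eventually.of_forall fun x hx s hs => hM (s, x) ⟨hs, subset_closure hx⟩
  · exact continuous_const.integrableOn_of_isBounded hU hb
  · exact Eventually.of_forall fun x s hs => hd s (hδI hs) x

/-- The part of the energy derivative made of exact divergences. -/
theorem H10.dynamic_identity {U : Set (EuclideanSpace ℝ (Fin n))} (hu : H10 U u) (hw : H10 U w)
    (hU : IsOpen U) (hb : Bornology.IsBounded U) (hη : ContDiff ℝ 2 η) (hη' : ContDiff ℝ 2 η') :
    IZ U (fun x => η x ^ 2 * (w x * lapl u x - u x * lapl w x) + 2 * gr η η' x * u x ^ 2 +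
      2 * gr η η x * (u x * w x) + 4 * η' x * u x * gr η u x + 2 * η' x * lapl η x * u x ^ 2 +
      4 * η x * w x * gr η u x + 2 * η x * lapl η x * (u x * w x)) := by
  have hη2 : ContDiff ℝ 2 (fun z => η z * η z) := hη.mul hη
  refine (((hu.div_smooth hu hU hb hη' hη).const_mul 2).add
    (((hu.div_smooth hw hU hb hη hη).const_mul 2).add ((hw.green hu hU hb hη2).add
      ((hu.green hw hU hb hη2).const_mul (-1))))).congr hU.measurableSet fun x _ => ?_
  have hd := hη.differentiable (by simp) x
  simp only [gr_mul_left hd hd, gr_comm w u, gr_comm η' η]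
  ring

/-- The density of the Carleman energy. -/
noncomputable def qdens {n : ℕ} (χ g u w : EuclideanSpace ℝ (Fin n) → ℝ) (θ θ' : ℝ)
    (x : EuclideanSpace ℝ (Fin n)) : ℝ :=
  Real.exp (θ * g x) ^ 2 * (-χ x ^ 2 * (u x * w x) +
    (gr χ χ x + 2 * θ * χ x * gr χ g x - θ' * g x * χ x ^ 2) * u x ^ 2)

/-- The zeroth order part of the conjugated operator. -/
noncomputable def ppot {n : ℕ} (μ : ℝ) (g : EuclideanSpace ℝ (Fin n) → ℝ) (θ θ' : ℝ)
    (x : EuclideanSpace ℝ (Fin n)) : ℝ :=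
  θ ^ 2 * gr g g x + θ' * g x - μ ^ 2 * sqd 0 x

theorem NiceSol.integral_qdens (h : NiceSol R μ b Y P Z) (ht : t ∈ Icc 0 b)
    (hχ : ContDiff ℝ 2 χ) (hg : ContDiff ℝ 2 g) (θ θ' : ℝ) :
    ∫ x in ball 0 R, qdens χ g (Y t) (P t) θ θ' x =
      ∫ x in ball 0 R, (gr (fun z => wt χ g θ z * Y t z) (fun z => wt χ g θ z * Y t z) x -
        ppot μ g θ θ' x * (wt χ g θ x * Y t x) ^ 2) := by
  have hU : IsOpen (ball (0 : EuclideanSpace ℝ (Fin n)) R) := isOpen_ball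
  have hb : Bornology.IsBounded (ball (0 : EuclideanSpace ℝ (Fin n)) R) := isBounded_ball
  have hY := h.h10Y ht
  have hη := contDiff_wt hχ hg θ
  have hχ1 : ContDiff ℝ 1 χ := hχ.of_le (by norm_num)
  have hg1 : ContDiff ℝ 1 g := hg.of_le (by norm_num)
  have hf := hY.mul hU hb hη
  have hz := ((hf.green hf hU hb contDiff_one).const_mul (-1)).add
    (hY.div_smooth hY hU hb hη hη)
  have hi : IntegrableOn (fun x => gr (fun z => wt χ g θ z * Y t z) (fun z => wt χ g θ z * Y t z) x
      - ppot μ g θ θ' x * (wt χ g θ x * Y t x) ^ 2) (ball 0 R) := by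
    refine (hf.integrableOn_gr hf).sub (integrableOn_bdd_mul hU hb ?_ (hf.integrableOn_sq hU hb))
    have h1 : Continuous (gr g g) := continuous_gr hg1 hg1
    have h2 : Continuous (sqd (0 : EuclideanSpace ℝ (Fin n))) := (contDiff_sqd 0 (k := 0)).continuous
    have h3 := hg.continuous
    unfold ppot
    fun_prop
  rw [← hz.integral_add_eq hi]
  refine setIntegral_congr_fun hU.measurableSet fun x hx => ?_
  have hηd := hη.differentiable (by simp) x
  simp only [lapl_mul hη.contDiffAt (hY.contDiffAt hU hx), gr_const_left, qdens, ppot,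
    lapl_wt hχ hg, gr_wt_left hχ1 hg1, gr_comm _ (wt χ g θ), gr_comm g χ, h.eY t ht x hx]
  unfold wt
  ring

theorem NiceSol.hasDerivAt_integral_qdens (h : NiceSol R μ b Y P Z) {I : Set ℝ} (hI : IsOpen I)
    (hIb : I ⊆ Icc 0 b) (hχ : ContDiff ℝ 2 χ) (hg : ContDiff ℝ 2 g) {θ θ' θ'' : ℝ → ℝ}
    (hθ : ∀ t ∈ I, HasDerivAt θ (θ' t) t) (hθ' : ∀ t ∈ I, HasDerivAt θ' (θ'' t) t)
    (hθ'' : ContinuousOn θ'' I) (ht : t ∈ I) {f : EuclideanSpace ℝ (Fin n) → ℝ}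
    (hf : f = fun z => wt χ g (θ t) z * Y t z) :
    HasDerivAt (fun s => ∫ x in ball 0 R, qdens χ g (Y s) (P s) (θ s) (θ' s) x)
      (∫ x in ball 0 R, (-2 * (lapl f x + ppot μ g (θ t) (θ' t) x * f x) *
        (lapl f x + ppot μ g (θ t) (θ' t) x * f x - 2 * θ t * gr g f x - θ t * lapl g x * f x -
          Real.exp (θ t * g x) * (2 * gr χ (Y t) x + lapl χ x * Y t x)) -
        (2 * θ t * θ' t * gr g g x + θ'' t * g x) * f x ^ 2)) t := by
  have hU : IsOpen (ball (0 : EuclideanSpace ℝ (Fin n)) R) := isOpen_ball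
  have hb : Bornology.IsBounded (ball (0 : EuclideanSpace ℝ (Fin n)) R) := isBounded_ball
  have hχ1 : ContDiff ℝ 1 χ := hχ.of_le (by norm_num)
  have hg1 : ContDiff ℝ 1 g := hg.of_le (by norm_num)
  set F' : ℝ → EuclideanSpace ℝ (Fin n) → ℝ := fun s x => Real.exp (θ s * g x) ^ 2 *
    (2 * θ' s * g x * (-χ x ^ 2 * (Y s x * P s x) +
      (gr χ χ x + 2 * θ s * χ x * gr χ g x - θ' s * g x * χ x ^ 2) * Y s x ^ 2) +
      (-χ x ^ 2 * (P s x ^ 2 + Y s x * Z s x) +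
      (2 * θ' s * χ x * gr χ g x - θ'' s * g x * χ x ^ 2) * Y s x ^ 2 +
      (gr χ χ x + 2 * θ s * χ x * gr χ g x - θ' s * g x * χ x ^ 2) * (2 * Y s x * P s x))) with hF'
  have c1 := hχ.continuous
  have c2 := hg.continuous
  have c3 : Continuous (gr χ χ) := continuous_gr hχ1 hχ1
  have c4 : Continuous (gr χ g) := continuous_gr hχ1 hg1
  have cF' : ContinuousOn (fun p : ℝ × EuclideanSpace ℝ (Fin n) => F' p.1 p.2) (I ×ˢ univ) := by
    have m1 : MapsTo (fun p : ℝ × EuclideanSpace ℝ (Fin n) => p.1) (I ×ˢ univ) I := fun p hp => hp.1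
    have t0 : ContinuousOn (fun p : ℝ × EuclideanSpace ℝ (Fin n) => θ p.1) (I ×ˢ univ) :=
      ContinuousOn.comp (fun s hs => (hθ s hs).continuousAt.continuousWithinAt)
        continuousOn_fst m1
    have t1 : ContinuousOn (fun p : ℝ × EuclideanSpace ℝ (Fin n) => θ' p.1) (I ×ˢ univ) :=
      ContinuousOn.comp (fun s hs => (hθ' s hs).continuousAt.continuousWithinAt)
        continuousOn_fst m1
    have t2 : ContinuousOn (fun p : ℝ × EuclideanSpace ℝ (Fin n) => θ'' p.1) (I ×ˢ univ) :=
      ContinuousOn.comp hθ'' continuousOn_fst m1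
    have d1 : ContinuousOn (fun p : ℝ × EuclideanSpace ℝ (Fin n) => χ p.2) (I ×ˢ univ) :=
      (c1.comp continuous_snd).continuousOn
    have d2 : ContinuousOn (fun p : ℝ × EuclideanSpace ℝ (Fin n) => g p.2) (I ×ˢ univ) :=
      (c2.comp continuous_snd).continuousOn
    have d3 : ContinuousOn (fun p : ℝ × EuclideanSpace ℝ (Fin n) => gr χ χ p.2) (I ×ˢ univ) :=
      (c3.comp continuous_snd).continuousOn
    have d4 : ContinuousOn (fun p : ℝ × EuclideanSpace ℝ (Fin n) => gr χ g p.2) (I ×ˢ univ) :=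
      (c4.comp continuous_snd).continuousOn
    have e1 := h.cY.continuousOn (s := I ×ˢ univ)
    have e2 := h.cP.continuousOn (s := I ×ˢ univ)
    have e3 := h.cZ.continuousOn (s := I ×ˢ univ)
    have aux : ∀ {T T' T'' C G A B y p z : ℝ × EuclideanSpace ℝ (Fin n) → ℝ}
        {S : Set (ℝ × EuclideanSpace ℝ (Fin n))}, ContinuousOn T S → ContinuousOn T' S →
        ContinuousOn T'' S → ContinuousOn C S → ContinuousOn G S → ContinuousOn A S →
        ContinuousOn B S → ContinuousOn y S → ContinuousOn p S → ContinuousOn z S →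
        ContinuousOn (fun q => Real.exp (T q * G q) ^ 2 *
          (2 * T' q * G q * (-C q ^ 2 * (y q * p q) +
            (A q + 2 * T q * C q * B q - T' q * G q * C q ^ 2) * y q ^ 2) +
          (-C q ^ 2 * (p q ^ 2 + y q * z q) +
            (2 * T' q * C q * B q - T'' q * G q * C q ^ 2) * y q ^ 2 +
            (A q + 2 * T q * C q * B q - T' q * G q * C q ^ 2) * (2 * y q * p q)))) S := by
      intros
      fun_prop
    exact aux t0 t1 t2 d1 d2 d3 d4 e1 e2 e3
  have key := hasDerivAt_integral_of_continuousOn (t := t) hU hb hI (F' := F')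
    (F := fun s => qdens χ g (Y s) (P s) (θ s) (θ' s)) (fun s _ => ?_) cF' (fun s hs x => ?_) ht
  · refine key.congr_deriv ?_
    have htb := hIb ht
    have hY := h.h10Y htb
    have hP := h.h10P htb
    have hη := contDiff_wt hχ hg (θ t)
    have hη1 : ContDiff ℝ 1 (wt χ g (θ t)) := hη.of_le (by norm_num)
    have hη' : ContDiff ℝ 2 (fun z => θ' t * g z * wt χ g (θ t) z) :=
      (contDiff_const.mul hg).mul hη
    have hz := (hY.dynamic_identity hP hU hb hη hη').const_mul (-1)
    have hi : IntegrableOn (F' t) (ball 0 R) := by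
      refine Continuous.integrableOn_of_isBounded hU hb ?_
      have := cF'.comp (by fun_prop : Continuous fun x : EuclideanSpace ℝ (Fin n) =>
        (t, x)).continuousOn (s := univ) fun x _ => ⟨ht, mem_univ _⟩
      exact continuousOn_univ.1 this
    rw [← hz.integral_add_eq hi]
    refine setIntegral_congr_fun hU.measurableSet fun x hx => ?_
    have hηd := hη.differentiable (by simp) x
    have hgd := hg.differentiable (by simp) x
    have hYd := hY.differentiableAt hU hx
    have hgd' : DifferentiableAt ℝ (fun z => θ' t * g z) x := hgd.const_mul _
    simp only [hf, lapl_mul hη.contDiffAt (hY.contDiffAt hU hx), ppot, gr_mul_right hηd hYd,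
      gr_mul_right hgd' hηd, gr_const_mul_right,
      lapl_wt hχ hg, gr_wt_left hχ1 hg1, gr_comm _ (wt χ g (θ t)), gr_comm g χ, h.eY t htb x hx,
      h.eP t htb x hx, hF']
    unfold wt
    ring
  · have h1 := continuous_of_uncurry h.cY s
    have h2 := continuous_of_uncurry h.cP s
    unfold qdens
    fun_prop
  · have h1 := ((((hθ s hs).mul_const (g x)).exp).pow 2)
    have h2 := ((h.dY s x).mul (h.dP s x)).const_mul (-χ x ^ 2)
    have h3 := ((((hθ s hs).const_mul 2).mul_const (χ x)).mul_const (gr χ g x)).const_add (gr χ χ x)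
    have h4 := (h3.sub (((hθ' s hs).mul_const (g x)).mul_const (χ x ^ 2))).mul ((h.dY s x).pow 2)
    refine (h1.mul (h2.add h4)).congr_deriv ?_
    simp only [hF', Pi.add_apply, Pi.mul_apply, Pi.sub_apply, Pi.pow_apply]
    push_cast
    ring

end Dynamic

section Static

variable {n : ℕ} {R lam c : ℝ} {a : EuclideanSpace ℝ (Fin n)} {f p : EuclideanSpace ℝ (Fin n) → ℝ}

/-- The Gaussian weight `c e^{-λ|x-a|²}`. -/
noncomputable def gw {n : ℕ} (a : EuclideanSpace ℝ (Fin n)) (lam c : ℝ) :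
    EuclideanSpace ℝ (Fin n) → ℝ :=
  wt (fun _ => c) (sqd a) (-lam)

theorem contDiff_gw {k : WithTop ℕ∞} : ContDiff ℝ k (gw a lam c) :=
  contDiff_wt contDiff_const (contDiff_sqd a) _

theorem gw_nonneg (hc : 0 ≤ c) (x : EuclideanSpace ℝ (Fin n)) : 0 ≤ gw a lam c x := by
  unfold gw wt; positivity

theorem gr_gw (h : EuclideanSpace ℝ (Fin n) → ℝ) (x : EuclideanSpace ℝ (Fin n)) :
    gr (gw a lam c) h x = -lam * gw a lam c x * gr (sqd a) h x := by
  rw [gw, gr_wt_left contDiff_const (contDiff_sqd a), gr_const_left, wt]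
  ring

theorem lapl_gw (x : EuclideanSpace ℝ (Fin n)) :
    lapl (gw a lam c) x = gw a lam c x * (4 * lam ^ 2 * sqd a x - 2 * n * lam) := by
  rw [gw, lapl_wt contDiff_const (contDiff_sqd a), gr_const_left, lapl_const, lapl_sqd, gr_sqd_sqd,
    wt]
  ring

theorem lapl_gw_mul (x : EuclideanSpace ℝ (Fin n)) :
    lapl (fun z => gw a lam c z * (2 * n + -4 * lam * sqd a z)) x = gw a lam c x *
      ((4 * lam ^ 2 * sqd a x - 2 * n * lam) * (2 * n - 4 * lam * sqd a x) +
        32 * lam ^ 2 * sqd a x - 8 * n * lam) := by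
  have h1 : ContDiff ℝ 2 (fun z => -4 * lam * sqd a z) := contDiff_const.mul (contDiff_sqd a)
  rw [lapl_mul contDiff_gw.contDiffAt (contDiff_const.add h1).contDiffAt, lapl_gw, gr_gw,
    lapl_add contDiffAt_const h1.contDiffAt, lapl_const, lapl_const_mul, lapl_sqd,
    gr_add_right (by fun_prop) (h1.differentiable (by simp) x), gr_const_right,
    gr_const_mul_right, gr_sqd_sqd]
  ring

theorem H10.static_le (hf : H10 (ball 0 R) f) (ha : a ∈ ball (0 : EuclideanSpace ℝ (Fin n)) R)
    (hlam : 0 ≤ lam) (hc : 0 ≤ c) (hp : ContDiff ℝ 2 p) :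
    IntegrableOn (fun x => -2 * (lapl f x + p x * f x) * (lapl f x + p x * f x +
        2 * gw a lam c x * gr (sqd a) f x +
        gw a lam c x * (2 * n + -4 * lam * sqd a x) * f x)) (ball 0 R) ∧
    ∫ x in ball 0 R, -2 * (lapl f x + p x * f x) * (lapl f x + p x * f x +
        2 * gw a lam c x * gr (sqd a) f x +
        gw a lam c x * (2 * n + -4 * lam * sqd a x) * f x) ≤
      ∫ x in ball 0 R, (8 * gw a lam c x ^ 2 + 2 * gw a lam c x * gr (sqd a) p x +
        8 * gw a lam c x * p x + gw a lam c x * (4 * (4 * lam ^ 2 * sqd a x - 2 * n * lam) -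
        ((4 * lam ^ 2 * sqd a x - 2 * n * lam) * (2 * n - 4 * lam * sqd a x) +
        32 * lam ^ 2 * sqd a x - 8 * n * lam))) * f x ^ 2 := by
  have hU : IsOpen (ball (0 : EuclideanSpace ℝ (Fin n)) R) := isOpen_ball
  have hb : Bornology.IsBounded (ball (0 : EuclideanSpace ℝ (Fin n)) R) := isBounded_ball
  have hp1 : ContDiff ℝ 1 p := hp.of_le (by norm_num)
  have hs : ContDiff ℝ 2 (sqd a) := contDiff_sqd a
  have hs1 : ContDiff ℝ 1 (sqd a) := contDiff_sqd a
  have hq : ContDiff ℝ 2 (gw a lam c) := contDiff_gw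
  have hm : ContDiff ℝ 2 (fun z => gw a lam c z * (2 * n + -4 * lam * sqd a z)) :=
    hq.mul (contDiff_const.add (contDiff_const.mul hs))
  have hr := hf.rellich ha hq (gw_nonneg hc)
  have hz := ((hf.mul_lapl hU hb hm).const_mul (-2)).add
    (((hf.mul_lapl hU hb hq).const_mul 8).add
      ((hf.div_smooth hf hU hb (hp.mul hq) hs).const_mul (-2)))
  have c1 := hp.continuous
  have c2 := hq.continuous
  have c3 := hs.continuous
  have c4 : Continuous (gr (sqd a) p) := continuous_gr hs1 hp1
  have h2 := hf.L2 hU hb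
  have hS : _root_.L2 (ball 0 R) (fun x => lapl f x + p x * f x) :=
    hf.lap.add (L2.bdd_mul hU hb c1 h2)
  have hD := L2.bdd_mul hU hb (f := fun x => 2 * gw a lam c x) (by fun_prop)
    (hf.L2_gr_left hU hb hs1)
  have hM := L2.bdd_mul hU hb hm.continuous h2
  have iL := (hS.const_mul (-2)).mul ((hS.add hD).add hM)
  set k : EuclideanSpace ℝ (Fin n) → ℝ := fun x =>
    8 * gw a lam c x ^ 2 + 2 * gw a lam c x * gr (sqd a) p x +
        8 * gw a lam c x * p x + gw a lam c x * (4 * (4 * lam ^ 2 * sqd a x - 2 * n * lam) -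
        ((4 * lam ^ 2 * sqd a x - 2 * n * lam) * (2 * n - 4 * lam * sqd a x) +
        32 * lam ^ 2 * sqd a x - 8 * n * lam)) with hk
  have iR : IntegrableOn (fun x => k x * f x ^ 2) (ball 0 R) :=
    integrableOn_bdd_mul hU hb (by simp only [hk]; fun_prop) (hf.integrableOn_sq hU hb)
  have iR' := iR.sub (hr.1.const_mul 4)
  refine ⟨iL, ?_⟩
  calc _ ≤ ∫ x in ball 0 R, (_ + (k x * f x ^ 2 - 4 * _)) := by
        refine setIntegral_mono_on iL (hz.1.add iR') hU.measurableSet fun x hx => ?_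
        have hpd := hp.differentiable (by simp) x
        have hqd := hq.differentiable (by simp) x
        have hN : 0 ≤ 4 * lam * gw a lam c x * gr (sqd a) f x ^ 2 +
            2 * (lapl f x + p x * f x + 2 * gw a lam c x * f x) ^ 2 := by
          have := gw_nonneg (a := a) (lam := lam) hc x
          positivity
        simp only [lapl_gw_mul, lapl_gw, gr_gw, gr_comm (sqd a) (gw a lam c),
          gr_mul_left hpd hqd, lapl_sqd, gr_sqd_sqd, gr_comm p (sqd a), hk]
        linarith
    _ = ∫ x in ball 0 R, (k x * f x ^ 2 - 4 * _) := hz.integral_add_eq iR'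
    _ ≤ _ := by
        rw [integral_sub iR (hr.1.const_mul 4), integral_const_mul]
        linarith [hr.2]

end Static

section RoughWeight

/-- The lower order terms of the Carleman weight are dominated by the main one. -/
theorem exists_carleman_error_bound (n : ℕ) {lam R S : ℝ} (hlam : 0 < lam) :
    ∃ Ce : ℝ, 0 < Ce ∧ ∀ κ μ θ θ' θ'' F s r₀ D₀ : ℝ, 1 ≤ κ → 0 ≤ μ → 4 * κ ≤ θ →
      μ ≤ θ / (4 * κ) → |θ'| ≤ θ ^ 2 / κ → |θ''| ≤ 2 * θ ^ 3 / κ ^ 2 → 0 ≤ F → F ≤ 1 → 0 ≤ s →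
      s ≤ S → 0 ≤ r₀ → r₀ ≤ R ^ 2 → |D₀| ≤ 8 * R ^ 2 →
      8 * (lam * θ * F) ^ 2 - 8 * lam * (lam * θ * F) * θ' * F * s -
        2 * (lam * θ * F) * μ ^ 2 * D₀ + 8 * (lam * θ * F) * (θ' * (F - 2) - μ ^ 2 * r₀) +
        (lam * θ * F) * (4 * (4 * lam ^ 2 * s - 2 * n * lam) -
        ((4 * lam ^ 2 * s - 2 * n * lam) * (2 * n - 4 * lam * s) +
        32 * lam ^ 2 * s - 8 * n * lam)) - 8 * θ * θ' * lam ^ 2 * F ^ 2 * s - θ'' * (F - 2) ≤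
      Ce * (θ ^ 3 / κ) := by
  obtain ⟨M, hM⟩ := (isCompact_Icc (a := (0:ℝ)) (b := S)).exists_bound_of_continuousOn
    (f := fun s : ℝ => 4 * (4 * lam ^ 2 * s - 2 * n * lam) -
        ((4 * lam ^ 2 * s - 2 * n * lam) * (2 * n - 4 * lam * s) +
        32 * lam ^ 2 * s - 8 * n * lam)) (by fun_prop)
  refine ⟨2 * lam ^ 2 + 8 * lam ^ 2 * |S| + lam * R ^ 2 + 16 * lam + lam * R ^ 2 + lam * |M| +
    8 * lam ^ 2 * |S| + 4, by positivity, ?_⟩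
  intro κ μ θ θ' θ'' F s r₀ D₀ hκ hμ hθ hμθ hθ' hθ'' hF0 hF1 hs0 hsS hr0 hrR hD
  have hκ0 : 0 < κ := by linarith
  have hθ0 : 0 < θ := by linarith
  have hsS' : s ≤ |S| := hsS.trans (le_abs_self S)
  set q := lam * θ * F with hq
  have hq0 : 0 ≤ q := by positivity
  have hq1 : q ≤ lam * θ := mul_le_of_le_one_right (by positivity) hF1
  set X := θ ^ 3 / κ with hX
  have hX0 : 0 < X := by positivity
  have hθ2 : θ ^ 2 ≤ X / 4 := by
    rw [hX, div_div, le_div_iff₀ (by positivity)]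
    nlinarith [sq_nonneg θ]
  have hθ1 : θ ≤ X := by nlinarith
  have hμ2 : θ * μ ^ 2 ≤ X / 16 := by
    have h1 : μ ^ 2 ≤ (θ / (4 * κ)) ^ 2 := pow_le_pow_left₀ hμ hμθ 2
    have h2 : θ * (θ / (4 * κ)) ^ 2 = X / 16 / κ := by rw [hX]; field_simp; ring
    have h3 : X / 16 / κ ≤ X / 16 := div_le_self (by positivity) hκ
    nlinarith
  have hθθ' : θ * |θ'| ≤ X := by
    have := mul_le_mul_of_nonneg_left hθ' hθ0.le
    refine this.trans_eq ?_
    rw [hX]; ring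
  have hθ3 : |θ''| ≤ 2 * X := by
    refine hθ''.trans ?_
    have : 2 * θ ^ 3 / κ ^ 2 = 2 * X / κ := by rw [hX]; field_simp
    rw [this]
    exact div_le_self (by positivity) hκ
  have hqθ' : q * |θ'| ≤ lam * X := by
    calc q * |θ'| ≤ lam * θ * |θ'| := mul_le_mul_of_nonneg_right hq1 (abs_nonneg _)
      _ = lam * (θ * |θ'|) := by ring
      _ ≤ _ := mul_le_mul_of_nonneg_left hθθ' hlam.le
  have hqμ : q * μ ^ 2 ≤ lam * X / 16 := by
    calc q * μ ^ 2 ≤ lam * θ * μ ^ 2 := mul_le_mul_of_nonneg_right hq1 (sq_nonneg _)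
      _ = lam * (θ * μ ^ 2) := by ring
      _ ≤ lam * (X / 16) := mul_le_mul_of_nonneg_left hμ2 hlam.le
      _ = _ := by ring
  have e1 : 8 * q ^ 2 ≤ 2 * lam ^ 2 * X := by
    have : q ^ 2 ≤ (lam * θ) ^ 2 := pow_le_pow_left₀ hq0 hq1 2
    have h2 := mul_le_mul_of_nonneg_left hθ2 (sq_nonneg lam)
    nlinarith
  have hFs : F * s ≤ |S| := (mul_le_of_le_one_left hs0 hF1).trans hsS'
  have e2 : -(8 * lam * q * θ' * F * s) ≤ 8 * lam ^ 2 * |S| * X := by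
    calc -(8 * lam * q * θ' * F * s) ≤ |8 * lam * q * θ' * F * s| := neg_le_abs _
      _ = 8 * lam * (q * |θ'|) * (F * s) := by
        simp only [abs_mul, abs_of_nonneg hq0, abs_of_pos hlam, abs_of_nonneg hF0,
          abs_of_nonneg hs0, abs_of_nonneg (by norm_num : (0:ℝ) ≤ 8)]
        ring
      _ ≤ 8 * lam * (lam * X) * |S| := by gcongr
      _ = _ := by ring
  have e3 : -(2 * q * μ ^ 2 * D₀) ≤ lam * R ^ 2 * X := by
    calc -(2 * q * μ ^ 2 * D₀) ≤ |2 * q * μ ^ 2 * D₀| := neg_le_abs _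
      _ = 2 * (q * μ ^ 2) * |D₀| := by
        rw [abs_mul, abs_of_nonneg (by positivity : 0 ≤ 2 * q * μ ^ 2)]; ring
      _ ≤ 2 * (lam * X / 16) * (8 * R ^ 2) := by gcongr
      _ = _ := by ring
  have e4 : 8 * q * (θ' * (F - 2) - μ ^ 2 * r₀) ≤ 16 * lam * X + lam * R ^ 2 * X := by
    have h1 : 8 * q * (θ' * (F - 2)) ≤ 16 * lam * X := by
      calc 8 * q * (θ' * (F - 2)) ≤ |8 * q * (θ' * (F - 2))| := le_abs_self _
        _ = 8 * (q * |θ'|) * |F - 2| := by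
          rw [abs_mul, abs_mul θ', abs_of_nonneg (by positivity : 0 ≤ 8 * q)]; ring
        _ ≤ 8 * (lam * X) * 2 := by
          gcongr
          rw [abs_le]; constructor <;> linarith
        _ = _ := by ring
    have h2 : 0 ≤ 8 * q * (μ ^ 2 * r₀) := by positivity
    have h3 : 0 ≤ lam * R ^ 2 * X := by positivity
    linarith
  have e5 : q * (4 * (4 * lam ^ 2 * s - 2 * n * lam) -
        ((4 * lam ^ 2 * s - 2 * n * lam) * (2 * n - 4 * lam * s) +
        32 * lam ^ 2 * s - 8 * n * lam)) ≤ lam * |M| * X := by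
    have h1 := (le_abs_self _).trans ((hM s ⟨hs0, hsS⟩).trans (le_abs_self M))
    calc _ ≤ q * |M| := mul_le_mul_of_nonneg_left h1 hq0
      _ ≤ lam * X * |M| := by
        refine mul_le_mul_of_nonneg_right (hq1.trans ?_) (abs_nonneg _)
        exact mul_le_mul_of_nonneg_left hθ1 hlam.le
      _ = _ := by ring
  have e6 : -(8 * θ * θ' * lam ^ 2 * F ^ 2 * s) ≤ 8 * lam ^ 2 * |S| * X := by
    calc -(8 * θ * θ' * lam ^ 2 * F ^ 2 * s) ≤ |8 * θ * θ' * lam ^ 2 * F ^ 2 * s| := neg_le_abs _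
      _ = 8 * lam ^ 2 * (θ * |θ'|) * (F * (F * s)) := by
        simp only [abs_mul, abs_of_pos hθ0, abs_of_nonneg hs0, abs_pow, abs_of_pos hlam,
          abs_of_nonneg hF0, abs_of_nonneg (by norm_num : (0:ℝ) ≤ 8)]
        ring
      _ ≤ 8 * lam ^ 2 * X * (1 * |S|) := by gcongr
      _ = _ := by ring
  have e7 : -(θ'' * (F - 2)) ≤ 4 * X := by
    calc -(θ'' * (F - 2)) ≤ |θ'' * (F - 2)| := neg_le_abs _
      _ = |θ''| * |F - 2| := abs_mul _ _
      _ ≤ 2 * X * 2 := by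
          gcongr
          rw [abs_le]; constructor <;> linarith
      _ = _ := by ring
  linarith

theorem carleman_main_le {lam θ F F₀ s : ℝ} (hlam : 0 < lam) (hθ : 0 ≤ θ) (hF0 : 0 ≤ F₀)
    (hF : F₀ ≤ F) (hF1 : F ≤ 1) (hs : 0 ≤ s) :
    64 * (lam * θ * F) ^ 3 * s * (1 - lam * s) ≤
      -(128 * lam ^ 2 * F₀ ^ 3) * θ ^ 3 +
        if lam * s < 2 then (256 * lam ^ 2) * θ ^ 3 else 0 := by
  have hFn : 0 ≤ F := hF0.trans hF
  have h3 : F₀ ^ 3 ≤ F ^ 3 := pow_le_pow_left₀ hF0 hF 3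
  have h4 : F ^ 3 ≤ 1 := pow_le_one₀ hFn hF1
  have hX : 0 ≤ lam ^ 2 * θ ^ 3 := by positivity
  split_ifs with h
  · have h1 : 64 * (lam * θ * F) ^ 3 * s * (1 - lam * s) ≤ 128 * (lam ^ 2 * θ ^ 3) := by
      calc 64 * (lam * θ * F) ^ 3 * s * (1 - lam * s)
          ≤ 64 * (lam * θ * F) ^ 3 * s * 1 :=
            mul_le_mul_of_nonneg_left (by nlinarith) (by positivity)
        _ = 64 * (lam ^ 2 * θ ^ 3) * (lam * s) * F ^ 3 := by ring
        _ ≤ 64 * (lam ^ 2 * θ ^ 3) * 2 * 1 := by gcongr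
        _ = _ := by ring
    have h2 : F₀ ^ 3 * (lam ^ 2 * θ ^ 3) ≤ 1 * (lam ^ 2 * θ ^ 3) :=
      mul_le_mul_of_nonneg_right (h3.trans h4) hX
    linarith
  · push Not at h
    have h1 : 64 * (lam * θ * F) ^ 3 * s * (1 - lam * s) ≤ -(128 * (lam ^ 2 * θ ^ 3) * F ^ 3) := by
      have h5 : 2 ≤ lam * s * (lam * s - 1) := by nlinarith
      have h6 : 0 ≤ 64 * (lam ^ 2 * θ ^ 3) * F ^ 3 := by positivity
      have := mul_le_mul_of_nonneg_left h5 h6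
      have e : 64 * (lam * θ * F) ^ 3 * s * (1 - lam * s) =
        -(64 * (lam ^ 2 * θ ^ 3) * F ^ 3 * (lam * s * (lam * s - 1))) := by ring
      rw [e]; linarith
    have := mul_le_mul_of_nonneg_left h3 hX
    linarith

end RoughWeight

section Energy

variable {n : ℕ} {R μ b t : ℝ} {Y P Z : ℝ → EuclideanSpace ℝ (Fin n) → ℝ}
  {m : EuclideanSpace ℝ (Fin n) → ℝ}

theorem NiceSol.hasDerivAt_energy (h : NiceSol R μ b Y P Z) {U : Set (EuclideanSpace ℝ (Fin n))}
    (hU : IsOpen U) (hb : Bornology.IsBounded U) (hm : Continuous m) (t : ℝ) :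
    HasDerivAt (fun s => ∫ x in U, m x * Y s x ^ 2) (∫ x in U, m x * (2 * Y t x * P t x)) t := by
  have cY := h.cY
  have cP := h.cP
  refine hasDerivAt_integral_of_continuousOn hU hb isOpen_univ
    (F := fun s x => m x * Y s x ^ 2) (F' := fun s x => m x * (2 * Y s x * P s x)) (fun s _ => ?_)
    (Continuous.continuousOn ?_) (fun s _ x => ?_) (mem_univ t)
  · have := continuous_of_uncurry cY s
    fun_prop
  · fun_prop
  · exact (((h.dY s x).pow 2).const_mul (m x)).congr_deriv (by ring)

theorem NiceSol.continuous_energy (h : NiceSol R μ b Y P Z) {U : Set (EuclideanSpace ℝ (Fin n))}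
    (hU : IsOpen U) (hb : Bornology.IsBounded U) (hm : Continuous m) :
    Continuous (fun s => ∫ x in U, m x * Y s x ^ 2) :=
  continuous_iff_continuousAt.2 fun t => (h.hasDerivAt_energy hU hb hm t).continuousAt

theorem NiceSol.energy_identity (h : NiceSol R μ b Y P Z) (ht : t ∈ Icc 0 b)
    (hm : ContDiff ℝ 2 m) :
    ∫ x in ball 0 R, m x * (2 * Y t x * P t x) =
      (∫ x in ball 0 R, (lapl m x - 2 * μ ^ 2 * sqd 0 x * m x) * Y t x ^ 2) -
        2 * ∫ x in ball 0 R, m x * gr (Y t) (Y t) x := by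
  have hU : IsOpen (ball (0 : EuclideanSpace ℝ (Fin n)) R) := isOpen_ball
  have hb : Bornology.IsBounded (ball (0 : EuclideanSpace ℝ (Fin n)) R) := isBounded_ball
  have hY := h.h10Y ht
  have hz := (hY.mul_lapl hU hb hm).const_mul 2
  have c1 := continuous_lapl hm
  have c2 := hm.continuous
  have c3 : Continuous (sqd (0 : EuclideanSpace ℝ (Fin n))) := (contDiff_sqd 0 (k := 0)).continuous
  have i1 : IntegrableOn (fun x => (lapl m x - 2 * μ ^ 2 * sqd 0 x * m x) * Y t x ^ 2)
      (ball 0 R) :=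
    integrableOn_bdd_mul hU hb (by fun_prop) (hY.integrableOn_sq hU hb)
  have i2 : IntegrableOn (fun x => m x * gr (Y t) (Y t) x) (ball 0 R) :=
    integrableOn_bdd_mul hU hb c2 (hY.integrableOn_gr hY)
  rw [← integral_const_mul, ← integral_sub i1 (i2.const_mul 2)]
  refine Eq.trans ?_ (hz.integral_add_eq (i1.sub (i2.const_mul 2)))
  refine setIntegral_congr_fun hU.measurableSet fun x hx => ?_
  simp only [h.eY t ht x hx]
  ring

theorem NiceSol.energy_antitone (h : NiceSol R μ b Y P Z) :
    AntitoneOn (fun s => ∫ x in ball 0 R, Y s x ^ 2) (Icc 0 b) := by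
  have hd : ∀ t, HasDerivAt (fun s => ∫ x in ball 0 R, Y s x ^ 2)
      (∫ x in ball 0 R, 1 * (2 * Y t x * P t x)) t := fun t => by
    simpa using h.hasDerivAt_energy isOpen_ball isBounded_ball
      (m := fun _ => (1:ℝ)) continuous_const t
  refine antitoneOn_of_deriv_nonpos (convex_Icc 0 b)
    (fun t _ => (hd t).continuousAt.continuousWithinAt)
    (fun t _ => (hd t).differentiableAt.differentiableWithinAt) fun t ht => ?_
  rw [interior_Icc] at ht
  rw [(hd t).deriv, h.energy_identity (Ioo_subset_Icc_self ht) contDiff_const]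
  have h1 : ∫ x in ball 0 R, (lapl (fun _ => (1:ℝ)) x - 2 * μ ^ 2 * sqd 0 x * 1) * Y t x ^ 2 ≤ 0 :=
    integral_nonpos fun x => by
      simp only [lapl_const, Pi.zero_apply]
      have := sqd_nonneg 0 x
      have : 0 ≤ 2 * μ ^ 2 * sqd 0 x * 1 * Y t x ^ 2 := by positivity
      linarith
  have h2 : 0 ≤ ∫ x in ball 0 R, 1 * gr (Y t) (Y t) x :=
    integral_nonneg fun x => by simpa using gr_self_nonneg _ x
  linarith

theorem le_of_hasDerivAt_of_tendsto {G G' : ℝ → ℝ} {b c A B : ℝ} (hb : 0 < b)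
    (hd : ∀ t ∈ Ioo 0 b, HasDerivAt G (G' t) t) (h0 : ∀ t ∈ Ioo 0 b, G' t ≤ 0)
    (h1 : ∀ t ∈ Icc (b / 4) (3 * b / 4), G' t ≤ -c)
    (lA : Tendsto G (nhdsWithin 0 (Ioi 0)) (nhds A))
    (lB : Tendsto G (nhdsWithin b (Iio b)) (nhds B)) : B ≤ A - c * b / 2 := by
  have hanti : AntitoneOn G (Ioo 0 b) := by
    refine antitoneOn_of_deriv_nonpos (convex_Ioo 0 b)
      (fun t ht => (hd t ht).continuousAt.continuousWithinAt)
      (fun t ht => (hd t (interior_subset ht)).differentiableAt.differentiableWithinAt)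
      fun t ht => ?_
    rw [(hd t (interior_subset ht)).deriv]
    exact h0 t (interior_subset ht)
  have hsub : Icc (b / 4) (3 * b / 4) ⊆ Ioo 0 b := fun t ht =>
    ⟨by linarith [ht.1], by linarith [ht.2]⟩
  have hmid : G (3 * b / 4) + c * (3 * b / 4) ≤ G (b / 4) + c * (b / 4) := by
    have hd' : ∀ t ∈ Icc (b / 4) (3 * b / 4), HasDerivAt (fun t => G t + c * t) (G' t + c * 1) t :=
      fun t ht => (hd t (hsub ht)).add ((hasDerivAt_id t).const_mul c)
    refine antitoneOn_of_deriv_nonpos (f := fun t => G t + c * t) (convex_Icc (b / 4) (3 * b / 4))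
      (fun t ht => (hd' t ht).continuousAt.continuousWithinAt)
      (fun t ht => (hd' t (interior_subset ht)).differentiableAt.differentiableWithinAt)
      (fun t ht => ?_) ⟨le_rfl, by linarith⟩ ⟨by linarith, le_rfl⟩ (by linarith)
    rw [(hd' t (interior_subset ht)).deriv]
    linarith [h1 t (interior_subset ht)]
  have hA : G (b / 4) ≤ A := by
    refine ge_of_tendsto lA ?_
    filter_upwards [Ioo_mem_nhdsGT (show (0:ℝ) < b / 4 by linarith)] with t ht
    exact hanti ⟨ht.1, by linarith [ht.2]⟩ ⟨by linarith, by linarith⟩ ht.2.le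
  have hB : B ≤ G (3 * b / 4) := by
    refine le_of_tendsto lB ?_
    filter_upwards [Ioo_mem_nhdsLT (show 3 * b / 4 < b by linarith)] with t ht
    exact hanti ⟨by linarith, by linarith⟩ ⟨by linarith [ht.1], ht.2⟩ ht.1.le
  linarith

end Energy

section RoughTime

variable {b K t : ℝ}

theorem hasDerivAt_blowup (ht : t ∈ Ioo 0 b) :
    HasDerivAt (fun t => K / (t * (b - t))) (-K * (b - 2 * t) / (t * (b - t)) ^ 2) t := by
  have h1 : t * (b - t) ≠ 0 := (mul_pos ht.1 (by linarith [ht.2])).ne'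
  have h2 : HasDerivAt (fun t => t * (b - t)) (1 * (b - t) + t * (0 - 1)) t :=
    (hasDerivAt_id t).mul ((hasDerivAt_const t b).sub (hasDerivAt_id t))
  exact ((hasDerivAt_const t K).div h2 h1).congr_deriv (by ring)

theorem hasDerivAt_blowup_deriv (ht : t ∈ Ioo 0 b) :
    HasDerivAt (fun t => -K * (b - 2 * t) / (t * (b - t)) ^ 2)
      (K * (2 * (b - 2 * t) ^ 2 + 2 * (t * (b - t))) / (t * (b - t)) ^ 3) t := by
  have h1 : t * (b - t) ≠ 0 := (mul_pos ht.1 (by linarith [ht.2])).ne'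
  have h2 : HasDerivAt (fun t => t * (b - t)) (1 * (b - t) + t * (0 - 1)) t :=
    (hasDerivAt_id t).mul ((hasDerivAt_const t b).sub (hasDerivAt_id t))
  have h3 : HasDerivAt (fun t => -K * (b - 2 * t)) (-K * (0 - 2 * 1)) t :=
    ((hasDerivAt_const t b).sub ((hasDerivAt_id t).const_mul 2)).const_mul (-K)
  refine (h3.div (h2.pow 2) (pow_ne_zero 2 h1)).congr_deriv ?_
  simp only [Nat.cast_ofNat, Nat.add_one_sub_one, Pi.pow_apply, pow_one]
  set u := t * (b - t) with hu
  field_simp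
  rw [hu]
  ring

theorem abs_blowup_deriv_le {κ : ℝ} (hκ : 0 < κ) (hK : κ * b ≤ K) (ht : t ∈ Ioo 0 b) :
    |-K * (b - 2 * t) / (t * (b - t)) ^ 2| ≤ (K / (t * (b - t))) ^ 2 / κ := by
  have hu : 0 < t * (b - t) := mul_pos ht.1 (by linarith [ht.2])
  have hb : 0 < b := ht.1.trans ht.2
  have hK0 : 0 < K := lt_of_lt_of_le (by positivity) hK
  have h1 : |b - 2 * t| ≤ b := abs_le.2 ⟨by linarith [ht.2], by linarith [ht.1]⟩
  rw [abs_div, abs_mul, abs_neg, abs_of_pos hK0, abs_of_pos (pow_pos hu 2), div_pow, div_div,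
    mul_comm (_ ^ 2) κ, ← div_div]
  refine div_le_div_of_nonneg_right ?_ (by positivity)
  rw [le_div_iff₀ hκ]
  have := mul_le_mul_of_nonneg_left h1 hK0.le
  nlinarith

theorem abs_blowup_deriv_deriv_le {κ : ℝ} (hκ : 0 < κ) (hK : κ * b ≤ K) (ht : t ∈ Ioo 0 b) :
    |K * (2 * (b - 2 * t) ^ 2 + 2 * (t * (b - t))) / (t * (b - t)) ^ 3| ≤
      2 * (K / (t * (b - t))) ^ 3 / κ ^ 2 := by
  have hu : 0 < t * (b - t) := mul_pos ht.1 (by linarith [ht.2])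
  have hb : 0 < b := ht.1.trans ht.2
  have hK0 : 0 < K := lt_of_lt_of_le (by positivity) hK
  have h1 : 2 * (b - 2 * t) ^ 2 + 2 * (t * (b - t)) ≤ 2 * b ^ 2 := by nlinarith
  have h2 : (κ * b) ^ 2 ≤ K ^ 2 := pow_le_pow_left₀ (by positivity) hK 2
  rw [abs_of_nonneg (by positivity), div_pow, mul_div_assoc', div_div, mul_comm _ (κ ^ 2), ← div_div]
  refine div_le_div_of_nonneg_right ?_ (by positivity)
  rw [le_div_iff₀ (by positivity)]
  calc _ ≤ K * (2 * b ^ 2) * κ ^ 2 := by gcongr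
    _ = 2 * K * (κ * b) ^ 2 := by ring
    _ ≤ 2 * K * K ^ 2 := by gcongr
    _ = _ := by ring

end RoughTime

section RoughRate

variable {n : ℕ} {R lam : ℝ} {a : EuclideanSpace ℝ (Fin n)}

theorem gr_gw_add_const (h : EuclideanSpace ℝ (Fin n) → ℝ) (x : EuclideanSpace ℝ (Fin n)) (c : ℝ) :
    gr (fun z => gw a lam 1 z + c) h x = -lam * gw a lam 1 x * gr (sqd a) h x := by
  have h1 : ContDiff ℝ 1 (gw a lam 1) := contDiff_gw
  rw [gr_comm, gr_add_right (h1.differentiable (by simp) x) (differentiableAt_const c),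
    gr_const_right, gr_comm, gr_gw, add_zero]

/-- Explicit form of the potential for the weight `e^{-λ|x-a|²} - 2`. -/
theorem ppot_gw (μ θ θ' : ℝ) (x : EuclideanSpace ℝ (Fin n)) :
    ppot μ (fun z => gw a lam 1 z + -2) θ θ' x =
      4 * (lam * θ * gw a lam 1 x) ^ 2 * sqd a x + θ' * (gw a lam 1 x - 2) - μ ^ 2 * sqd 0 x := by
  rw [ppot, gr_gw_add_const, gr_comm,
    gr_gw_add_const, gr_sqd_sqd]
  ring

theorem gr_sqd_ppot_gw (μ θ θ' : ℝ) (x : EuclideanSpace ℝ (Fin n)) :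
    gr (sqd a) (ppot μ (fun z => gw a lam 1 z + -2) θ θ') x =
      16 * (lam * θ * gw a lam 1 x) ^ 2 * sqd a x -
      32 * lam * (lam * θ * gw a lam 1 x) ^ 2 * sqd a x ^ 2 -
      4 * lam * θ' * gw a lam 1 x * sqd a x - μ ^ 2 * gr (sqd a) (sqd 0) x := by
  have h1 : ContDiff ℝ 1 (gw a lam 1) := contDiff_gw
  have h2 : ContDiff ℝ 1 (sqd a) := contDiff_sqd a
  have h3 : ContDiff ℝ 1 (sqd (0 : EuclideanSpace ℝ (Fin n))) := contDiff_sqd 0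
  have d1 := h1.differentiable (by simp) x
  have d2 := h2.differentiable (by simp) x
  have d3 := h3.differentiable (by simp) x
  have e : ppot μ (fun z => gw a lam 1 z + -2) θ θ' = fun x =>
      ((4 * (lam * θ) ^ 2) * ((gw a lam 1 x * gw a lam 1 x) * sqd a x) +
      θ' * (gw a lam 1 x + -2)) + (-μ ^ 2) * sqd 0 x := by
    funext x
    rw [ppot_gw]
    ring
  rw [e, gr_add_right (by fun_prop) (by fun_prop), gr_add_right (by fun_prop) (by fun_prop),
    gr_const_mul_right, gr_const_mul_right, gr_const_mul_right, gr_mul_right (by fun_prop) d2,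
    gr_mul_right d1 d1, gr_sqd_sqd, gr_comm (sqd a) (fun z => gw a lam 1 z + -2),
    gr_gw_add_const, gr_comm (sqd a) (gw a lam 1), gr_gw, gr_sqd_sqd]
  ring

theorem abs_gr_sqd_le (ha : a ∈ ball (0 : EuclideanSpace ℝ (Fin n)) R)
    {x : EuclideanSpace ℝ (Fin n)} (hx : x ∈ ball (0 : EuclideanSpace ℝ (Fin n)) R) :
    |gr (sqd a) (sqd 0) x| ≤ 8 * R ^ 2 := by
  rw [mem_ball_zero_iff] at ha hx
  have h1 := gr_sq_le (sqd a) (sqd 0) x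
  rw [gr_sqd_sqd, gr_sqd_sqd] at h1
  have h2 : sqd a x ≤ (2 * R) ^ 2 :=
    pow_le_pow_left₀ (norm_nonneg _) ((norm_sub_le x a).trans (by linarith)) 2
  have h3 : sqd 0 x ≤ R ^ 2 := by
    unfold sqd
    rw [sub_zero]
    exact pow_le_pow_left₀ (norm_nonneg _) hx.le 2
  refine abs_le_of_sq_le_sq (h1.trans ?_) (by positivity)
  calc 4 * sqd a x * (4 * sqd 0 x) ≤ 4 * (2 * R) ^ 2 * (4 * R ^ 2) := by
        have := sqd_nonneg a x
        have := sqd_nonneg 0 x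
        gcongr
    _ = (8 * R ^ 2) ^ 2 := by ring

theorem pow_mul_exp_neg_le_one {θ : ℝ} (hθ : 0 ≤ θ) : θ ^ 3 * Real.exp (-2 * θ) ≤ 1 := by
  have h1 := Real.pow_div_factorial_le_exp (2 * θ) (by positivity) 3
  have h2 : ((3).factorial : ℝ) = 6 := by norm_num [Nat.factorial]
  have h3 : θ ^ 3 ≤ Real.exp (2 * θ) := by
    rw [h2] at h1
    nlinarith [pow_nonneg hθ 3]
  calc _ ≤ Real.exp (2 * θ) * Real.exp (-2 * θ) := by gcongr
    _ = 1 := by rw [← Real.exp_add]; simp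

set_option maxHeartbeats 1000000 in
/-- Decay of the weighted energy along the flow, up to the observed part. -/
theorem exists_carleman_rate (ha : a ∈ ball (0 : EuclideanSpace ℝ (Fin n)) R) (hlam : 0 < lam)
    {A : Set (EuclideanSpace ℝ (Fin n))} (hA : MeasurableSet A) (hAB : A ⊆ ball 0 R)
    (hsub : ∀ x ∈ ball (0 : EuclideanSpace ℝ (Fin n)) R, lam * sqd a x < 2 → x ∈ A) :
    ∃ κ c C : ℝ, 1 ≤ κ ∧ 0 < c ∧ 0 < C ∧ ∀ (μ b : ℝ)
      (Y P Z : ℝ → EuclideanSpace ℝ (Fin n) → ℝ) (θ θ' θ'' : ℝ → ℝ) (t : ℝ), 0 ≤ μ →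
      NiceSol R μ b Y P Z → t ∈ Ioo 0 b → (∀ t ∈ Ioo 0 b, HasDerivAt θ (θ' t) t) →
      (∀ t ∈ Ioo 0 b, HasDerivAt θ' (θ'' t) t) → ContinuousOn θ'' (Ioo 0 b) →
      4 * κ ≤ θ t → μ ≤ θ t / (4 * κ) → |θ' t| ≤ θ t ^ 2 / κ → |θ'' t| ≤ 2 * θ t ^ 3 / κ ^ 2 →
      ∃ D : ℝ, HasDerivAt (fun s => ∫ x in ball 0 R,
        qdens (fun _ => 1) (fun z => gw a lam 1 z + -2) (Y s) (P s) (θ s) (θ' s) x) D t ∧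
        D ≤ -(c * Real.exp (-4 * θ t)) * (∫ x in ball 0 R, Y t x ^ 2) +
          C * ∫ x in A, Y t x ^ 2 := by
  obtain ⟨Ce, hCe, herr⟩ := exists_carleman_error_bound n (R := R) (S := (2 * R) ^ 2) hlam
  set F₀ := Real.exp (-lam * (2 * R) ^ 2) with hF₀
  set C1 := 128 * lam ^ 2 * F₀ ^ 3 with hC1
  have hC1p : 0 < C1 := by positivity
  refine ⟨max 1 (2 * Ce / C1), C1 / 2, 256 * lam ^ 2, le_max_left _ _, by positivity,
    by positivity, ?_⟩
  set κ := max 1 (2 * Ce / C1) with hκ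
  have hκ1 : 1 ≤ κ := le_max_left _ _
  have hκC : Ce / κ ≤ C1 / 2 := by
    rw [div_le_div_iff₀ (by linarith) (by norm_num)]
    have := (div_le_iff₀ hC1p).1 (le_max_right 1 (2 * Ce / C1))
    linarith
  intro μ b Y P Z θ θ' θ'' t hμ h ht hθ hθ' hθ'' hθκ hμθ hb1 hb2
  have hU : IsOpen (ball (0 : EuclideanSpace ℝ (Fin n)) R) := isOpen_ball
  have hbd : Bornology.IsBounded (ball (0 : EuclideanSpace ℝ (Fin n)) R) := isBounded_ball
  have hg : ContDiff ℝ 2 (fun z => gw a lam 1 z + -2) := contDiff_gw.add contDiff_const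
  have hY := h.h10Y (Ioo_subset_Icc_self ht)
  set η := wt (fun _ => (1:ℝ)) (fun z => gw a lam 1 z + -2) (θ t) with hη
  have hηc : ContDiff ℝ 2 η := contDiff_wt contDiff_const hg _
  set f : EuclideanSpace ℝ (Fin n) → ℝ := fun z => η z * Y t z with hf
  have hfH : H10 (ball 0 R) f := hY.mul hU hbd hηc
  have hD := h.hasDerivAt_integral_qdens isOpen_Ioo Ioo_subset_Icc_self
    (χ := fun _ => (1:ℝ)) contDiff_const hg hθ hθ' hθ'' ht hf
  refine ⟨_, hD, ?_⟩
  have hθ1 : 1 ≤ θ t := by linarith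
  have hs2 : ContDiff ℝ 2 (sqd a) := contDiff_sqd a
  have hs0 : ContDiff ℝ 2 (sqd (0 : EuclideanSpace ℝ (Fin n))) := contDiff_sqd 0
  have hw2 : ContDiff ℝ 2 (gw a lam 1) := contDiff_gw
  set p := ppot μ (fun z => gw a lam 1 z + -2) (θ t) (θ' t) with hp
  have hpC : ContDiff ℝ 2 p := by
    have : p = fun x => 4 * (lam * θ t * gw a lam 1 x) ^ 2 * sqd a x +
        θ' t * (gw a lam 1 x - 2) - μ ^ 2 * sqd 0 x := funext fun x => ppot_gw μ (θ t) (θ' t) x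
    rw [this]
    fun_prop
  obtain ⟨iS, hS⟩ := hfH.static_le ha hlam.le (c := lam * θ t) (by positivity) hpC
  set W' : EuclideanSpace ℝ (Fin n) → ℝ := fun x =>
    8 * θ t * θ' t * lam ^ 2 * gw a lam 1 x ^ 2 * sqd a x + θ'' t * (gw a lam 1 x - 2) with hW'
  have c1 := hs2.continuous
  have c2 := hw2.continuous
  have c4 := hpC.continuous
  have c5 : Continuous (gr (sqd a) p) := continuous_gr (contDiff_sqd a) (hpC.of_le (by norm_num))
  have c6 : Continuous (gw a lam (lam * θ t)) := (contDiff_gw (k := 0)).continuous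
  have iW' : IntegrableOn (fun x => W' x * f x ^ 2) (ball 0 R) :=
    integrableOn_bdd_mul hU hbd (by simp only [hW']; fun_prop) (hfH.integrableOn_sq hU hbd)
  set k : EuclideanSpace ℝ (Fin n) → ℝ := fun x =>
    8 * gw a lam (lam * θ t) x ^ 2 + 2 * gw a lam (lam * θ t) x * gr (sqd a) p x +
        8 * gw a lam (lam * θ t) x * p x +
        gw a lam (lam * θ t) x * (4 * (4 * lam ^ 2 * sqd a x - 2 * n * lam) -
        ((4 * lam ^ 2 * sqd a x - 2 * n * lam) * (2 * n - 4 * lam * sqd a x) +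
        32 * lam ^ 2 * sqd a x - 8 * n * lam)) with hk
  have ik : IntegrableOn (fun x => k x * f x ^ 2) (ball 0 R) :=
    integrableOn_bdd_mul hU hbd (by simp only [hk]; fun_prop) (hfH.integrableOn_sq hU hbd)
  have hgw : ∀ x, gw a lam (lam * θ t) x = lam * θ t * gw a lam 1 x := fun x => by
    unfold gw wt; ring
  have iY := hY.integrableOn_sq hU hbd
  have iA : IntegrableOn (A.indicator fun x => 256 * lam ^ 2 * Y t x ^ 2) (ball 0 R) :=
    (iY.const_mul _).indicator hA
  have i1 : IntegrableOn (fun x => -(C1 / 2 * Real.exp (-4 * θ t)) * Y t x ^ 2) (ball 0 R) :=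
    iY.const_mul _
  have hpt : ∀ x ∈ ball (0 : EuclideanSpace ℝ (Fin n)) R, k x * f x ^ 2 - W' x * f x ^ 2 ≤
      -(C1 / 2 * Real.exp (-4 * θ t)) * Y t x ^ 2 +
      A.indicator (fun x => 256 * lam ^ 2 * Y t x ^ 2) x := by
    intro x hx
    have hF1 : gw a lam 1 x ≤ 1 := by
      unfold gw wt
      rw [one_mul, Real.exp_le_one_iff]
      have := mul_nonneg hlam.le (sqd_nonneg a x)
      linarith
    have hxn := mem_ball_zero_iff.1 hx
    have han := mem_ball_zero_iff.1 ha
    have hsS : sqd a x ≤ (2 * R) ^ 2 :=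
      pow_le_pow_left₀ (norm_nonneg _) ((norm_sub_le x a).trans (by linarith)) 2
    have h0R : sqd 0 x ≤ R ^ 2 := by
      unfold sqd
      rw [sub_zero]
      exact pow_le_pow_left₀ (norm_nonneg _) hxn.le 2
    have hF0 : F₀ ≤ gw a lam 1 x := by
      unfold gw wt
      rw [one_mul, hF₀, Real.exp_le_exp]
      have := mul_le_mul_of_nonneg_left hsS hlam.le
      linarith
    have hF0p : 0 < F₀ := Real.exp_pos _
    have hE := herr κ μ (θ t) (θ' t) (θ'' t) (gw a lam 1 x) (sqd a x) (sqd 0 x)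
      (gr (sqd a) (sqd 0) x) hκ1 hμ hθκ hμθ hb1 hb2 (hF0p.le.trans hF0) hF1 (sqd_nonneg a x) hsS
      (sqd_nonneg 0 x) h0R (abs_gr_sqd_le ha hx)
    have hM := carleman_main_le hlam (zero_le_one.trans hθ1) hF0p.le hF0 hF1 (sqd_nonneg a x)
    have hsum : k x - W' x ≤ -(C1 / 2) * θ t ^ 3 +
        if lam * sqd a x < 2 then (256 * lam ^ 2) * θ t ^ 3 else 0 := by
      have h1 : Ce * (θ t ^ 3 / κ) ≤ C1 / 2 * θ t ^ 3 := by
        calc _ = Ce / κ * θ t ^ 3 := by ring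
          _ ≤ _ := by gcongr
      simp only [hk, hW', hgw, hp, gr_sqd_ppot_gw, ppot_gw]
      rw [← hC1] at hM
      linarith
    have hfx : f x ^ 2 = Real.exp (2 * θ t * (gw a lam 1 x - 2)) * Y t x ^ 2 := by
      simp only [hf, hη, wt]
      rw [one_mul, mul_pow, ← Real.exp_nat_mul]
      congr 2
      push_cast
      ring
    have hlo : Real.exp (-4 * θ t) * Y t x ^ 2 ≤ f x ^ 2 := by
      rw [hfx]
      refine mul_le_mul_of_nonneg_right (Real.exp_le_exp.2 ?_) (sq_nonneg _)
      nlinarith [hF0p.le.trans hF0]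
    have hhi : f x ^ 2 ≤ Real.exp (-2 * θ t) * Y t x ^ 2 := by
      rw [hfx]
      refine mul_le_mul_of_nonneg_right (Real.exp_le_exp.2 ?_) (sq_nonneg _)
      nlinarith
    have hfn : 0 ≤ f x ^ 2 := sq_nonneg _
    have h1 : C1 / 2 * Real.exp (-4 * θ t) * Y t x ^ 2 ≤ C1 / 2 * θ t ^ 3 * f x ^ 2 := by
      calc _ = C1 / 2 * 1 * (Real.exp (-4 * θ t) * Y t x ^ 2) := by ring
        _ ≤ _ := by
          gcongr
          exact one_le_pow₀ hθ1
    have h2 : (if lam * sqd a x < 2 then (256 * lam ^ 2) * θ t ^ 3 else 0) * f x ^ 2 ≤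
        A.indicator (fun x => 256 * lam ^ 2 * Y t x ^ 2) x := by
      split_ifs with hc
      · rw [indicator_of_mem (hsub x hx hc)]
        have h3 := pow_mul_exp_neg_le_one (zero_le_one.trans hθ1)
        calc 256 * lam ^ 2 * θ t ^ 3 * f x ^ 2
            ≤ 256 * lam ^ 2 * θ t ^ 3 * (Real.exp (-2 * θ t) * Y t x ^ 2) := by gcongr
          _ = 256 * lam ^ 2 * (θ t ^ 3 * Real.exp (-2 * θ t)) * Y t x ^ 2 := by ring
          _ ≤ 256 * lam ^ 2 * 1 * Y t x ^ 2 := by gcongr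
          _ = _ := by ring
      · rw [zero_mul]
        exact indicator_nonneg (fun x _ => by positivity) x
    have h3 := mul_le_mul_of_nonneg_right hsum hfn
    linarith
  have hAint : ∫ x in ball 0 R, A.indicator (fun x => 256 * lam ^ 2 * Y t x ^ 2) x =
      256 * lam ^ 2 * ∫ x in A, Y t x ^ 2 := by
    rw [setIntegral_indicator hA, inter_eq_self_of_subset_right hAB, integral_const_mul]
  calc _ = ∫ x in ball 0 R, (-2 * (lapl f x + p x * f x) * (lapl f x + p x * f x +
        2 * gw a lam (lam * θ t) x * gr (sqd a) f x +
        gw a lam (lam * θ t) x * (2 * n + -4 * lam * sqd a x) * f x) - W' x * f x ^ 2) := by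
        refine setIntegral_congr_fun hU.measurableSet fun x hx => ?_
        simp only [gr_gw_add_const, gr_const_left,
          gr_comm (sqd a) (fun z => gw a lam 1 z + -2), gr_sqd_sqd, lapl_const,
          lapl_add hw2.contDiffAt contDiffAt_const, lapl_gw, hgw, hW']
        ring
    _ ≤ ∫ x in ball 0 R, (k x * f x ^ 2 - W' x * f x ^ 2) := by
        rw [integral_sub iS iW', integral_sub ik iW']
        linarith
    _ ≤ ∫ x in ball 0 R, (-(C1 / 2 * Real.exp (-4 * θ t)) * Y t x ^ 2 +
          A.indicator (fun x => 256 * lam ^ 2 * Y t x ^ 2) x) :=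
        setIntegral_mono_on (ik.sub iW') (i1.add iA) hU.measurableSet hpt
    _ = _ := by
        rw [integral_add i1 iA, integral_const_mul, hAint]

end RoughRate

section RoughEstimate

variable {n : ℕ} {R R₁ R₂ μ b : ℝ} {Y P Z : ℝ → EuclideanSpace ℝ (Fin n) → ℝ}

/-- The open annulus `R₁ < ‖x‖ < R₂`. -/
def annulus (n : ℕ) (R₁ R₂ : ℝ) : Set (EuclideanSpace ℝ (Fin n)) := {x | R₁ < ‖x‖ ∧ ‖x‖ < R₂}

theorem isOpen_annulus : IsOpen (annulus n R₁ R₂) :=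
  (isOpen_lt continuous_const continuous_norm).inter (isOpen_lt continuous_norm continuous_const)

theorem annulus_subset_ball (h : R₂ ≤ R) : annulus n R₁ R₂ ⊆ ball 0 R := fun _ hx =>
  mem_ball_zero_iff.2 (hx.2.trans_le h)

theorem isBounded_annulus : Bornology.IsBounded (annulus n R₁ R₂) :=
  isBounded_ball.subset (annulus_subset_ball le_rfl)

/-- The energy of `Y` observed in the annulus between the times `0` and `t`. -/
noncomputable def obs (R₁ R₂ : ℝ) (Y : ℝ → EuclideanSpace ℝ (Fin n) → ℝ) (t : ℝ) : ℝ :=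
  ∫ s in (0:ℝ)..t, ∫ x in annulus n R₁ R₂, Y s x ^ 2

theorem NiceSol.continuous_obs_density (h : NiceSol R μ b Y P Z) :
    Continuous fun s => ∫ x in annulus n R₁ R₂, Y s x ^ 2 := by
  simpa using h.continuous_energy isOpen_annulus isBounded_annulus
    (m := fun _ => (1:ℝ)) continuous_const

theorem NiceSol.hasDerivAt_obs (h : NiceSol R μ b Y P Z) (t : ℝ) :
    HasDerivAt (obs R₁ R₂ Y) (∫ x in annulus n R₁ R₂, Y t x ^ 2) t :=
  (h.continuous_obs_density.integral_hasStrictDerivAt 0 t).hasDerivAt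

theorem obs_nonneg {t : ℝ} (ht : 0 ≤ t) : 0 ≤ obs R₁ R₂ Y t :=
  intervalIntegral.integral_nonneg ht fun _ _ => integral_nonneg fun _ => sq_nonneg _

theorem NiceSol.exists_abs_integral_qdens_le (h : NiceSol R μ b Y P Z)
    {g : EuclideanSpace ℝ (Fin n) → ℝ} (hg2 : ∀ x, -2 ≤ g x) (hg1 : ∀ x, g x ≤ -1) :
    ∃ M : ℝ, 0 ≤ M ∧ ∀ t ∈ Icc 0 b, ∀ θ θ' : ℝ, 1 ≤ θ → |θ'| ≤ θ ^ 2 →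
      |∫ x in ball 0 R, qdens (fun _ => 1) g (Y t) (P t) θ θ' x| ≤ M / θ := by
  have hK : IsCompact (Icc 0 b ×ˢ closedBall (0 : EuclideanSpace ℝ (Fin n)) R) :=
    isCompact_Icc.prod (isCompact_closedBall _ _)
  obtain ⟨M₁, hM₁⟩ := hK.exists_bound_of_continuousOn h.cY.continuousOn
  obtain ⟨M₂, hM₂⟩ := hK.exists_bound_of_continuousOn h.cP.continuousOn
  set v := volume.real (ball (0 : EuclideanSpace ℝ (Fin n)) R)
  refine ⟨(|M₁| * |M₂| + 2 * |M₁| ^ 2) * v, by positivity, fun t ht θ θ' hθ hθ' => ?_⟩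
  have hθ0 : 0 < θ := by linarith
  have key : ∀ x ∈ ball (0 : EuclideanSpace ℝ (Fin n)) R,
      ‖qdens (fun _ => 1) g (Y t) (P t) θ θ' x‖ ≤ (|M₁| * |M₂| + 2 * |M₁| ^ 2) / θ := by
    intro x hx
    have h1 : |Y t x| ≤ |M₁| := (hM₁ (t, x) ⟨ht, ball_subset_closedBall hx⟩).trans (le_abs_self _)
    have h2 : |P t x| ≤ |M₂| := (hM₂ (t, x) ⟨ht, ball_subset_closedBall hx⟩).trans (le_abs_self _)
    have hE : Real.exp (θ * g x) ^ 2 ≤ Real.exp (-2 * θ) := by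
      rw [← Real.exp_nat_mul, Real.exp_le_exp]
      push_cast
      nlinarith [hg1 x]
    have hgx : |g x| ≤ 2 := abs_le.2 ⟨hg2 x, by linarith [hg1 x]⟩
    have h3 : |qdens (fun _ => 1) g (Y t) (P t) θ θ' x| ≤
        Real.exp (-2 * θ) * (|M₁| * |M₂| + θ ^ 2 * 2 * |M₁| ^ 2) := by
      rw [qdens, gr_const_left, gr_const_left, abs_mul, abs_of_nonneg (sq_nonneg _)]
      refine mul_le_mul hE ?_ (abs_nonneg _) (Real.exp_pos _).le
      have e : -(1:ℝ) ^ 2 * (Y t x * P t x) +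
          (0 + 2 * θ * 1 * 0 - θ' * g x * 1 ^ 2) * Y t x ^ 2 =
          -(Y t x * P t x) + -(θ' * g x * Y t x ^ 2) := by ring
      rw [e]
      refine (abs_add_le _ _).trans ?_
      rw [abs_neg, abs_neg, abs_mul, abs_mul, abs_mul, abs_pow]
      gcongr
    refine h3.trans ?_
    rw [le_div_iff₀ hθ0]
    have h4 := pow_mul_exp_neg_le_one hθ0.le
    have h5 : θ ≤ θ ^ 3 := le_self_pow₀ hθ (by norm_num)
    have h6 : 0 ≤ |M₁| * |M₂| := by positivity
    have hE0 := Real.exp_pos (-2 * θ)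
    calc _ = (|M₁| * |M₂|) * (θ * Real.exp (-2 * θ)) +
          2 * |M₁| ^ 2 * (θ ^ 3 * Real.exp (-2 * θ)) := by ring
      _ ≤ (|M₁| * |M₂|) * 1 + 2 * |M₁| ^ 2 * 1 := by
        have : θ * Real.exp (-2 * θ) ≤ 1 := le_trans (by gcongr) h4
        gcongr
      _ = _ := by ring
  have := norm_setIntegral_le_of_norm_le_const
    (measure_ball_lt_top (μ := volume) (x := (0 : EuclideanSpace ℝ (Fin n))) (r := R)) key
  rw [Real.norm_eq_abs] at this
  refine this.trans_eq ?_
  ring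

theorem exists_rough_estimate (hn : 0 < n) (hR₁ : 0 < R₁) (h₁₂ : R₁ < R₂) (h₂R : R₂ ≤ R) :
    ∃ C : ℝ, 0 < C ∧ ∀ (μ b : ℝ) (Y P Z : ℝ → EuclideanSpace ℝ (Fin n) → ℝ), 0 ≤ μ →
      b ∈ Ioc 0 1 → NiceSol R μ b Y P Z →
      ∫ x in ball 0 R, Y b x ^ 2 ≤ C * Real.exp (C * (1 / b + μ)) * obs R₁ R₂ Y b := by
  set a : EuclideanSpace ℝ (Fin n) := EuclideanSpace.single ⟨0, hn⟩ ((R₁ + R₂) / 2) with ha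
  have han : ‖a‖ = (R₁ + R₂) / 2 := by
    rw [ha, PiLp.norm_single, Real.norm_eq_abs, abs_of_pos (by linarith)]
  set lam := 8 / (R₂ - R₁) ^ 2 with hlam
  have hd : 0 < R₂ - R₁ := by linarith
  have hlam0 : 0 < lam := by positivity
  have haB : a ∈ ball (0 : EuclideanSpace ℝ (Fin n)) R := by
    rw [mem_ball_zero_iff, han]; linarith
  have hsub : ∀ x ∈ ball (0 : EuclideanSpace ℝ (Fin n)) R, lam * sqd a x < 2 →
      x ∈ annulus n R₁ R₂ := by
    intro x _ hx
    have h1 : ‖x - a‖ ^ 2 < ((R₂ - R₁) / 2) ^ 2 := by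
      rw [hlam, div_mul_eq_mul_div, div_lt_iff₀ (by positivity)] at hx
      unfold sqd at hx
      linarith
    have h2 := lt_of_pow_lt_pow_left₀ 2 (by positivity) h1
    have h3 := norm_sub_norm_le x a
    have h4 := norm_sub_norm_le a x
    rw [norm_sub_rev] at h4
    exact ⟨by linarith, by linarith⟩
  obtain ⟨κ, c, C, hκ, hc, hC, H⟩ := exists_carleman_rate haB hlam0 isOpen_annulus.measurableSet
    (annulus_subset_ball h₂R) hsub
  have hκ0 : 0 < κ := by linarith
  set g : EuclideanSpace ℝ (Fin n) → ℝ := fun z => gw a lam 1 z + -2 with hg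
  have hg2 : ∀ x, -2 ≤ g x := fun x => by
    have := gw_nonneg (a := a) (lam := lam) zero_le_one x
    simp only [hg]; linarith
  have hg1 : ∀ x, g x ≤ -1 := fun x => by
    have : gw a lam 1 x ≤ 1 := by
      unfold gw wt
      rw [one_mul, Real.exp_le_one_iff]
      have := mul_nonneg hlam0.le (sqd_nonneg a x)
      linarith
    simp only [hg]; linarith
  refine ⟨2 * C / c + 64 * κ / 3 + 1, by positivity, fun μ b Y P Z hμ hb h => ?_⟩
  have hb0 := hb.1
  set K := κ * (b + μ * b ^ 2) with hK
  have hK0 : 0 < K := by positivity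
  have hKb : κ * b ≤ K := by
    rw [hK]; gcongr; nlinarith [mul_nonneg hμ (sq_nonneg b)]
  set θ : ℝ → ℝ := fun t => K / (t * (b - t)) with hθ
  set θ' : ℝ → ℝ := fun t => -K * (b - 2 * t) / (t * (b - t)) ^ 2 with hθ'
  set θ'' : ℝ → ℝ := fun t =>
    K * (2 * (b - 2 * t) ^ 2 + 2 * (t * (b - t))) / (t * (b - t)) ^ 3 with hθ''
  have hpos : ∀ t ∈ Ioo 0 b, 0 < t * (b - t) := fun t ht => mul_pos ht.1 (by linarith [ht.2])
  have hθlow : ∀ t ∈ Ioo 0 b, 4 * κ * (1 / b + μ) ≤ θ t := fun t ht => by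
    rw [hθ]
    simp only
    rw [le_div_iff₀ (hpos t ht)]
    have h1 : t * (b - t) ≤ b ^ 2 / 4 := by nlinarith [sq_nonneg (b - 2 * t)]
    calc _ ≤ 4 * κ * (1 / b + μ) * (b ^ 2 / 4) := by gcongr
      _ = K := by rw [hK]; field_simp
  have h1b : 1 ≤ 1 / b := by rw [le_div_iff₀ hb0]; linarith [hb.2]
  have hθ4 : ∀ t ∈ Ioo 0 b, 4 * κ ≤ θ t := fun t ht => by
    refine le_trans ?_ (hθlow t ht)
    exact le_mul_of_one_le_right (by positivity) (by linarith)
  have hcont : ContinuousOn θ'' (Ioo 0 b) := by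
    refine ContinuousOn.div (by fun_prop) (by fun_prop) fun t ht => (pow_pos (hpos t ht) 3).ne'
  have HD := fun t (ht : t ∈ Ioo 0 b) => H μ b Y P Z θ θ' θ'' t hμ h ht
    (fun t ht => hasDerivAt_blowup ht) (fun t ht => hasDerivAt_blowup_deriv ht) hcont (hθ4 t ht)
    (by
      rw [le_div_iff₀ (by positivity)]
      have := hθlow t ht
      have h2 : 0 ≤ 4 * κ * (1 / b) := by positivity
      linarith)
    (abs_blowup_deriv_le hκ0 hKb ht) (abs_blowup_deriv_deriv_le hκ0 hKb ht)
  choose! D hD hDle using HD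
  set Q : ℝ → ℝ := fun s => ∫ x in ball 0 R, qdens (fun _ => 1) g (Y s) (P s) (θ s) (θ' s) x
    with hQ
  obtain ⟨M, hM0, hM⟩ := h.exists_abs_integral_qdens_le hg2 hg1
  have hQle : ∀ t ∈ Ioo 0 b, |Q t| ≤ M / K * (t * (b - t)) := fun t ht => by
    refine (hM t (Ioo_subset_Icc_self ht) (θ t) (θ' t) (by linarith [hθ4 t ht])
      ((abs_blowup_deriv_le hκ0 hKb ht).trans (div_le_self (sq_nonneg _) hκ))).trans_eq ?_
    have := (hpos t ht).ne'
    simp only [hθ]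
    field_simp
  have hlim : ∀ x : ℝ, x * (b - x) = 0 → ∀ s : Set ℝ, Ioo 0 b ∈ nhdsWithin x s →
      Tendsto Q (nhdsWithin x s) (nhds 0) := fun x hx s hs => by
    have h1 : Tendsto (fun t => M / K * (t * (b - t))) (nhdsWithin x s) (nhds 0) := by
      have h2 : Continuous fun t => M / K * (t * (b - t)) := by fun_prop
      have := h2.tendsto x
      rw [hx, mul_zero] at this
      exact this.mono_left nhdsWithin_le_nhds
    refine squeeze_zero_norm' ?_ h1
    filter_upwards [hs] with t ht using hQle t ht
  have cobs : Continuous (obs R₁ R₂ Y) :=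
    continuous_iff_continuousAt.2 fun t => (h.hasDerivAt_obs t).continuousAt
  have hobs0 : obs R₁ R₂ Y 0 = 0 := intervalIntegral.integral_same
  set N := ∫ x in ball 0 R, Y b x ^ 2 with hN
  have hN0 : 0 ≤ N := integral_nonneg fun _ => sq_nonneg _
  set Θ := 16 * κ / 3 * (1 / b + μ) with hΘ
  have hres := le_of_hasDerivAt_of_tendsto (G := fun t => Q t - C * obs R₁ R₂ Y t)
    (G' := fun t => D t - C * ∫ x in annulus n R₁ R₂, Y t x ^ 2) (b := b)
    (c := c * Real.exp (-4 * Θ) * N) (A := 0 - C * obs R₁ R₂ Y 0) (B := 0 - C * obs R₁ R₂ Y b) hb0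
    (fun t ht => (hD t ht).sub ((h.hasDerivAt_obs t).const_mul C))
    (fun t ht => by
      have h1 := hDle t ht
      have h2 : 0 ≤ ∫ x in ball 0 R, Y t x ^ 2 := integral_nonneg fun _ => sq_nonneg _
      have h3 : 0 ≤ c * Real.exp (-4 * θ t) * ∫ x in ball 0 R, Y t x ^ 2 := by positivity
      linarith)
    (fun t ht => by
      have ht' : t ∈ Ioo 0 b := ⟨by linarith [ht.1], by linarith [ht.2]⟩
      have h1 := hDle t ht'
      have h2 : N ≤ ∫ x in ball 0 R, Y t x ^ 2 :=
        h.energy_antitone (Ioo_subset_Icc_self ht') ⟨hb0.le, le_rfl⟩ ht'.2.le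
      have h3 : θ t ≤ Θ := by
        simp only [hθ]
        rw [div_le_iff₀ (hpos t ht')]
        have h4 : 3 * b ^ 2 / 16 ≤ t * (b - t) := by nlinarith [ht.1, ht.2]
        calc K = Θ * (3 * b ^ 2 / 16) := by rw [hK, hΘ]; field_simp
          _ ≤ _ := by gcongr
      have h5 : c * Real.exp (-4 * Θ) * N ≤
          c * Real.exp (-4 * θ t) * ∫ x in ball 0 R, Y t x ^ 2 := by
        have : Real.exp (-4 * Θ) ≤ Real.exp (-4 * θ t) := Real.exp_le_exp.2 (by linarith)
        gcongr
      linarith)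
    ((hlim 0 (by ring) _ (Ioo_mem_nhdsGT hb0)).sub
      (((cobs.const_mul C).tendsto 0).mono_left nhdsWithin_le_nhds))
    ((hlim b (by ring) _ (Ioo_mem_nhdsLT hb0)).sub
      (((cobs.const_mul C).tendsto b).mono_left nhdsWithin_le_nhds))
  rw [hobs0] at hres
  have hO : 0 ≤ obs R₁ R₂ Y b := obs_nonneg hb0.le
  have h1 : N ≤ 2 * C / c * (1 / b) * Real.exp (4 * Θ) * obs R₁ R₂ Y b := by
    have h2 : c * Real.exp (-4 * Θ) * N * b ≤ 2 * C * obs R₁ R₂ Y b := by linarith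
    have h3 : N = (1 / c) * (1 / b) * Real.exp (4 * Θ) * (c * Real.exp (-4 * Θ) * N * b) := by
      have : Real.exp (4 * Θ) * Real.exp (-(4 * Θ)) = 1 := by rw [← Real.exp_add]; simp
      rw [neg_mul]
      field_simp
      linear_combination (-N) * this
    rw [h3]
    calc _ ≤ (1 / c) * (1 / b) * Real.exp (4 * Θ) * (2 * C * obs R₁ R₂ Y b) := by gcongr
      _ = _ := by ring
  refine h1.trans ?_
  have h2 : 1 / b ≤ Real.exp (1 / b + μ) := by
    have := Real.add_one_le_exp (1 / b + μ)
    linarith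
  have h3 : 0 ≤ 2 * C / c := by positivity
  have h4 : 0 ≤ 1 / b + μ := by positivity
  calc _ ≤ 2 * C / c * Real.exp (1 / b + μ) * Real.exp (4 * Θ) * obs R₁ R₂ Y b := by gcongr
    _ = 2 * C / c * Real.exp ((64 * κ / 3 + 1) * (1 / b + μ)) * obs R₁ R₂ Y b := by
      rw [mul_assoc (2 * C / c), ← Real.exp_add, hΘ]
      ring_nf
    _ ≤ _ := by
      gcongr
      · have : 0 ≤ 64 * κ / 3 + 1 := by positivity
        linarith
      · linarith

end RoughEstimate

section Cutoff

variable {n : ℕ} {s w : ℝ} {x : EuclideanSpace ℝ (Fin n)} {f f' f'' : ℝ → ℝ}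

theorem gr_radial_left (hf : ∀ u, HasDerivAt f (f' u) u) (h : EuclideanSpace ℝ (Fin n) → ℝ) :
    gr (fun z => f ((sqd 0 z - s) / w)) h x = f' ((sqd 0 x - s) / w) / w * gr (sqd 0) h x := by
  have hd : ∀ v : ℝ, HasDerivAt (fun v => f ((v - s) / w)) (f' ((v - s) / w) * (1 / w)) v :=
    fun v => (hf ((v - s) / w)).comp v (((hasDerivAt_id v).sub_const s).div_const w)
  rw [gr_comp_left (k := fun v => f ((v - s) / w)) (hd _)
    ((contDiff_sqd 0 (k := 1)).differentiable (by simp) x)]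
  ring

theorem lapl_radial (hf : ∀ u, HasDerivAt f (f' u) u) (hf' : ∀ u, HasDerivAt f' (f'' u) u) :
    lapl (fun z => f ((sqd 0 z - s) / w)) x = f' ((sqd 0 x - s) / w) * (2 * n / w) +
      f'' ((sqd 0 x - s) / w) * (4 * sqd 0 x / w ^ 2) := by
  have hd : ∀ v : ℝ, HasDerivAt (fun v => f ((v - s) / w)) (f' ((v - s) / w) * (1 / w)) v :=
    fun v => (hf ((v - s) / w)).comp v (((hasDerivAt_id v).sub_const s).div_const w)
  have hd' : ∀ v : ℝ, HasDerivAt (fun v => f' ((v - s) / w) * (1 / w))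
      (f'' ((v - s) / w) * (1 / w) * (1 / w)) v :=
    fun v => ((hf' ((v - s) / w)).comp v
      (((hasDerivAt_id v).sub_const s).div_const w)).mul_const (1 / w)
  rw [lapl_comp (k := fun v => f ((v - s) / w)) hd hd' (contDiff_sqd 0).contDiffAt, lapl_sqd,
    gr_sqd_sqd]
  ring

theorem deriv_eq_zero_off_Icc (hf : ∀ u ∉ Icc (0:ℝ) 1, f u = 0) :
    ∀ u ∉ Icc (0:ℝ) 1, deriv f u = 0 := fun u hu => by
  have : f =ᶠ[nhds u] fun _ => 0 := by
    filter_upwards [isClosed_Icc.isOpen_compl.mem_nhds hu] with v hv using hf v hv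
  rw [this.deriv_eq, deriv_const]

theorem exists_bound_of_eq_zero_off_Icc (hc : Continuous f) (hf : ∀ u ∉ Icc (0:ℝ) 1, f u = 0) :
    ∃ M : ℝ, 0 ≤ M ∧ ∀ u, |f u| ≤ M := by
  obtain ⟨M, hM⟩ := (isCompact_Icc (a := (0:ℝ)) (b := 1)).exists_bound_of_continuousOn
    hc.continuousOn
  refine ⟨|M|, abs_nonneg _, fun u => ?_⟩
  by_cases hu : u ∈ Icc (0:ℝ) 1
  · exact (hM u hu).trans (le_abs_self _)
  · rw [hf u hu]; simp

theorem deriv_smoothTransition_off_Icc : ∀ u ∉ Icc (0:ℝ) 1, deriv Real.smoothTransition u = 0 := by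
  intro u hu
  rw [mem_Icc, not_and_or, not_le, not_le] at hu
  rcases hu with hu | hu
  · have : Real.smoothTransition =ᶠ[nhds u] fun _ => 0 := by
      filter_upwards [Iio_mem_nhds hu] with v hv
        using Real.smoothTransition.zero_of_nonpos (le_of_lt hv)
    rw [this.deriv_eq, deriv_const]
  · have : Real.smoothTransition =ᶠ[nhds u] fun _ => 1 := by
      filter_upwards [Ioi_mem_nhds hu] with v hv
        using Real.smoothTransition.one_of_one_le (le_of_lt hv)
    rw [this.deriv_eq, deriv_const]

/-- The smooth radial function equal to `0` on `|x|² ≤ s` and to `1` on `|x|² ≥ s + w`. -/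
noncomputable def cut (s w : ℝ) (x : EuclideanSpace ℝ (Fin n)) : ℝ :=
  Real.smoothTransition ((sqd 0 x - s) / w)

theorem contDiff_cut {k : ℕ∞} : ContDiff ℝ k (cut s w : EuclideanSpace ℝ (Fin n) → ℝ) :=
  Real.smoothTransition.contDiff.comp (((contDiff_sqd 0).sub contDiff_const).div_const w)

theorem contDiff_gr_cut :
    ContDiff ℝ 2 (gr (cut s w) (cut s w) : EuclideanSpace ℝ (Fin n) → ℝ) := by
  have h := contDiff_pd (contDiff_cut (n := n) (s := s) (w := w) (k := 3)) (m := 2)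
    (by norm_num)
  unfold gr
  exact ContDiff.sum fun i _ => (h i).mul (h i)

theorem cut_eq_zero (hw : 0 < w) (hx : sqd 0 x ≤ s) : cut s w x = 0 :=
  Real.smoothTransition.zero_of_nonpos (div_nonpos_of_nonpos_of_nonneg (by linarith) hw.le)

theorem cut_eq_one (hw : 0 < w) (hx : s + w ≤ sqd 0 x) : cut s w x = 1 :=
  Real.smoothTransition.one_of_one_le ((one_le_div hw).2 (by linarith))

theorem exists_cut_bounds (n : ℕ) (R : ℝ) : ∃ C : ℝ, 0 < C ∧ ∀ s w : ℝ, w ∈ Ioc 0 1 →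
    ∀ x ∈ ball (0 : EuclideanSpace ℝ (Fin n)) R,
      (sqd 0 x ∉ Icc s (s + w) → gr (cut s w) (cut s w) x = 0 ∧ lapl (cut s w) x = 0 ∧
        lapl (gr (cut s w) (cut s w)) x = 0) ∧
      gr (cut s w) (cut s w) x ≤ C / w ^ 2 ∧ |lapl (cut s w) x| ≤ C / w ^ 2 ∧
      |lapl (gr (cut s w) (cut s w)) x| ≤ C / w ^ 4 := by
  set φ := Real.smoothTransition
  have hφ : ContDiff ℝ 4 φ := Real.smoothTransition.contDiff (n := 4)
  have hφ1 : ContDiff ℝ 3 (deriv φ) := hφ.iterate_deriv' 3 1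
  have hφ2 : ContDiff ℝ 2 (deriv (deriv φ)) := hφ1.iterate_deriv' 2 1
  set ψ : ℝ → ℝ := fun u => deriv φ u ^ 2 with hψ
  have hψ0 : ContDiff ℝ 3 ψ := hφ1.pow 2
  have hψ1 : ContDiff ℝ 2 (deriv ψ) := hψ0.iterate_deriv' 2 1
  have hψ2 : ContDiff ℝ 1 (deriv (deriv ψ)) := hψ1.iterate_deriv' 1 1
  have zφ1 : ∀ u ∉ Icc (0:ℝ) 1, deriv φ u = 0 := deriv_smoothTransition_off_Icc
  have zφ2 := deriv_eq_zero_off_Icc zφ1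
  have zψ : ∀ u ∉ Icc (0:ℝ) 1, ψ u = 0 := fun u hu => by simp [hψ, zφ1 u hu]
  have zψ1 := deriv_eq_zero_off_Icc zψ
  have zψ2 := deriv_eq_zero_off_Icc zψ1
  obtain ⟨M1, p1, b1⟩ := exists_bound_of_eq_zero_off_Icc hφ1.continuous zφ1
  obtain ⟨M2, p2, b2⟩ := exists_bound_of_eq_zero_off_Icc hφ2.continuous zφ2
  obtain ⟨M3, p3, b3⟩ := exists_bound_of_eq_zero_off_Icc hψ0.continuous zψ
  obtain ⟨M4, p4, b4⟩ := exists_bound_of_eq_zero_off_Icc hψ1.continuous zψ1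
  obtain ⟨M5, p5, b5⟩ := exists_bound_of_eq_zero_off_Icc hψ2.continuous zψ2
  have dφ : ∀ u, HasDerivAt φ (deriv φ u) u :=
    fun u => (hφ.differentiable (by simp) u).hasDerivAt
  have dφ1 : ∀ u, HasDerivAt (deriv φ) (deriv (deriv φ) u) u :=
    fun u => (hφ1.differentiable (by simp) u).hasDerivAt
  have dψ : ∀ u, HasDerivAt ψ (deriv ψ u) u :=
    fun u => (hψ0.differentiable (by simp) u).hasDerivAt
  have dψ1 : ∀ u, HasDerivAt (deriv ψ) (deriv (deriv ψ) u) u :=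
    fun u => (hψ1.differentiable (by simp) u).hasDerivAt
  refine ⟨4 * M3 * R ^ 2 + (M1 * (2 * n) + M2 * (4 * R ^ 2)) +
    4 * (R ^ 2 * (M4 * (2 * n) + M5 * (4 * R ^ 2)) + 8 * M4 * R ^ 2 + M3 * (2 * n)) + 1,
    by positivity, fun s w hw x hx => ?_⟩
  have hw0 := hw.1
  have hw1 := hw.2
  have hxR : sqd 0 x ≤ R ^ 2 := by
    unfold sqd
    rw [sub_zero]
    exact pow_le_pow_left₀ (norm_nonneg _) (mem_ball_zero_iff.1 hx).le 2
  have hx0 := sqd_nonneg 0 x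
  set u := (sqd 0 x - s) / w with hu
  have e1 : ∀ x : EuclideanSpace ℝ (Fin n), gr (cut s w) (cut s w) x =
      4 / w ^ 2 * (sqd 0 x * ψ ((sqd 0 x - s) / w)) := fun x => by
    unfold cut
    rw [gr_radial_left dφ, gr_comm, gr_radial_left dφ, gr_sqd_sqd, hψ]
    field_simp
  have e2 : lapl (cut s w) x = deriv φ u * (2 * n / w) + deriv (deriv φ) u * (4 * sqd 0 x / w ^ 2) :=
    lapl_radial dφ dφ1
  have hψc : ContDiff ℝ 2 (fun z : EuclideanSpace ℝ (Fin n) => ψ ((sqd 0 z - s) / w)) :=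
    (hψ0.of_le (by norm_num)).comp (((contDiff_sqd 0).sub contDiff_const).div_const w)
  have e3 : lapl (gr (cut s w) (cut s w)) x = 4 / w ^ 2 * (sqd 0 x *
      (deriv ψ u * (2 * n / w) + deriv (deriv ψ) u * (4 * sqd 0 x / w ^ 2)) +
      8 * (deriv ψ u / w) * sqd 0 x + ψ u * (2 * n)) := by
    rw [show gr (cut s w) (cut s w) = _ from funext e1, lapl_const_mul,
      lapl_mul (contDiff_sqd 0).contDiffAt hψc.contDiffAt, lapl_radial dψ dψ1, gr_comm,
      gr_radial_left dψ, lapl_sqd, gr_sqd_sqd]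
    ring
  have i1 : 1 / w ≤ 1 / w ^ 2 := one_div_le_one_div_of_le (by positivity) (by nlinarith)
  have i0 : 1 ≤ 1 / w ^ 2 := by rw [le_div_iff₀ (by positivity)]; nlinarith
  have q4 : 0 ≤ 1 / w ^ 2 := by positivity
  refine ⟨fun hxs => ?_, ?_, ?_, ?_⟩
  · have hu' : u ∉ Icc (0:ℝ) 1 := by
      intro h
      refine hxs ⟨?_, ?_⟩
      · by_contra! hc
        have : u < 0 := div_neg_of_neg_of_pos (by linarith) hw0
        linarith [h.1]
      · have := (div_le_one hw0).1 h.2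
        linarith
    rw [e1, e2, e3, zφ1 u hu', zφ2 u hu', zψ u hu', zψ1 u hu', zψ2 u hu']
    simp
  · rw [e1]
    have h1 : ψ u ≤ M3 := (le_abs_self _).trans (b3 u)
    calc 4 / w ^ 2 * (sqd 0 x * ψ u) ≤ 4 / w ^ 2 * (R ^ 2 * M3) := by
          refine mul_le_mul_of_nonneg_left (mul_le_mul hxR h1 (sq_nonneg _) (sq_nonneg _))
            (by positivity)
      _ = (4 * M3 * R ^ 2) / w ^ 2 := by ring
      _ ≤ _ := by
        refine div_le_div_of_nonneg_right ?_ (by positivity)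
        have : 0 ≤ (M1 * (2 * n) + M2 * (4 * R ^ 2)) + 4 * (R ^ 2 * (M4 * (2 * n) +
          M5 * (4 * R ^ 2)) + 8 * M4 * R ^ 2 + M3 * (2 * n)) + 1 := by positivity
        linarith
  · rw [e2]
    calc _ ≤ |deriv φ u * (2 * n / w)| + |deriv (deriv φ) u * (4 * sqd 0 x / w ^ 2)| :=
          abs_add_le _ _
      _ = |deriv φ u| * (2 * n * (1 / w)) + |deriv (deriv φ) u| * (4 * sqd 0 x * (1 / w ^ 2)) := by
        rw [abs_mul, abs_mul, abs_of_nonneg (show 0 ≤ 2 * (n:ℝ) / w by positivity),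
          abs_of_nonneg (show 0 ≤ 4 * sqd 0 x / w ^ 2 by positivity)]
        ring
      _ ≤ M1 * (2 * n * (1 / w ^ 2)) + M2 * (4 * R ^ 2 * (1 / w ^ 2)) := by
        have := b1 u
        have := b2 u
        gcongr
      _ = (M1 * (2 * n) + M2 * (4 * R ^ 2)) / w ^ 2 := by ring
      _ ≤ _ := by
        refine div_le_div_of_nonneg_right ?_ (by positivity)
        have : 0 ≤ 4 * M3 * R ^ 2 + 4 * (R ^ 2 * (M4 * (2 * n) +
          M5 * (4 * R ^ 2)) + 8 * M4 * R ^ 2 + M3 * (2 * n)) + 1 := by positivity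
        linarith
  · rw [e3, abs_mul, abs_of_nonneg (show 0 ≤ 4 / w ^ 2 by positivity)]
    have h1 : |sqd 0 x * (deriv ψ u * (2 * n / w) + deriv (deriv ψ) u * (4 * sqd 0 x / w ^ 2)) +
        8 * (deriv ψ u / w) * sqd 0 x + ψ u * (2 * n)| ≤
        (R ^ 2 * (M4 * (2 * n) + M5 * (4 * R ^ 2)) + 8 * M4 * R ^ 2 + M3 * (2 * n)) / w ^ 2 := by
      calc _ ≤ |sqd 0 x * (deriv ψ u * (2 * n / w))| +
            |sqd 0 x * (deriv (deriv ψ) u * (4 * sqd 0 x / w ^ 2))| +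
            |8 * (deriv ψ u / w) * sqd 0 x| + |ψ u * (2 * n)| := by
            rw [mul_add]
            refine (abs_add_le _ _).trans ?_
            gcongr
            refine (abs_add_le _ _).trans ?_
            gcongr
            exact abs_add_le _ _
        _ = sqd 0 x * (|deriv ψ u| * (2 * n * (1 / w))) +
            sqd 0 x * (|deriv (deriv ψ) u| * (4 * sqd 0 x * (1 / w ^ 2))) +
            8 * (|deriv ψ u| * (1 / w)) * sqd 0 x + |ψ u| * (2 * n) * 1 := by
          simp only [abs_mul, abs_div, abs_of_nonneg hx0, abs_of_pos hw0, Nat.abs_cast, abs_two,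
            abs_pow, show |(8:ℝ)| = 8 by norm_num, show |(4:ℝ)| = 4 by norm_num]
          ring
        _ ≤ R ^ 2 * (M4 * (2 * n * (1 / w ^ 2))) +
            R ^ 2 * (M5 * (4 * R ^ 2 * (1 / w ^ 2))) +
            8 * (M4 * (1 / w ^ 2)) * R ^ 2 + M3 * (2 * n) * (1 / w ^ 2) := by
          have := b3 u
          have := b4 u
          have := b5 u
          gcongr
        _ = _ := by ring
    calc _ ≤ 4 / w ^ 2 * ((R ^ 2 * (M4 * (2 * n) + M5 * (4 * R ^ 2)) + 8 * M4 * R ^ 2 +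
            M3 * (2 * n)) / w ^ 2) := by gcongr
      _ = 4 * (R ^ 2 * (M4 * (2 * n) + M5 * (4 * R ^ 2)) + 8 * M4 * R ^ 2 + M3 * (2 * n)) /
          w ^ 4 := by field_simp
      _ ≤ _ := by
        refine div_le_div_of_nonneg_right ?_ (by positivity)
        have : 0 ≤ 4 * M3 * R ^ 2 + (M1 * (2 * n) + M2 * (4 * R ^ 2)) + 1 := by positivity
        linarith

end Cutoff

section Exterior

variable {n : ℕ} {R R₁ R₂ μ b : ℝ} {Y P Z : ℝ → EuclideanSpace ℝ (Fin n) → ℝ}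

theorem mem_annulus_of_sqd {x : EuclideanSpace ℝ (Fin n)} (hR₁ : 0 < R₁) (h₁₂ : R₁ < R₂)
    (h1 : R₁ ^ 2 < sqd 0 x) (h2 : sqd 0 x < R₂ ^ 2) : x ∈ annulus n R₁ R₂ := by
  unfold sqd at h1 h2
  rw [sub_zero] at h1 h2
  exact ⟨lt_of_pow_lt_pow_left₀ 2 (norm_nonneg _) h1,
    lt_of_pow_lt_pow_left₀ 2 (by linarith) h2⟩

theorem integral_indicator_annulus (h₂R : R₂ ≤ R) (c : ℝ) (f : EuclideanSpace ℝ (Fin n) → ℝ) :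
    ∫ x in ball 0 R, (annulus n R₁ R₂).indicator (fun x => c * f x) x =
      c * ∫ x in annulus n R₁ R₂, f x := by
  rw [setIntegral_indicator isOpen_annulus.measurableSet,
    inter_eq_self_of_subset_right (annulus_subset_ball h₂R), integral_const_mul]

theorem exists_exterior_estimate (n : ℕ) (hR₁ : 0 < R₁) (h₁₂ : R₁ < R₂) (h₂R : R₂ ≤ R) :
    ∃ C : ℝ, 0 < C ∧ ∀ w ∈ Ioc (0:ℝ) 1, R₁ ^ 2 + w < R₂ ^ 2 → ∀ (μ b : ℝ)
      (Y P Z : ℝ → EuclideanSpace ℝ (Fin n) → ℝ), 0 < b → NiceSol R μ b Y P Z →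
      ∫ x in ball 0 R, cut (R₁ ^ 2 + w / 2) (w / 2) x * Y b x ^ 2 ≤
        Real.exp (-(μ ^ 2 * R₁ ^ 2 * b)) * (∫ x in ball 0 R, Y (b / 2) x ^ 2) +
        C / w ^ 2 * obs R₁ R₂ Y b := by
  obtain ⟨C, hC, H⟩ := exists_cut_bounds n R
  refine ⟨4 * C, by positivity, fun w hw hwR μ b Y P Z hb h => ?_⟩
  have hw0 := hw.1
  set m : EuclideanSpace ℝ (Fin n) → ℝ := cut (R₁ ^ 2 + w / 2) (w / 2) with hm
  have hm2 : ContDiff ℝ 2 m := contDiff_cut (k := 2)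
  have hm0 : ∀ x, 0 ≤ m x := fun x => Real.smoothTransition.nonneg _
  have hm1 : ∀ x, m x ≤ 1 := fun x => Real.smoothTransition.le_one _
  have hU : IsOpen (ball (0 : EuclideanSpace ℝ (Fin n)) R) := isOpen_ball
  have hbd : Bornology.IsBounded (ball (0 : EuclideanSpace ℝ (Fin n)) R) := isBounded_ball
  set α := 2 * μ ^ 2 * R₁ ^ 2 with hα
  set E : ℝ → ℝ := fun t => ∫ x in ball 0 R, m x * Y t x ^ 2 with hE
  set E' : ℝ → ℝ := fun t => ∫ x in ball 0 R, m x * (2 * Y t x * P t x) with hE'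
  have hdE : ∀ t, HasDerivAt E (E' t) t := h.hasDerivAt_energy hU hbd hm2.continuous
  have hle : ∀ t ∈ Icc 0 b, E' t ≤ -α * E t + 4 * C / w ^ 2 * ∫ x in annulus n R₁ R₂, Y t x ^ 2 := by
    intro t ht
    have hY := h.h10Y ht
    have iY := hY.integrableOn_sq hU hbd
    have c1 := continuous_lapl hm2
    have c2 := hm2.continuous
    have c3 : Continuous (sqd (0 : EuclideanSpace ℝ (Fin n))) :=
      (contDiff_sqd 0 (k := 0)).continuous
    have i1 : IntegrableOn (fun x => (lapl m x - 2 * μ ^ 2 * sqd 0 x * m x) * Y t x ^ 2)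
        (ball 0 R) := integrableOn_bdd_mul hU hbd (by fun_prop) iY
    have i2 : IntegrableOn (fun x => -α * (m x * Y t x ^ 2)) (ball 0 R) :=
      (integrableOn_bdd_mul hU hbd c2 iY).const_mul _
    have i3 : IntegrableOn ((annulus n R₁ R₂).indicator fun x => 4 * C / w ^ 2 * Y t x ^ 2)
        (ball 0 R) := (iY.const_mul _).indicator isOpen_annulus.measurableSet
    have hg : 0 ≤ ∫ x in ball 0 R, m x * gr (Y t) (Y t) x :=
      integral_nonneg fun x => mul_nonneg (hm0 x) (gr_self_nonneg _ x)
    have hmono : ∫ x in ball 0 R, (lapl m x - 2 * μ ^ 2 * sqd 0 x * m x) * Y t x ^ 2 ≤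
        ∫ x in ball 0 R, (-α * (m x * Y t x ^ 2) +
          (annulus n R₁ R₂).indicator (fun x => 4 * C / w ^ 2 * Y t x ^ 2) x) := by
      refine setIntegral_mono_on i1 (i2.add i3) hU.measurableSet fun x hx => ?_
      obtain ⟨b0, -, b2, -⟩ := H (R₁ ^ 2 + w / 2) (w / 2) ⟨by linarith, by linarith [hw.2]⟩ x hx
      have h1 : R₁ ^ 2 * m x ≤ sqd 0 x * m x := by
        rcases le_total (R₁ ^ 2) (sqd 0 x) with h1 | h1
        · exact mul_le_mul_of_nonneg_right h1 (hm0 x)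
        · rw [hm, cut_eq_zero (by linarith) (by linarith)]; simp
      have h2 : -(2 * μ ^ 2 * sqd 0 x * m x) * Y t x ^ 2 ≤ -α * (m x * Y t x ^ 2) := by
        have : 0 ≤ 2 * μ ^ 2 * Y t x ^ 2 := by positivity
        rw [hα]
        nlinarith
      have h3 : lapl m x * Y t x ^ 2 ≤
          (annulus n R₁ R₂).indicator (fun x => 4 * C / w ^ 2 * Y t x ^ 2) x := by
        by_cases hs : sqd 0 x ∈ Icc (R₁ ^ 2 + w / 2) (R₁ ^ 2 + w / 2 + w / 2)
        · rw [indicator_of_mem (mem_annulus_of_sqd hR₁ h₁₂ (by linarith [hs.1])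
            (by linarith [hs.2]))]
          refine mul_le_mul_of_nonneg_right ?_ (sq_nonneg _)
          refine ((le_abs_self _).trans b2).trans_eq ?_
          field_simp
          ring
        · rw [hm, (b0 hs).2.1, zero_mul]
          exact indicator_nonneg (fun x _ => by positivity) x
      linarith
    simp only [hE', h.energy_identity ht hm2]
    rw [integral_add i2 i3, integral_const_mul, integral_indicator_annulus h₂R] at hmono
    linarith
  have hα0 : 0 ≤ α := by positivity
  have hG : ∀ t, HasDerivAt (fun t => Real.exp (α * (t - b)) * E t - 4 * C / w ^ 2 * obs R₁ R₂ Y t)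
      (Real.exp (α * (t - b)) * (α * 1) * E t + Real.exp (α * (t - b)) * E' t -
        4 * C / w ^ 2 * ∫ x in annulus n R₁ R₂, Y t x ^ 2) t := fun t =>
    (((((hasDerivAt_id t).sub_const b).const_mul α).exp).mul (hdE t)).sub
      ((h.hasDerivAt_obs t).const_mul _)
  have hanti : AntitoneOn (fun t => Real.exp (α * (t - b)) * E t -
      4 * C / w ^ 2 * obs R₁ R₂ Y t) (Icc 0 b) := by
    refine antitoneOn_of_deriv_nonpos (convex_Icc 0 b)
      (fun t _ => (hG t).continuousAt.continuousWithinAt)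
      (fun t _ => (hG t).differentiableAt.differentiableWithinAt) fun t ht => ?_
    rw [interior_Icc] at ht
    rw [(hG t).deriv]
    have h1 := hle t (Ioo_subset_Icc_self ht)
    have h2 : Real.exp (α * (t - b)) ≤ 1 :=
      Real.exp_le_one_iff.2 (mul_nonpos_of_nonneg_of_nonpos hα0 (by linarith [ht.2]))
    have h3 : 0 ≤ 4 * C / w ^ 2 * ∫ x in annulus n R₁ R₂, Y t x ^ 2 :=
      mul_nonneg (by positivity) (integral_nonneg fun _ => sq_nonneg _)
    have h4 := Real.exp_pos (α * (t - b))
    nlinarith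
  have hfin := hanti (⟨by linarith, by linarith⟩ : b / 2 ∈ Icc 0 b) ⟨hb.le, le_rfl⟩ (by linarith)
  simp only [sub_self, mul_zero, Real.exp_zero, one_mul] at hfin
  have h1 : E (b / 2) ≤ ∫ x in ball 0 R, Y (b / 2) x ^ 2 := by
    have iY := (h.h10Y (⟨by linarith, by linarith⟩ : b / 2 ∈ Icc 0 b)).integrableOn_sq hU hbd
    exact setIntegral_mono (integrableOn_bdd_mul hU hbd hm2.continuous iY) iY fun x =>
      mul_le_of_le_one_left (sq_nonneg _) (hm1 x)
  have h2 : 0 ≤ 4 * C / w ^ 2 * obs R₁ R₂ Y (b / 2) :=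
    mul_nonneg (by positivity) (obs_nonneg (by linarith))
  have h3 : α * (b / 2 - b) = -(μ ^ 2 * R₁ ^ 2 * b) := by rw [hα]; ring
  rw [h3] at hfin
  have h4 := mul_le_mul_of_nonneg_left h1 (Real.exp_pos (-(μ ^ 2 * R₁ ^ 2 * b))).le
  linarith

end Exterior

section Interior

variable {n : ℕ} {f : EuclideanSpace ℝ (Fin n) → ℝ} {U : Set (EuclideanSpace ℝ (Fin n))}

theorem pd_comm (hf : ContDiff ℝ 2 f) (i j : Fin n) (x : EuclideanSpace ℝ (Fin n)) :
    pd i (pd j f) x = pd j (pd i f) x := by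
  have hs : IsSymmSndFDerivAt ℝ f x := hf.contDiffAt.isSymmSndFDerivAt (by simp)
  have hd : DifferentiableAt ℝ (fderiv ℝ f) x :=
    ((hf.fderiv_right (m := 1) (by norm_num)).differentiable (by simp)) x
  have key : ∀ i j : Fin n, pd i (pd j f) x =
      fderiv ℝ (fderiv ℝ f) x (EuclideanSpace.single i 1) (EuclideanSpace.single j 1) := by
    intro i j
    change fderiv ℝ (fun z => fderiv ℝ f z (EuclideanSpace.single j 1)) x _ = _
    rw [fderiv_clm_apply hd (differentiableAt_const _)]
    simp
  rw [key, key]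
  exact hs _ _

theorem pd_finset_sum {ι : Type*} (s : Finset ι) (i : Fin n)
    {F : ι → EuclideanSpace ℝ (Fin n) → ℝ} {x : EuclideanSpace ℝ (Fin n)}
    (hF : ∀ j ∈ s, DifferentiableAt ℝ (F j) x) :
    pd i (fun z => ∑ j ∈ s, F j z) x = ∑ j ∈ s, pd i (F j) x := by
  unfold pd
  rw [fderiv_fun_sum hF]
  simp

theorem pd_gr (hf : ContDiff ℝ 2 f) {g : EuclideanSpace ℝ (Fin n) → ℝ} (hg : ContDiff ℝ 2 g)
    (i : Fin n) (x : EuclideanSpace ℝ (Fin n)) :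
    pd i (gr f g) x = ∑ j, (pd j f x * pd i (pd j g) x + pd j g x * pd i (pd j f) x) := by
  have d1 : ∀ j, DifferentiableAt ℝ (pd j f) x := fun j =>
    ((contDiff_pd (m := 1) hf (by norm_num) j).differentiable (by simp)) x
  have d2 : ∀ j, DifferentiableAt ℝ (pd j g) x := fun j =>
    ((contDiff_pd (m := 1) hg (by norm_num) j).differentiable (by simp)) x
  unfold gr
  rw [pd_finset_sum _ _ fun j _ => (d1 j).fun_mul (d2 j)]
  exact Finset.sum_congr rfl fun j _ => pd_mul i (d1 j) (d2 j)

theorem pd_pd_sqd (i j : Fin n) (a x : EuclideanSpace ℝ (Fin n)) :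
    pd i (pd j (sqd a)) x = if j = i then 2 else 0 := by
  have h : pd j (sqd a) = fun z => 2 * (z j - a j) := funext fun z => pd_sqd j a z
  rw [h, pd_const_mul]
  unfold pd
  have : HasFDerivAt (fun z : EuclideanSpace ℝ (Fin n) => z j - a j)
    (EuclideanSpace.proj j : EuclideanSpace ℝ (Fin n) →L[ℝ] ℝ) x :=
      (EuclideanSpace.proj j : EuclideanSpace ℝ (Fin n) →L[ℝ] ℝ).hasFDerivAt.sub_const (a j)
  rw [this.fderiv]
  simp

theorem contDiff_gr {k l : WithTop ℕ∞} (hf : ContDiff ℝ k f) {g : EuclideanSpace ℝ (Fin n) → ℝ}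
    (hg : ContDiff ℝ k g) (hk : l + 1 ≤ k) : ContDiff ℝ l (gr f g) :=
  ContDiff.sum fun i _ => (contDiff_pd hf hk i).mul (contDiff_pd hg hk i)

/-- The Rellich identity for compactly supported functions: there is no boundary term. -/
theorem rellich_of_hasCompactSupport (hf : ContDiff ℝ 2 f) (hc : HasCompactSupport f)
    (hsub : tsupport f ⊆ U) (a : EuclideanSpace ℝ (Fin n)) :
    IZ U (fun x => gr (sqd a) f x * lapl f x + (2 - n) * gr f f x) := by
  have hs : ContDiff ℝ 2 (sqd a) := contDiff_sqd a
  have hD : ContDiff ℝ 1 (gr (sqd a) f) := contDiff_gr hs hf (by norm_num)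
  have hE : ContDiff ℝ 1 (gr f f) := contDiff_gr hf hf (by norm_num)
  have hp : ∀ i, ContDiff ℝ 1 (pd i f) := contDiff_pd hf (by norm_num)
  have hq : ∀ i, ContDiff ℝ 1 (pd i (sqd a)) := contDiff_pd hs (by norm_num)
  have hF : ∀ i ∈ Finset.univ, IZ U (pd i fun x =>
      gr (sqd a) f x * pd i f x + -(1 / 2) * (gr f f x * pd i (sqd a) x)) := by
    intro i _
    have hz : ∀ x, x ∉ tsupport f → gr (sqd a) f x * pd i f x +
        -(1 / 2) * (gr f f x * pd i (sqd a) x) = 0 := by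
      intro x hx
      have h0 : ∀ j, pd j f x = 0 := fun j => by
        have : f =ᶠ[nhds x] fun _ => 0 := by
          filter_upwards [(isClosed_tsupport f).isOpen_compl.mem_nhds hx] with z hz
          exact image_eq_zero_of_notMem_tsupport hz
        rw [pd_congr j this]
        exact pd_const j 0
      simp [gr, h0]
    have hsup : tsupport (fun x => gr (sqd a) f x * pd i f x +
        -(1 / 2) * (gr f f x * pd i (sqd a) x)) ⊆ tsupport f := by
      refine closure_minimal (fun x hx => ?_) (isClosed_tsupport f)
      by_contra hx'
      exact hx (hz x hx')
    exact IZ.of_tsupport ((hD.mul (hp i)).add (contDiff_const.mul (hE.mul (hq i))))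
      (hc.of_isClosed_subset (isClosed_tsupport _) hsup) (hsup.trans hsub) i
  have key : (fun x => ∑ i, pd i (fun x => gr (sqd a) f x * pd i f x +
      -(1 / 2) * (gr f f x * pd i (sqd a) x)) x) =
      fun x => gr (sqd a) f x * lapl f x + (2 - n) * gr f f x := by
    funext x
    have e : ∀ i, pd i (fun x => gr (sqd a) f x * pd i f x +
        -(1 / 2) * (gr f f x * pd i (sqd a) x)) x =
        gr (sqd a) f x * pd i (pd i f) x - gr f f x + 2 * (pd i f x * pd i f x) +
          (∑ j, pd i f x * (pd j (sqd a) x * pd i (pd j f) x) -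
          ∑ j, pd i (sqd a) x * (pd j f x * pd j (pd i f) x)) := by
      intro i
      have d1 := hD.differentiable (by simp) x
      have d2 := (hp i).differentiable (by simp) x
      have d3 := hE.differentiable (by simp) x
      have d4 := (hq i).differentiable (by simp) x
      rw [pd_add i (d1.fun_mul d2) ((d3.fun_mul d4).const_mul _), pd_mul i d1 d2, pd_const_mul,
        pd_mul i d3 d4, pd_gr hs hf, pd_gr hf hf, pd_pd_sqd, if_pos rfl,
        Finset.sum_add_distrib, Finset.sum_add_distrib]
      simp only [pd_pd_sqd, mul_ite, mul_zero, Finset.sum_ite_eq', Finset.mem_univ, if_true,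
        pd_comm hf i, ← Finset.mul_sum]
      ring
    have hsw : ∑ i, ∑ j, pd i f x * (pd j (sqd a) x * pd i (pd j f) x) =
        ∑ i, ∑ j, pd i (sqd a) x * (pd j f x * pd j (pd i f) x) := by
      rw [Finset.sum_comm]
      exact Finset.sum_congr rfl fun i _ => Finset.sum_congr rfl fun j _ => by ring
    simp only [e, Finset.sum_add_distrib, Finset.sum_sub_distrib, hsw, lapl_eq_sum_pd,
      Finset.mul_sum, Finset.sum_const, Finset.card_univ, Fintype.card_fin, nsmul_eq_mul]
    have : ∑ i, 2 * (pd i f x * pd i f x) = 2 * gr f f x := by rw [gr, Finset.mul_sum]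
    rw [this]
    ring
  rw [← key]
  exact IZ.sum Finset.univ hF

/-- The commutator estimate for the exact Gaussian weight: `f` is compactly supported and `G` is an
error term. -/
theorem static_interior_le {R : ℝ} (hf : ContDiff ℝ 2 f) (hc : HasCompactSupport f)
    (hsub : tsupport f ⊆ ball 0 R) (hf1 : H10 (ball 0 R) f) {G : EuclideanSpace ℝ (Fin n) → ℝ}
    (hG : L2 (ball 0 R) G) (θ κ : ℝ) :
    ∫ x in ball 0 R, (-2 * (lapl f x + κ * f x) * (lapl f x + κ * f x - θ * gr (sqd 0) f x -
        θ * n * f x - G x) + 4 * θ * κ * f x ^ 2) ≤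
      1 / 2 * (∫ x in ball 0 R, G x ^ 2) -
        4 * θ * ∫ x in ball 0 R, (gr f f x - κ * f x ^ 2) := by
  have hU : IsOpen (ball (0 : EuclideanSpace ℝ (Fin n)) R) := isOpen_ball
  have hb : Bornology.IsBounded (ball (0 : EuclideanSpace ℝ (Fin n)) R) := isBounded_ball
  have z1 := rellich_of_hasCompactSupport hf hc hsub 0
  have z2 := hf1.mul_lapl hU hb contDiff_one
  have z3 := (hf1.div_smooth hf1 hU hb contDiff_one (contDiff_sqd 0)).const_mul (1 / 2)
  have z := ((z1.add (z2.const_mul n)).add (z3.const_mul κ)).const_mul (2 * θ)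
  have iG : IntegrableOn (fun x => G x ^ 2) (ball 0 R) := hG.integrable_sq
  have if2 := hf1.integrableOn_sq hU hb
  have igr := hf1.integrableOn_gr hf1
  have iQ : IntegrableOn (fun x => gr f f x - κ * f x ^ 2) (ball 0 R) := igr.sub (if2.const_mul κ)
  have hL : L2 (ball 0 R) (fun x => lapl f x) := hf1.lap
  have hF : L2 (ball 0 R) f := hf1.L2 hU hb
  have hS : L2 (ball 0 R) (fun x => lapl f x + κ * f x) := hL.add (hF.const_mul κ)
  have hDf : L2 (ball 0 R) (fun x => gr (sqd 0) f x) :=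
    hf1.L2_gr_left hU hb (contDiff_sqd 0)
  have hA : L2 (ball 0 R) (fun x => lapl f x + κ * f x - θ * gr (sqd 0) f x -
        θ * n * f x - G x) := ((hS.sub (hDf.const_mul θ)).sub (hF.const_mul (θ * n))).sub hG
  have iL : IntegrableOn (fun x => -2 * (lapl f x + κ * f x) * (lapl f x + κ * f x -
      θ * gr (sqd 0) f x - θ * n * f x - G x) + 4 * θ * κ * f x ^ 2) (ball 0 R) :=
    ((hS.const_mul (-2)).mul hA).add (if2.const_mul _)
  have iR : IntegrableOn (fun x => 1 / 2 * G x ^ 2 - 4 * θ * (gr f f x - κ * f x ^ 2))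
      (ball 0 R) := (iG.const_mul _).sub (iQ.const_mul _)
  rw [← integral_const_mul, ← integral_const_mul, ← integral_sub (iG.const_mul _)
    (iQ.const_mul _), ← z.integral_add_eq iR]
  refine setIntegral_mono_on iL (z.1.add iR) hU.measurableSet fun x _ => ?_
  simp only [gr_const_left, lapl_const, lapl_sqd]
  have : 0 ≤ 2 * (lapl f x + κ * f x - 1 / 2 * G x) ^ 2 := by positivity
  linarith

end Interior

section InteriorWeight

variable {n : ℕ} {ℓ μ t : ℝ} {h : EuclideanSpace ℝ (Fin n) → ℝ} {x : EuclideanSpace ℝ (Fin n)}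

/-- The quadratic weight vanishing on the sphere of squared radius `ℓ`. -/
noncomputable def quadw {n : ℕ} (ℓ : ℝ) (x : EuclideanSpace ℝ (Fin n)) : ℝ :=
  1 / 2 * sqd 0 x + -(ℓ / 2)

theorem contDiff_quadw {k : WithTop ℕ∞} :
    ContDiff ℝ k (quadw ℓ : EuclideanSpace ℝ (Fin n) → ℝ) :=
  (contDiff_const.mul (contDiff_sqd 0)).add contDiff_const

theorem gr_quadw_left : gr (quadw ℓ) h x = 1 / 2 * gr (sqd 0) h x := by
  have d : DifferentiableAt ℝ (sqd (0 : EuclideanSpace ℝ (Fin n))) x :=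
    (contDiff_sqd 0 (k := 1)).differentiable (by simp) x
  unfold quadw
  rw [gr_add_left (d.const_mul _) (differentiableAt_const _), gr_const_mul_left, gr_const_left]
  ring

theorem gr_quadw_quadw : gr (quadw ℓ) (quadw ℓ) x = sqd 0 x := by
  rw [gr_quadw_left, gr_comm, gr_quadw_left, gr_sqd_sqd]
  ring

theorem lapl_quadw : lapl (quadw ℓ) x = n := by
  have d : ContDiffAt ℝ 2 (sqd (0 : EuclideanSpace ℝ (Fin n))) x := (contDiff_sqd 0).contDiffAt
  unfold quadw
  rw [lapl_add (contDiffAt_const.mul d) contDiffAt_const, lapl_const_mul, lapl_const, lapl_sqd]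
  ring

/-- The solution `μ coth (2 μ t)` of the Riccati equation `θ' = -2 (θ² - μ²)`. -/
noncomputable def cth (μ t : ℝ) : ℝ := μ * Real.cosh (2 * μ * t) / Real.sinh (2 * μ * t)

theorem hasDerivAt_sinh_mul (μ t : ℝ) :
    HasDerivAt (fun t => Real.sinh (2 * μ * t)) (2 * μ * Real.cosh (2 * μ * t)) t := by
  have := ((hasDerivAt_id t).const_mul (2 * μ)).sinh
  simpa [mul_comm] using this

theorem hasDerivAt_cosh_mul (μ t : ℝ) :
    HasDerivAt (fun t => Real.cosh (2 * μ * t)) (2 * μ * Real.sinh (2 * μ * t)) t := by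
  have := ((hasDerivAt_id t).const_mul (2 * μ)).cosh
  simpa [mul_comm] using this

theorem hasDerivAt_cth (hs : Real.sinh (2 * μ * t) ≠ 0) :
    HasDerivAt (cth μ) (-2 * μ ^ 2 / Real.sinh (2 * μ * t) ^ 2) t := by
  refine (((hasDerivAt_cosh_mul μ t).const_mul μ).div (hasDerivAt_sinh_mul μ t) hs).congr_deriv ?_
  have := Real.cosh_sq (2 * μ * t)
  congr 1
  linear_combination -2 * μ ^ 2 * this

theorem hasDerivAt_cth_deriv (hs : Real.sinh (2 * μ * t) ≠ 0) :
    HasDerivAt (fun t => -2 * μ ^ 2 / Real.sinh (2 * μ * t) ^ 2)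
      (8 * μ ^ 3 * Real.cosh (2 * μ * t) / Real.sinh (2 * μ * t) ^ 3) t := by
  refine (((hasDerivAt_const t (-2 * μ ^ 2)).div ((hasDerivAt_sinh_mul μ t).pow 2)
    (pow_ne_zero 2 hs))).congr_deriv ?_
  simp only [Pi.pow_apply]
  field_simp
  ring

theorem ppot_quadw (hs : Real.sinh (2 * μ * t) ≠ 0) :
    ppot μ (quadw ℓ) (cth μ t) (-2 * μ ^ 2 / Real.sinh (2 * μ * t) ^ 2) x =
      μ ^ 2 * ℓ / Real.sinh (2 * μ * t) ^ 2 := by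
  have := Real.cosh_sq (2 * μ * t)
  rw [ppot, gr_quadw_quadw, cth, quadw, div_pow, mul_pow, this]
  generalize Real.sinh (2 * μ * t) = s at hs
  field_simp
  ring

end InteriorWeight

section InteriorDynamics

variable {n : ℕ} {R μ b t ℓ : ℝ} {Y P Z : ℝ → EuclideanSpace ℝ (Fin n) → ℝ}
  {χ : EuclideanSpace ℝ (Fin n) → ℝ}

/-- Differential inequality for the weighted energy with weight `quadw`. -/
theorem NiceSol.hasDerivAt_interior (h : NiceSol R μ b Y P Z) (hμ : 0 < μ) (ht : t ∈ Ioo 0 b)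
    (hχ : ContDiff ℝ 2 χ) (hc : HasCompactSupport χ) (hsub : tsupport χ ⊆ ball 0 R)
    {Q : ℝ → ℝ} (hQ : Q = fun s => ∫ x in ball 0 R, qdens χ (quadw ℓ) (Y s) (P s) (cth μ s)
      (-2 * μ ^ 2 / Real.sinh (2 * μ * s) ^ 2) x) :
    ∃ Q', HasDerivAt Q Q' t ∧ Q' ≤ 1 / 2 * (∫ x in ball 0 R, (Real.exp (cth μ t * quadw ℓ x) *
      (2 * gr χ (Y t) x + lapl χ x * Y t x)) ^ 2) - 4 * cth μ t * Q t := by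
  have hU : IsOpen (ball (0 : EuclideanSpace ℝ (Fin n)) R) := isOpen_ball
  have hb : Bornology.IsBounded (ball (0 : EuclideanSpace ℝ (Fin n)) R) := isBounded_ball
  have hχ1 : ContDiff ℝ 1 χ := hχ.of_le (by norm_num)
  have htI : t ∈ Icc 0 b := Ioo_subset_Icc_self ht
  have hY := h.h10Y htI
  have hs : ∀ s ∈ Ioo 0 b, Real.sinh (2 * μ * s) ≠ 0 := fun s hs =>
    (Real.sinh_pos_iff.2 (mul_pos (by linarith) hs.1)).ne'
  have hg : ContDiff ℝ 2 (quadw ℓ : EuclideanSpace ℝ (Fin n) → ℝ) := contDiff_quadw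
  have hw := contDiff_wt hχ hg (cth μ t)
  set f : EuclideanSpace ℝ (Fin n) → ℝ := fun z => wt χ (quadw ℓ) (cth μ t) z * Y t z with hf
  have hsup : tsupport (wt χ (quadw ℓ) (cth μ t)) ⊆ tsupport χ := tsupport_mul_subset_left
  have hcw : HasCompactSupport (wt χ (quadw ℓ) (cth μ t)) := hc.mul_right
  have hf2 : ContDiff ℝ 2 f :=
    contDiff_mul_of_tsupport_subset hw hU (hsup.trans hsub) (h.sY t htI)
  have hfc : HasCompactSupport f := hcw.mul_right
  have hfs : tsupport f ⊆ ball 0 R := (tsupport_mul_subset_left.trans hsup).trans hsub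
  have hfH : H10 (ball 0 R) f := hY.mul hU hb hw
  set κ := μ ^ 2 * ℓ / Real.sinh (2 * μ * t) ^ 2 with hκ
  have hcy : Continuous (Y t) := hY.cont
  have hG : L2 (ball 0 R) (fun x => Real.exp (cth μ t * quadw ℓ x) *
      (2 * gr χ (Y t) x + lapl χ x * Y t x)) := by
    have c1 : Continuous fun x : EuclideanSpace ℝ (Fin n) => Real.exp (cth μ t * quadw ℓ x) := by
      have := hg.continuous
      fun_prop
    exact L2.bdd_mul hU hb c1 (((hY.L2_gr_left hU hb hχ1).const_mul 2).add
      (L2.bdd_mul hU hb (continuous_lapl hχ) (hY.L2 hU hb)))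
  have hd := h.hasDerivAt_integral_qdens isOpen_Ioo Ioo_subset_Icc_self hχ hg
    (fun s hs' => hasDerivAt_cth (hs s hs')) (fun s hs' => hasDerivAt_cth_deriv (hs s hs'))
    (fun s hs' => ContinuousAt.continuousWithinAt
      (ContinuousAt.div (by fun_prop) (by fun_prop) (pow_ne_zero 3 (hs s hs')))) ht hf
  refine ⟨_, hQ ▸ hd, ?_⟩
  have key := static_interior_le hf2 hfc hfs hfH hG (cth μ t) κ
  have e1 : Q t = ∫ x in ball 0 R, (gr f f x - κ * f x ^ 2) := by
    rw [hQ]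
    simp only [h.integral_qdens htI hχ hg, ppot_quadw (hs t ht)]
    rfl
  rw [e1]
  refine le_trans (le_of_eq ?_) key
  congr 1
  funext x
  rw [ppot_quadw (hs t ht), gr_quadw_left, gr_quadw_quadw, lapl_quadw]
  have : 2 * cth μ t * (-2 * μ ^ 2 / Real.sinh (2 * μ * t) ^ 2) * sqd 0 x +
      8 * μ ^ 3 * Real.cosh (2 * μ * t) / Real.sinh (2 * μ * t) ^ 3 * quadw ℓ x =
      -4 * cth μ t * κ := by
    have := hs t ht
    rw [hκ, quadw, cth]
    field_simp
    ring
  rw [this]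
  ring

end InteriorDynamics

section InteriorEstimate

variable {n : ℕ} {R R₁ R₂ μ b t ℓ s w : ℝ} {Y P Z : ℝ → EuclideanSpace ℝ (Fin n) → ℝ}
  {χ : EuclideanSpace ℝ (Fin n) → ℝ}

/-- A cutoff equal to `1` on the ball of squared radius `s`, supported in the ball of squared
radius `s + w`. -/
noncomputable def ccut {n : ℕ} (s w : ℝ) (x : EuclideanSpace ℝ (Fin n)) : ℝ := 1 + -1 * cut s w x

theorem contDiff_ccut {k : ℕ∞} : ContDiff ℝ k (ccut s w : EuclideanSpace ℝ (Fin n) → ℝ) :=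
  contDiff_const.add (contDiff_const.mul contDiff_cut)

theorem ccut_eq_zero {x : EuclideanSpace ℝ (Fin n)} (hw : 0 < w) (hx : s + w ≤ sqd 0 x) :
    ccut s w x = 0 := by
  rw [ccut, cut_eq_one hw hx]; ring

theorem gr_ccut_ccut (x : EuclideanSpace ℝ (Fin n)) :
    gr (ccut s w) (ccut s w) x = gr (cut s w) (cut s w) x := by
  have d : DifferentiableAt ℝ (cut s w : EuclideanSpace ℝ (Fin n) → ℝ) x :=
    (contDiff_cut (k := 1)).differentiable (by simp) x
  unfold ccut
  rw [gr_add_left (differentiableAt_const _) (d.const_mul _), gr_const_left,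
    gr_add_right (differentiableAt_const _) (d.const_mul _), gr_const_right,
    gr_const_mul_left, gr_const_mul_right]
  ring

theorem lapl_ccut (x : EuclideanSpace ℝ (Fin n)) : lapl (ccut s w) x = -lapl (cut s w) x := by
  have d : ContDiffAt ℝ 2 (cut s w : EuclideanSpace ℝ (Fin n) → ℝ) x :=
    (contDiff_cut (k := 2)).contDiffAt
  unfold ccut
  rw [lapl_add contDiffAt_const (contDiffAt_const.mul d), lapl_const, lapl_const_mul]
  ring

theorem tsupport_ccut_subset (hw : 0 < w) :
    tsupport (ccut s w : EuclideanSpace ℝ (Fin n) → ℝ) ⊆ {x | sqd 0 x ≤ s + w} := by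
  refine closure_minimal (fun x hx => ?_)
    (isClosed_le (contDiff_sqd 0 (k := 0)).continuous continuous_const)
  by_contra hx'
  exact hx (ccut_eq_zero hw (not_le.1 hx').le)

theorem tsupport_ccut_subset_ball (hw : 0 < w) (hR : 0 < R) (hs : s + w < R ^ 2) :
    tsupport (ccut s w : EuclideanSpace ℝ (Fin n) → ℝ) ⊆ ball 0 R := fun x hx => by
  have h1 : sqd 0 x ≤ s + w := tsupport_ccut_subset hw hx
  rw [sqd] at h1
  exact mem_ball_iff_norm.2 (lt_of_pow_lt_pow_left₀ 2 hR.le (h1.trans_lt hs))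

theorem hasCompactSupport_ccut (hw : 0 < w) (hR : 0 < R) (hs : s + w < R ^ 2) :
    HasCompactSupport (ccut s w : EuclideanSpace ℝ (Fin n) → ℝ) :=
  (isCompact_closedBall 0 R).of_isClosed_subset (isClosed_tsupport _)
    ((tsupport_ccut_subset_ball hw hR hs).trans ball_subset_closedBall)

theorem cth_pos (hμ : 0 < μ) (ht : 0 < t) : 0 < cth μ t :=
  div_pos (mul_pos hμ (Real.cosh_pos _)) (Real.sinh_pos_iff.2 (by positivity))

/-- Upper bound for the weighted energy near time zero. -/
theorem NiceSol.exists_integral_qdens_interior_le (h : NiceSol R μ b Y P Z) (hμ : 0 < μ)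
    (hw : 0 < w) (hℓ : s + w ≤ ℓ) :
    ∃ D, 0 ≤ D ∧ ∀ t ∈ Ioo 0 b,
      ∫ x in ball 0 R, qdens (ccut s w) (quadw ℓ) (Y t) (P t) (cth μ t)
        (-2 * μ ^ 2 / Real.sinh (2 * μ * t) ^ 2) x ≤ D * (1 + cth μ t) := by
  have hU : IsOpen (ball (0 : EuclideanSpace ℝ (Fin n)) R) := isOpen_ball
  have hb : Bornology.IsBounded (ball (0 : EuclideanSpace ℝ (Fin n)) R) := isBounded_ball
  set χ : EuclideanSpace ℝ (Fin n) → ℝ := ccut s w with hχd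
  have hχ : ContDiff ℝ 1 χ := contDiff_ccut (k := 1)
  have hg : ContDiff ℝ 1 (quadw ℓ : EuclideanSpace ℝ (Fin n) → ℝ) := contDiff_quadw
  have c1 := hχ.continuous
  have c2 := hg.continuous
  have c3 := continuous_gr hχ hχ
  have c4 := continuous_gr hχ hg
  obtain ⟨A, hA, HA⟩ := exists_bound_of_isBounded hb c1
  obtain ⟨B, hB, HB⟩ := exists_bound_of_isBounded hb c3
  obtain ⟨C, hC, HC⟩ := exists_bound_of_isBounded hb c4
  have hK : IsCompact (Icc 0 b ×ˢ closedBall (0 : EuclideanSpace ℝ (Fin n)) R) :=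
    isCompact_Icc.prod (isCompact_closedBall 0 R)
  obtain ⟨M, HM⟩ := hK.exists_bound_of_continuousOn h.cY.continuousOn
  obtain ⟨N, HN⟩ := hK.exists_bound_of_continuousOn h.cP.continuousOn
  set V := volume.real (ball (0 : EuclideanSpace ℝ (Fin n)) R) with hV
  set D := A ^ 2 * (M ^ 2 + N ^ 2) + (B + 2 * A * C) * M ^ 2 with hD
  have hD0 : 0 ≤ D := by positivity
  refine ⟨D * V, by positivity, fun t ht => ?_⟩
  have hθ := cth_pos hμ ht.1
  have hsn : 0 < Real.sinh (2 * μ * t) := Real.sinh_pos_iff.2 (mul_pos (by linarith) ht.1)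
  have hcY := continuous_of_uncurry h.cY t
  have hcP := continuous_of_uncurry h.cP t
  set θ' := -2 * μ ^ 2 / Real.sinh (2 * μ * t) ^ 2 with hθ'
  have hθ'0 : θ' ≤ 0 := div_nonpos_of_nonpos_of_nonneg (by nlinarith) (by positivity)
  have i1 : IntegrableOn (qdens χ (quadw ℓ) (Y t) (P t) (cth μ t) θ') (ball 0 R) := by
    refine Continuous.integrableOn_of_isBounded hU hb ?_
    unfold qdens
    fun_prop
  have i2 : IntegrableOn (fun _ => D * (1 + cth μ t)) (ball (0 : EuclideanSpace ℝ (Fin n)) R) :=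
    continuous_const.integrableOn_of_isBounded hU hb
  refine (setIntegral_mono_on i1 i2 hU.measurableSet fun x hx => ?_).trans_eq ?_
  · have hpos : 0 ≤ D * (1 + cth μ t) := by positivity
    rcases le_or_gt (s + w) (sqd 0 x) with hx1 | hx1
    · have h0 : χ x = 0 := ccut_eq_zero hw hx1
      have h1 : gr χ χ x = 0 := by
        have hmin : IsLocalMin χ x := by
          refine Filter.Eventually.of_forall fun z => ?_
          rw [h0, hχd, ccut]
          have : cut s w z ≤ 1 := Real.smoothTransition.le_one _
          linarith
        have : fderiv ℝ χ x = 0 := hmin.fderiv_eq_zero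
        simp [gr, pd, this]
      rw [qdens, h0, h1]
      simpa using hpos
    · have hg0 : quadw ℓ x ≤ 0 := by unfold quadw; linarith
      have he : Real.exp (cth μ t * quadw ℓ x) ^ 2 ≤ 1 :=
        pow_le_one₀ (Real.exp_pos _).le
          (Real.exp_le_one_iff.2 (mul_nonpos_of_nonneg_of_nonpos hθ.le hg0))
      have hxK : (t, x) ∈ Icc 0 b ×ˢ closedBall (0 : EuclideanSpace ℝ (Fin n)) R :=
        ⟨Ioo_subset_Icc_self ht, ball_subset_closedBall hx⟩
      have hYM : Y t x ^ 2 ≤ M ^ 2 := by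
        have := HM _ hxK
        rw [Real.norm_eq_abs] at this
        rw [← sq_abs]
        gcongr
      have hPN : P t x ^ 2 ≤ N ^ 2 := by
        have := HN _ hxK
        rw [Real.norm_eq_abs] at this
        rw [← sq_abs]
        gcongr
      have hχ2 : χ x ^ 2 ≤ A ^ 2 := by
        rw [← sq_abs]
        gcongr
        exact HA x hx
      have h3 : χ x * gr χ (quadw ℓ) x ≤ A * C := by
        refine (le_abs_self _).trans ?_
        rw [abs_mul]
        exact mul_le_mul (HA x hx) (HC x hx) (abs_nonneg _) hA
      have hbr : -χ x ^ 2 * (Y t x * P t x) + (gr χ χ x + 2 * cth μ t * χ x * gr χ (quadw ℓ) x -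
          θ' * quadw ℓ x * χ x ^ 2) * Y t x ^ 2 ≤ D * (1 + cth μ t) := by
        have a1 : -χ x ^ 2 * (Y t x * P t x) ≤ A ^ 2 * (M ^ 2 + N ^ 2) := by
          have : -(Y t x * P t x) ≤ M ^ 2 + N ^ 2 := by nlinarith [sq_nonneg (Y t x + P t x)]
          calc -χ x ^ 2 * (Y t x * P t x) = χ x ^ 2 * (-(Y t x * P t x)) := by ring
            _ ≤ χ x ^ 2 * (M ^ 2 + N ^ 2) := mul_le_mul_of_nonneg_left this (sq_nonneg _)
            _ ≤ _ := mul_le_mul_of_nonneg_right hχ2 (by positivity)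
        have a2 : 0 ≤ θ' * quadw ℓ x * χ x ^ 2 :=
          mul_nonneg (mul_nonneg_of_nonpos_of_nonpos hθ'0 hg0) (sq_nonneg _)
        have a3 : gr χ χ x ≤ B := (le_abs_self _).trans (HB x hx)
        have a4 : (gr χ χ x + 2 * cth μ t * χ x * gr χ (quadw ℓ) x -
            θ' * quadw ℓ x * χ x ^ 2) * Y t x ^ 2 ≤ (B + 2 * A * C * cth μ t) * M ^ 2 := by
          have : gr χ χ x + 2 * cth μ t * χ x * gr χ (quadw ℓ) x - θ' * quadw ℓ x * χ x ^ 2 ≤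
              B + 2 * A * C * cth μ t := by
            have := mul_le_mul_of_nonneg_left h3 (by positivity : 0 ≤ 2 * cth μ t)
            linarith
          exact (mul_le_mul_of_nonneg_right this (sq_nonneg _)).trans
            (mul_le_mul_of_nonneg_left hYM (by positivity))
        have a5 : 0 ≤ (A ^ 2 * (M ^ 2 + N ^ 2) + B * M ^ 2) * cth μ t + 2 * A * C * M ^ 2 := by
          positivity
        rw [hD]
        linarith
      rw [qdens]
      have e0 : 0 < Real.exp (cth μ t * quadw ℓ x) ^ 2 := by positivity
      calc _ ≤ Real.exp (cth μ t * quadw ℓ x) ^ 2 * (D * (1 + cth μ t)) :=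
            mul_le_mul_of_nonneg_left hbr e0.le
        _ ≤ 1 * (D * (1 + cth μ t)) := mul_le_mul_of_nonneg_right he hpos
        _ = _ := one_mul _
  · rw [setIntegral_const, smul_eq_mul]
    ring

end InteriorEstimate

section InteriorEstimate

variable {n : ℕ} {R R₁ R₂ μ b t ℓ s w C : ℝ} {Y P Z : ℝ → EuclideanSpace ℝ (Fin n) → ℝ}

/-- The error created by the cutoff is supported in the annulus. -/
theorem NiceSol.integral_sq_cutoff_error_le (h : NiceSol R μ b Y P Z) (ht : t ∈ Icc 0 b)
    (hR₁ : 0 < R₁) (h₁₂ : R₁ < R₂) (h₂R : R₂ ≤ R) (hs : R₁ ^ 2 < s) (hs₂ : s + w < R₂ ^ 2)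
    (hℓ : s + w ≤ ℓ) {θ : ℝ} (hθ : 0 ≤ θ) (hw : 0 < w)
    (H : ∀ x ∈ ball (0 : EuclideanSpace ℝ (Fin n)) R,
      (sqd 0 x ∉ Icc s (s + w) → gr (cut s w) (cut s w) x = 0 ∧ lapl (cut s w) x = 0) ∧
      |lapl (cut s w) x| ≤ C / w ^ 2) :
    ∫ x in ball 0 R, (Real.exp (θ * quadw ℓ x) * (2 * gr (ccut s w) (Y t) x +
        lapl (ccut s w) x * Y t x)) ^ 2 ≤
      8 * (∫ x in ball 0 R, gr (cut s w) (cut s w) x * gr (Y t) (Y t) x) +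
        2 * C ^ 2 / w ^ 4 * ∫ x in annulus n R₁ R₂, Y t x ^ 2 := by
  have hU : IsOpen (ball (0 : EuclideanSpace ℝ (Fin n)) R) := isOpen_ball
  have hb : Bornology.IsBounded (ball (0 : EuclideanSpace ℝ (Fin n)) R) := isBounded_ball
  have hY := h.h10Y ht
  set χ : EuclideanSpace ℝ (Fin n) → ℝ := ccut s w with hχd
  have hχ : ContDiff ℝ 2 χ := contDiff_ccut (k := 2)
  have hχ1 : ContDiff ℝ 1 χ := hχ.of_le (by norm_num)
  have hm2 : ContDiff ℝ 2 (gr (cut s w) (cut s w) : EuclideanSpace ℝ (Fin n) → ℝ) :=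
    contDiff_gr_cut
  have iY := hY.integrableOn_sq hU hb
  have hG : L2 (ball 0 R) (fun x => Real.exp (θ * quadw ℓ x) *
      (2 * gr χ (Y t) x + lapl χ x * Y t x)) := by
    have c1 : Continuous fun x : EuclideanSpace ℝ (Fin n) => Real.exp (θ * quadw ℓ x) := by
      have := (contDiff_quadw (n := n) (ℓ := ℓ) (k := 0)).continuous
      fun_prop
    exact L2.bdd_mul hU hb c1 (((hY.L2_gr_left hU hb hχ1).const_mul 2).add
      (L2.bdd_mul hU hb (continuous_lapl hχ) (hY.L2 hU hb)))
  have iG : IntegrableOn (fun x => (Real.exp (θ * quadw ℓ x) *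
      (2 * gr χ (Y t) x + lapl χ x * Y t x)) ^ 2) (ball 0 R) := hG.integrable_sq
  have im : IntegrableOn (fun x => 8 * (gr (cut s w) (cut s w) x * gr (Y t) (Y t) x))
      (ball 0 R) := (hY.integrableOn_weight_gr hY hU hb hm2.continuous).const_mul 8
  have iA : IntegrableOn ((annulus n R₁ R₂).indicator fun x => 2 * C ^ 2 / w ^ 4 * Y t x ^ 2)
      (ball 0 R) := (iY.const_mul _).indicator isOpen_annulus.measurableSet
  rw [← integral_const_mul, ← integral_indicator_annulus h₂R, ← integral_add im iA]
  refine setIntegral_mono_on iG (im.add iA) hU.measurableSet fun x hx => ?_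
  obtain ⟨b0, b2⟩ := H x hx
  have hgχ := gr_ccut_ccut (s := s) (w := w) x
  have hlχ := lapl_ccut (s := s) (w := w) x
  have hcs := gr_sq_le χ (Y t) x
  rw [hgχ] at hcs
  by_cases hx1 : sqd 0 x ∈ Icc s (s + w)
  · rw [indicator_of_mem (mem_annulus_of_sqd hR₁ h₁₂ (by linarith [hx1.1]) (by linarith [hx1.2]))]
    have hg0 : quadw ℓ x ≤ 0 := by unfold quadw; linarith [hx1.2]
    have he : Real.exp (θ * quadw ℓ x) ^ 2 ≤ 1 := pow_le_one₀ (Real.exp_pos _).le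
      (Real.exp_le_one_iff.2 (mul_nonpos_of_nonneg_of_nonpos hθ hg0))
    have h1 : lapl χ x ^ 2 ≤ C ^ 2 / w ^ 4 := by
      rw [hlχ, neg_sq, ← sq_abs]
      calc |lapl (cut s w) x| ^ 2 ≤ (C / w ^ 2) ^ 2 := by gcongr
        _ = C ^ 2 / w ^ 4 := by rw [div_pow]; ring
    have h2 := mul_le_mul_of_nonneg_right h1 (sq_nonneg (Y t x))
    rw [mul_pow]
    refine (mul_le_of_le_one_left (sq_nonneg _) he).trans ?_
    have h3 : 2 * C ^ 2 / w ^ 4 * Y t x ^ 2 = 2 * (C ^ 2 / w ^ 4 * Y t x ^ 2) := by ring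
    rw [h3]
    nlinarith [sq_nonneg (2 * gr χ (Y t) x - lapl χ x * Y t x)]
  · have h1 : gr χ (Y t) x = 0 := by
      rw [(b0 hx1).1, zero_mul] at hcs
      exact pow_eq_zero_iff two_ne_zero |>.1 (le_antisymm hcs (sq_nonneg _))
    rw [h1, hlχ, (b0 hx1).1, (b0 hx1).2]
    simpa using indicator_nonneg (fun x _ => by positivity) x

theorem hasDerivAt_sinh_sq (μ t : ℝ) :
    HasDerivAt (fun t => Real.sinh (2 * μ * t) ^ 2)
      (4 * μ * Real.sinh (2 * μ * t) * Real.cosh (2 * μ * t)) t :=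
  ((hasDerivAt_sinh_mul μ t).pow 2).congr_deriv (by push_cast; ring)

theorem cth_mul_sinh_sq :
    cth μ t * Real.sinh (2 * μ * t) ^ 2 =
      μ * Real.sinh (2 * μ * t) * Real.cosh (2 * μ * t) := by
  rw [cth]
  field_simp

/-- Bound of the weighted energy in terms of the observation. -/
theorem exists_interior_energy_le (n : ℕ) (hR₁ : 0 < R₁) (h₁₂ : R₁ < R₂) (h₂R : R₂ ≤ R) :
    ∃ C : ℝ, 0 < C ∧ ∀ w ∈ Ioc (0:ℝ) 1, ∀ s, R₁ ^ 2 < s → s + w < R₂ ^ 2 → ∀ ℓ, s + w ≤ ℓ →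
      ∀ (μ b t : ℝ) (Y P Z : ℝ → EuclideanSpace ℝ (Fin n) → ℝ), 0 < μ → t ∈ Ioo 0 b →
      NiceSol R μ b Y P Z →
      ∫ x in ball 0 R, qdens (ccut s w) (quadw ℓ) (Y t) (P t) (cth μ t)
        (-2 * μ ^ 2 / Real.sinh (2 * μ * t) ^ 2) x ≤
        C / w ^ 4 * (1 + cth μ t) * obs R₁ R₂ Y t := by
  obtain ⟨C, hC, H⟩ := exists_cut_bounds n R
  refine ⟨C ^ 2 + 8 * C, by positivity,
    fun w hw s hs hs₂ ℓ hℓ μ b t Y P Z hμ ht h => ?_⟩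
  have hw0 := hw.1
  have hR : 0 < R := by linarith
  have hsR : s + w < R ^ 2 := hs₂.trans_le (pow_le_pow_left₀ (by linarith) h₂R 2)
  have hU : IsOpen (ball (0 : EuclideanSpace ℝ (Fin n)) R) := isOpen_ball
  have hbd : Bornology.IsBounded (ball (0 : EuclideanSpace ℝ (Fin n)) R) := isBounded_ball
  set m : EuclideanSpace ℝ (Fin n) → ℝ := gr (cut s w) (cut s w) with hm
  have hm2 : ContDiff ℝ 2 m := contDiff_gr_cut
  have hm0 : ∀ x, 0 ≤ m x := gr_self_nonneg _
  set E : ℝ → ℝ := fun τ => ∫ x in ball 0 R, m x * Y τ x ^ 2 with hE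
  set O : ℝ → ℝ := fun τ => ∫ x in annulus n R₁ R₂, Y τ x ^ 2 with hO
  have hO0 : ∀ τ, 0 ≤ O τ := fun τ => integral_nonneg fun _ => sq_nonneg _
  set σ : ℝ → ℝ := fun τ => Real.sinh (2 * μ * τ) ^ 2 with hσ
  set σ' : ℝ → ℝ := fun τ => 4 * μ * Real.sinh (2 * μ * τ) * Real.cosh (2 * μ * τ) with hσ'
  set Q : ℝ → ℝ := fun τ => ∫ x in ball 0 R, qdens (ccut s w) (quadw ℓ) (Y τ) (P τ) (cth μ τ)
        (-2 * μ ^ 2 / Real.sinh (2 * μ * τ) ^ 2) x with hQ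
  have hsn : ∀ τ, 0 < τ → 0 < Real.sinh (2 * μ * τ) := fun τ hτ =>
    Real.sinh_pos_iff.2 (by positivity)
  have hσθ : ∀ τ, 0 < τ → σ' τ = 4 * (cth μ τ * σ τ) := fun τ hτ => by
    simp only [hσ, hσ']
    rw [cth_mul_sinh_sq]
    ring
  set K := σ t * (C ^ 2 + 2 * C) / w ^ 4 + 2 * σ' t * (C / w ^ 2) with hK
  have hann : ∀ τ ∈ Icc 0 b, ∀ (F : EuclideanSpace ℝ (Fin n) → ℝ) (c : ℝ), 0 ≤ c →
      Continuous F → (∀ x ∈ ball (0 : EuclideanSpace ℝ (Fin n)) R,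
        (sqd 0 x ∉ Icc s (s + w) → F x = 0) ∧ F x ≤ c) →
      ∫ x in ball 0 R, F x * Y τ x ^ 2 ≤ c * O τ := by
    intro τ hτ F c hc hF hFc
    have iY := (h.h10Y hτ).integrableOn_sq hU hbd
    rw [hO, ← integral_indicator_annulus h₂R]
    refine setIntegral_mono_on (integrableOn_bdd_mul hU hbd hF iY)
      ((iY.const_mul _).indicator isOpen_annulus.measurableSet) hU.measurableSet fun x hx => ?_
    by_cases hx1 : sqd 0 x ∈ Icc s (s + w)
    · rw [indicator_of_mem
        (mem_annulus_of_sqd hR₁ h₁₂ (by linarith [hx1.1]) (by linarith [hx1.2]))]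
      exact mul_le_mul_of_nonneg_right (hFc x hx).2 (sq_nonneg _)
    · rw [(hFc x hx).1 hx1, zero_mul]
      exact indicator_nonneg (fun x _ => by positivity) x
  have hEle : ∀ τ ∈ Icc 0 b, E τ ≤ C / w ^ 2 * O τ := fun τ hτ =>
    hann τ hτ m _ (by positivity) hm2.continuous fun x hx =>
      ⟨fun hx1 => ((H s w hw x hx).1 hx1).1, (H s w hw x hx).2.1⟩
  have hd : ∀ τ ∈ Ioc 0 t, ∃ G', HasDerivAt
      (fun τ => σ τ * Q τ + 2 * σ τ * E τ - K * obs R₁ R₂ Y τ) G' τ ∧ G' ≤ 0 := by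
    intro τ hτ
    have hτb : τ ∈ Ioo 0 b := ⟨hτ.1, hτ.2.trans_lt ht.2⟩
    have hτI := Ioo_subset_Icc_self hτb
    obtain ⟨Q', hQ', hQle⟩ := h.hasDerivAt_interior hμ hτb (contDiff_ccut (k := 2))
      (hasCompactSupport_ccut hw0 hR hsR) (tsupport_ccut_subset_ball hw0 hR hsR) hQ
    have hθ := cth_pos hμ hτ.1
    have herr := h.integral_sq_cutoff_error_le hτI hR₁ h₁₂ h₂R hs hs₂ hℓ hθ.le hw0 (C := C)
      fun x hx => ⟨fun hx1 => ⟨((H s w hw x hx).1 hx1).1, ((H s w hw x hx).1 hx1).2.1⟩,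
        (H s w hw x hx).2.2.1⟩
    have hEd := h.hasDerivAt_energy hU hbd hm2.continuous τ
    rw [h.energy_identity hτI hm2] at hEd
    have hsd := hasDerivAt_sinh_sq μ τ
    refine ⟨_, ((hsd.mul hQ').add ((hsd.const_mul 2).mul hEd)).sub
      ((h.hasDerivAt_obs τ).const_mul K), ?_⟩
    have hlap : ∫ x in ball 0 R, (lapl m x - 2 * μ ^ 2 * sqd 0 x * m x) * Y τ x ^ 2 ≤
        C / w ^ 4 * O τ := by
      refine hann τ hτI _ _ (by positivity) ?_ fun x hx => ⟨fun hx1 => ?_, ?_⟩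
      · have c1 := continuous_lapl hm2
        have c2 := hm2.continuous
        have c3 : Continuous (sqd (0 : EuclideanSpace ℝ (Fin n))) :=
          (contDiff_sqd 0 (k := 0)).continuous
        fun_prop
      · obtain ⟨h1, -, h3⟩ := (H s w hw x hx).1 hx1
        rw [hm, h1, h3]; ring
      · have h1 := (le_abs_self _).trans (H s w hw x hx).2.2.2
        have h2 : 0 ≤ 2 * μ ^ 2 * sqd 0 x * m x :=
          mul_nonneg (mul_nonneg (by positivity) (sqd_nonneg _ _)) (hm0 x)
        linarith
    set W := ∫ x in ball 0 R, m x * gr (Y τ) (Y τ) x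
    set Λ := ∫ x in ball 0 R, (lapl m x - 2 * μ ^ 2 * sqd 0 x * m x) * Y τ x ^ 2
    have hσ0 : 0 ≤ σ τ := sq_nonneg _
    have hσ'0 : 0 ≤ σ' τ := by rw [hσθ τ hτ.1]; positivity
    have hst : Real.sinh (2 * μ * τ) ≤ Real.sinh (2 * μ * t) :=
      Real.sinh_le_sinh.2 (mul_le_mul_of_nonneg_left hτ.2 (by positivity))
    have hct : Real.cosh (2 * μ * τ) ≤ Real.cosh (2 * μ * t) := by
      have h1 := hτ.1
      have h2 := ht.1
      rw [Real.cosh_le_cosh, abs_of_pos (by positivity), abs_of_pos (by positivity)]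
      exact mul_le_mul_of_nonneg_left hτ.2 (by positivity)
    have hσt : σ τ ≤ σ t := pow_le_pow_left₀ (hsn τ hτ.1).le hst 2
    have hσ't : σ' τ ≤ σ' t := by
      have := mul_le_mul hst hct (Real.cosh_pos _).le (hsn t ht.1).le
      have := mul_le_mul_of_nonneg_left this (by positivity : 0 ≤ 4 * μ)
      simp only [hσ']
      linarith
    have q1 := mul_le_mul_of_nonneg_left (hQle.trans (sub_le_sub_right
      (mul_le_mul_of_nonneg_left herr (by norm_num)) _)) hσ0
    have q2 := mul_le_mul_of_nonneg_left (hEle τ hτI) hσ'0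
    have q3 := mul_le_mul_of_nonneg_left hlap hσ0
    have q4 : σ τ * ((C ^ 2 + 2 * C) / w ^ 4 * O τ) ≤ σ t * ((C ^ 2 + 2 * C) / w ^ 4 * O τ) :=
      mul_le_mul_of_nonneg_right hσt (mul_nonneg (by positivity) (hO0 τ))
    have q5 : σ' τ * (C / w ^ 2 * O τ) ≤ σ' t * (C / w ^ 2 * O τ) :=
      mul_le_mul_of_nonneg_right hσ't (mul_nonneg (by positivity) (hO0 τ))
    have q6 := hσθ τ hτ.1
    have q7 : (C ^ 2 + 2 * C) / w ^ 4 * O τ = C ^ 2 / w ^ 4 * O τ + 2 * (C / w ^ 4 * O τ) := by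
      ring
    have q8 : 2 * C ^ 2 / w ^ 4 * O τ = 2 * (C ^ 2 / w ^ 4 * O τ) := by ring
    have q9 : K * O τ = σ t * ((C ^ 2 + 2 * C) / w ^ 4 * O τ) + 2 * (σ' t * (C / w ^ 2 * O τ)) := by
      rw [hK]; ring
    have q10 : σ' τ * Q τ = 4 * (cth μ τ * σ τ) * Q τ := by rw [q6]
    change σ' τ * Q τ + σ τ * Q' + (2 * σ' τ * E τ + 2 * σ τ * (Λ - 2 * W)) - K * O τ ≤ 0
    rw [q7] at q4
    rw [q8] at q1
    rw [q9, q7]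
    linarith
  have hanti : AntitoneOn (fun τ => σ τ * Q τ + 2 * σ τ * E τ - K * obs R₁ R₂ Y τ) (Ioc 0 t) := by
    refine antitoneOn_of_deriv_nonpos (convex_Ioc 0 t) (fun τ hτ => ?_) (fun τ hτ => ?_)
      fun τ hτ => ?_
    · obtain ⟨G', hG, -⟩ := hd τ hτ
      exact hG.continuousAt.continuousWithinAt
    · obtain ⟨G', hG, -⟩ := hd τ (interior_subset hτ)
      exact hG.differentiableAt.differentiableWithinAt
    · obtain ⟨G', hG, hG0⟩ := hd τ (interior_subset hτ)
      rw [hG.deriv]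
      exact hG0
  obtain ⟨D, hD0, hD⟩ := h.exists_integral_qdens_interior_le hμ hw0 hℓ
  have hK0 : 0 ≤ K := by
    have h1 : 0 ≤ σ' t := by rw [hσθ t ht.1]; have := cth_pos hμ ht.1; positivity
    positivity
  have hlim : σ t * Q t + 2 * σ t * E t - K * obs R₁ R₂ Y t ≤ 0 := by
    have hcE : Continuous E := h.continuous_energy hU hbd hm2.continuous
    have hT : Tendsto (fun τ => D * (σ τ + μ * Real.sinh (2 * μ * τ) * Real.cosh (2 * μ * τ)) +
        2 * σ τ * E τ) (nhdsWithin 0 (Ioi 0)) (nhds 0) := by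
      have hc : Continuous fun τ => D * (σ τ + μ * Real.sinh (2 * μ * τ) *
          Real.cosh (2 * μ * τ)) + 2 * σ τ * E τ := by
        have := Real.continuous_sinh
        have := Real.continuous_cosh
        fun_prop
      have := hc.tendsto 0
      simp only [hσ, mul_zero, Real.sinh_zero, zero_mul, add_zero, ne_eq, OfNat.ofNat_ne_zero,
        not_false_eq_true, zero_pow] at this
      exact this.mono_left nhdsWithin_le_nhds
    refine ge_of_tendsto hT ?_
    filter_upwards [Ioo_mem_nhdsGT ht.1] with τ hτ
    refine (hanti ⟨hτ.1, hτ.2.le⟩ ⟨ht.1, le_rfl⟩ hτ.2.le).trans ?_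
    have h1 := mul_le_mul_of_nonneg_left (hD τ ⟨hτ.1, hτ.2.trans ht.2⟩) (sq_nonneg _ : 0 ≤ σ τ)
    have h2 : 0 ≤ K * obs R₁ R₂ Y τ := mul_nonneg hK0 (obs_nonneg hτ.1.le)
    have h3 : cth μ τ * σ τ = _ := cth_mul_sinh_sq
    have h4 : σ τ * (D * (1 + cth μ τ)) = D * (σ τ + cth μ τ * σ τ) := by ring
    rw [h4, h3] at h1
    linarith
  have hE0 : 0 ≤ E t := integral_nonneg fun x => mul_nonneg (hm0 x) (sq_nonneg _)
  have hσt0 : 0 < σ t := pow_pos (hsn t ht.1) 2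
  have hθ := cth_pos hμ ht.1
  have hobs : 0 ≤ obs R₁ R₂ Y t := obs_nonneg ht.1.le
  have hKle : K ≤ σ t * ((C ^ 2 + 8 * C) / w ^ 4 * (1 + cth μ t)) := by
    have h1 : C / w ^ 2 ≤ C / w ^ 4 :=
      div_le_div_of_nonneg_left hC.le (by positivity)
        (pow_le_pow_of_le_one hw0.le hw.2 (by norm_num))
    have h2 := mul_le_mul_of_nonneg_left h1 (by positivity : 0 ≤ 8 * (cth μ t * σ t))
    have h3 : 0 ≤ σ t * (6 * C + C ^ 2 * cth μ t) / w ^ 4 := by positivity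
    rw [hK, hσθ t ht.1]
    have e : σ t * ((C ^ 2 + 8 * C) / w ^ 4 * (1 + cth μ t)) =
      σ t * (C ^ 2 + 2 * C) / w ^ 4 + 8 * (cth μ t * σ t) * (C / w ^ 4) +
      σ t * (6 * C + C ^ 2 * cth μ t) / w ^ 4 := by ring
    rw [e]
    linarith
  have h1 := mul_le_mul_of_nonneg_right hKle hobs
  have h2 : 0 ≤ 2 * σ t * E t := by positivity
  have h3 : σ t * Q t ≤ σ t * ((C ^ 2 + 8 * C) / w ^ 4 * (1 + cth μ t) * obs R₁ R₂ Y t) := by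
    linarith
  exact le_of_mul_le_mul_left h3 hσt0

end InteriorEstimate

section InteriorEstimate

variable {n : ℕ} {R R₁ R₂ : ℝ}

/-- Sharp estimate of the interior mass. -/
theorem exists_interior_estimate (hn : 2 ≤ n) (hR₁ : 0 < R₁) (h₁₂ : R₁ < R₂) (h₂R : R₂ ≤ R) :
    ∃ C : ℝ, 0 < C ∧ ∀ w ∈ Ioc (0:ℝ) 1, ∀ s, R₁ ^ 2 < s → s + w < R₂ ^ 2 → ∀ ℓ, s + w ≤ ℓ →
      ∀ (μ b t : ℝ) (Y P Z : ℝ → EuclideanSpace ℝ (Fin n) → ℝ), 0 < μ → t ∈ Ioo 0 b →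
      NiceSol R μ b Y P Z → 2 * μ ^ 2 * ℓ * R ^ 2 ≤ Real.sinh (2 * μ * t) ^ 2 →
      ∫ x in ball 0 R, ccut s w x ^ 2 * Y t x ^ 2 ≤
        C / w ^ 4 * (1 + cth μ t) * Real.exp (cth μ t * ℓ) * obs R₁ R₂ Y t := by
  obtain ⟨C, hC, H⟩ := exists_interior_energy_le n hR₁ h₁₂ h₂R
  have hR : 0 < R := by linarith
  refine ⟨2 * R ^ 2 * C, by positivity,
    fun w hw s hs hs₂ ℓ hℓ μ b t Y P Z hμ ht h hsinh => ?_⟩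
  have hU : IsOpen (ball (0 : EuclideanSpace ℝ (Fin n)) R) := isOpen_ball
  have hb : Bornology.IsBounded (ball (0 : EuclideanSpace ℝ (Fin n)) R) := isBounded_ball
  have htI := Ioo_subset_Icc_self ht
  have hsn : 0 < Real.sinh (2 * μ * t) := Real.sinh_pos_iff.2 (mul_pos (by linarith) ht.1)
  have hθ := cth_pos hμ ht.1
  have hχ : ContDiff ℝ 2 (ccut s w : EuclideanSpace ℝ (Fin n) → ℝ) := contDiff_ccut (k := 2)
  have hg : ContDiff ℝ 2 (quadw ℓ : EuclideanSpace ℝ (Fin n) → ℝ) := contDiff_quadw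
  have key := H w hw s hs hs₂ ℓ hℓ μ b t Y P Z hμ ht h
  rw [h.integral_qdens htI hχ hg] at key
  simp only [ppot_quadw hsn.ne'] at key
  set θ := cth μ t with hθd
  set f : EuclideanSpace ℝ (Fin n) → ℝ := fun z => wt (ccut s w) (quadw ℓ) θ z * Y t z with hf
  have hY := h.h10Y htI
  have hfH : H10 (ball 0 R) f := hY.mul hU hb (contDiff_wt hχ hg θ)
  have if2 := hfH.integrableOn_sq hU hb
  have igr := hfH.integrableOn_gr hfH
  set κ := μ ^ 2 * ℓ / Real.sinh (2 * μ * t) ^ 2 with hκ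
  have hκR : κ * R ^ 2 ≤ 1 / 2 := by
    rw [hκ, div_mul_eq_mul_div, div_le_iff₀ (by positivity)]
    linarith
  have hP := hfH.poincare hn
  have e1 : ∫ x in ball 0 R, (gr f f x - κ * f x ^ 2) =
      (∫ x in ball 0 R, gr f f x) - κ * ∫ x in ball 0 R, f x ^ 2 := by
    rw [integral_sub igr (if2.const_mul κ), integral_const_mul]
  have h0 : 0 ≤ ∫ x in ball 0 R, f x ^ 2 := integral_nonneg fun _ => sq_nonneg _
  have hmass : ∫ x in ball 0 R, f x ^ 2 ≤ 2 * R ^ 2 * (C / w ^ 4 * (1 + θ) * obs R₁ R₂ Y t) := by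
    have h1 := mul_le_mul_of_nonneg_left (e1 ▸ key) (by positivity : 0 ≤ 2 * R ^ 2)
    have h2 := mul_le_mul_of_nonneg_right hκR h0
    linarith
  have hχY : IntegrableOn (fun x => ccut s w x ^ 2 * Y t x ^ 2) (ball 0 R) :=
    integrableOn_bdd_mul hU hb (hχ.continuous.pow 2) (hY.integrableOn_sq hU hb)
  calc ∫ x in ball 0 R, ccut s w x ^ 2 * Y t x ^ 2
      ≤ ∫ x in ball 0 R, Real.exp (θ * ℓ) * f x ^ 2 := by
        refine setIntegral_mono_on hχY (if2.const_mul _) hU.measurableSet fun x _ => ?_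
        have e : Real.exp (θ * ℓ) * f x ^ 2 =
            Real.exp (θ * sqd 0 x) * (ccut s w x ^ 2 * Y t x ^ 2) := by
          simp only [hf, wt, mul_pow, ← Real.exp_nat_mul]
          rw [show θ * sqd 0 x = θ * ℓ + ((2:ℕ):ℝ) * (θ * quadw ℓ x) by
            rw [quadw]; push_cast; ring, Real.exp_add]
          ring
        rw [e]
        exact le_mul_of_one_le_left (by positivity)
          (Real.one_le_exp (mul_nonneg hθ.le (sqd_nonneg _ _)))
    _ = Real.exp (θ * ℓ) * ∫ x in ball 0 R, f x ^ 2 := integral_const_mul _ _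
    _ ≤ Real.exp (θ * ℓ) * (2 * R ^ 2 * (C / w ^ 4 * (1 + θ) * obs R₁ R₂ Y t)) :=
        mul_le_mul_of_nonneg_left hmass (Real.exp_pos _).le
    _ = _ := by ring

theorem cth_le {μ t : ℝ} (hμ : 0 < μ) (ht : 0 < t) : cth μ t ≤ μ + 1 / (2 * t) := by
  have hs : 0 < Real.sinh (2 * μ * t) := Real.sinh_pos_iff.2 (by positivity)
  have h1 : 2 * μ * t ≤ Real.sinh (2 * μ * t) := Real.self_le_sinh_iff.2 (by positivity)
  have h2 : Real.cosh (2 * μ * t) ≤ Real.sinh (2 * μ * t) + 1 := by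
    have := Real.cosh_sub_sinh (2 * μ * t)
    have h3 : Real.exp (-(2 * μ * t)) ≤ 1 := Real.exp_le_one_iff.2 (by
      have : 0 < 2 * μ * t := by positivity
      linarith)
    linarith
  rw [cth, div_le_iff₀ hs]
  have h3 : μ ≤ 1 / (2 * t) * Real.sinh (2 * μ * t) := by
    rw [div_mul_eq_mul_div, le_div_iff₀ (by positivity)]
    linarith
  nlinarith

end InteriorEstimate

section Assembly

variable {n : ℕ} {R R₁ R₂ : ℝ}

theorem exp_div_four_le_sinh {z : ℝ} (hz : 1 ≤ z) : Real.exp z / 4 ≤ Real.sinh z := by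
  rw [Real.sinh_eq]
  have h1 : Real.exp (-z) ≤ 1 := Real.exp_le_one_iff.2 (by linarith)
  have h2 := Real.add_one_le_exp z
  linarith

/-- In the regime of large `μ` the potential created by the conjugation is small. -/
theorem exists_sinh_threshold {β : ℝ} (hβ : 1 < β) {D : ℝ} (hD : 0 < D) :
    ∃ K : ℝ, 1 ≤ K ∧ ∀ μ t : ℝ, 0 < μ → 0 < t → t ≤ 1 → K ≤ μ * t ^ β →
      D * μ ≤ Real.sinh (2 * μ * t) := by
  have hβ0 : 0 < β - 1 := by linarith
  obtain ⟨N, hN⟩ := exists_nat_ge (β / (β - 1))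
  set M : ℝ := 4 * N.factorial * D with hM
  have hM0 : 0 < M := by positivity
  refine ⟨max 1 (M ^ (β - 1)), le_max_left _ _, fun μ t hμ ht ht1 hK => ?_⟩
  have htβ : t ^ β ≤ t := by
    simpa using Real.rpow_le_rpow_of_exponent_ge ht ht1 hβ.le
  have h1 : 1 ≤ μ * t := ((le_max_left _ _).trans hK).trans (mul_le_mul_of_nonneg_left htβ hμ.le)
  have h0 : 0 < μ * t := by positivity
  have h2 : M * μ ≤ (μ * t) ^ N := by
    have h3 : (μ * t) ^ (β / (β - 1)) ≤ (μ * t) ^ N := by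
      rw [← Real.rpow_natCast]
      exact Real.rpow_le_rpow_of_exponent_le h1 hN
    refine le_trans ?_ h3
    have e1 : (μ * t) ^ (β / (β - 1)) = (μ * t ^ β) ^ (1 / (β - 1)) * μ := by
      have htb : 0 < t ^ β := Real.rpow_pos_of_pos ht _
      rw [Real.mul_rpow hμ.le ht.le, Real.mul_rpow hμ.le htb.le, ← Real.rpow_mul ht.le,
        mul_one_div]
      have : μ ^ (β / (β - 1)) = μ ^ (1 / (β - 1)) * μ := by
        nth_rw 3 [← Real.rpow_one μ]
        rw [← Real.rpow_add hμ]
        congr 1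
        field_simp
        ring
      rw [this]
      ring
    rw [e1]
    refine mul_le_mul_of_nonneg_right ?_ hμ.le
    have h4 : (M ^ (β - 1)) ^ (1 / (β - 1)) = M := by
      rw [← Real.rpow_mul hM0.le, mul_one_div, div_self hβ0.ne', Real.rpow_one]
    rw [← h4]
    exact Real.rpow_le_rpow (by positivity) ((le_max_right _ _).trans hK) (by positivity)
  have h5 : (μ * t) ^ N / N.factorial ≤ Real.exp (2 * μ * t) := by
    refine (Real.pow_div_factorial_le_exp (μ * t) h0.le N).trans (Real.exp_le_exp.2 ?_)
    linarith
  have h6 := exp_div_four_le_sinh (z := 2 * μ * t) (by linarith)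
  have h7 : 4 * D * μ ≤ (μ * t) ^ N / N.factorial := by
    rw [le_div_iff₀ (by positivity)]
    calc _ = M * μ := by rw [hM]; ring
      _ ≤ _ := h2
  linarith

theorem NiceSol.obs_mono {μ b : ℝ} {Y P Z : ℝ → EuclideanSpace ℝ (Fin n) → ℝ}
    (h : NiceSol R μ b Y P Z) : Monotone (obs R₁ R₂ Y) :=
  monotone_of_deriv_nonneg (fun t => (h.hasDerivAt_obs t).differentiableAt) fun t => by
    rw [(h.hasDerivAt_obs t).deriv]
    exact integral_nonneg fun _ => sq_nonneg _

set_option maxHeartbeats 1000000 in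
/-- Observability for regular solutions on short time intervals. -/
theorem NiceSol.exists_observability (hn : 2 ≤ n) (hR₁ : 0 < R₁) (h₁₂ : R₁ < R₂) (h₂R : R₂ ≤ R) :
    ∃ c : ℝ, 0 < c ∧ ∀ β : ℝ, 1 < β → ∃ A : ℝ, 0 < A ∧ ∀ μ : ℝ, 0 < μ → ∀ ε ∈ Ioc (0:ℝ) 1,
      ∀ (b t : ℝ) (Y P Z : ℝ → EuclideanSpace ℝ (Fin n) → ℝ), t ∈ Ioo 0 b → t ≤ 1 →
      NiceSol R μ b Y P Z →
      ∫ x in ball 0 R, Y t x ^ 2 ≤ (c / ε ^ 6) * (1 + μ) * Real.exp (μ * (R₁ + ε) ^ 2) *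
        Real.exp (A / t ^ β) * obs R₁ R₂ Y t := by
  have hR : 0 < R := by linarith
  obtain ⟨Cr, hCr, Hr⟩ := exists_rough_estimate (by omega : 0 < n) hR₁ h₁₂ h₂R
  obtain ⟨Ce, hCe, He⟩ := exists_exterior_estimate n hR₁ h₁₂ h₂R
  obtain ⟨Ci, hCi, Hi⟩ := exists_interior_estimate hn hR₁ h₁₂ h₂R
  have hgap : 0 < R₂ ^ 2 - R₁ ^ 2 := by nlinarith
  set w₀ : ℝ := min 1 (min (R₁ / 2) ((R₂ ^ 2 - R₁ ^ 2) / 4)) with hw₀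
  have hw00 : 0 < w₀ := by positivity
  have hw01 : w₀ ≤ 1 := min_le_left _ _
  have hw02 : w₀ ≤ R₁ / 2 := (min_le_right _ _).trans (min_le_left _ _)
  have hw03 : w₀ ≤ (R₂ ^ 2 - R₁ ^ 2) / 4 := (min_le_right _ _).trans (min_le_right _ _)
  refine ⟨Cr + Ce / w₀ ^ 4 + Ci / w₀ ^ 4, by positivity, fun β hβ => ?_⟩
  obtain ⟨K₀, hK₀, hK₀s⟩ := exists_sinh_threshold hβ (D := 2 * R ^ 2) (by positivity)
  set K := max K₀ (Cr / R₁ ^ 2) with hK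
  have hK1 : 1 ≤ K := hK₀.trans (le_max_left _ _)
  set A := R ^ 2 + 1 + 2 * Cr + Cr * (1 + K) with hA
  refine ⟨A, by positivity, fun μ hμ ε hε b t Y P Z ht ht1 h => ?_⟩
  have hε0 := hε.1
  have ht0 := ht.1
  have htb : 0 < t ^ β := Real.rpow_pos_of_pos ht0 _
  have htβ : t ^ β ≤ t := by
    simpa using Real.rpow_le_rpow_of_exponent_ge ht0 ht1 hβ.le
  have hinv : 1 / t ≤ 1 / t ^ β := one_div_le_one_div_of_le htb htβ
  have hobs : 0 ≤ obs R₁ R₂ Y t := obs_nonneg ht0.le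
  set L := Real.exp (μ * (R₁ + ε) ^ 2) with hL
  have hL1 : 1 ≤ L := Real.one_le_exp (by positivity)
  set X := Real.exp (A / t ^ β) with hX
  have hX1 : 1 ≤ X := Real.one_le_exp (by positivity)
  have hε6 : 1 ≤ 1 / ε ^ 6 := (one_le_div (by positivity)).2 (pow_le_one₀ hε0.le hε.2)
  set B := 1 / ε ^ 6 * (1 + μ) * L * X with hB
  have hXB : X ≤ B := by
    have h1 : 1 ≤ 1 / ε ^ 6 * (1 + μ) * L :=
      one_le_mul_of_one_le_of_one_le (one_le_mul_of_one_le_of_one_le hε6 (by linarith)) hL1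
    exact le_mul_of_one_le_left (by positivity) h1
  have hB0 : 0 ≤ B := by positivity
  have hexpX : ∀ z, z ≤ A * (1 / t ^ β) → Real.exp z ≤ X := fun z hz =>
    Real.exp_le_exp.2 (hz.trans_eq (by ring))
  have hgoal : ∀ F, ∫ x in ball 0 R, Y t x ^ 2 ≤ F * obs R₁ R₂ Y t →
      F ≤ (Cr + Ce / w₀ ^ 4 + Ci / w₀ ^ 4) * B → ∫ x in ball 0 R, Y t x ^ 2 ≤
        ((Cr + Ce / w₀ ^ 4 + Ci / w₀ ^ 4) / ε ^ 6) * (1 + μ) * L * X * obs R₁ R₂ Y t := by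
    intro F h1 h2
    refine (h1.trans (mul_le_mul_of_nonneg_right h2 hobs)).trans_eq ?_
    rw [hB]
    ring
  have hAp : 0 ≤ 1 / t ^ β := by positivity
  have hce : 0 ≤ Ce / w₀ ^ 4 * B := by positivity
  have hci : 0 ≤ Ci / w₀ ^ 4 * B := by positivity
  rcases lt_or_ge (μ * t ^ β) K with hsmall | hlarge
  · refine hgoal _ (Hr μ t Y P Z hμ.le ⟨ht0, ht1⟩ (h.mono ht.2.le)) ?_
    have h1 : μ ≤ K * (1 / t ^ β) := by
      rw [mul_one_div, le_div_iff₀ htb]; exact hsmall.le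
    have h2 : Real.exp (Cr * (1 / t + μ)) ≤ X := by
      refine hexpX _ ?_
      have h3 : Cr * (1 / t + μ) ≤ Cr * (1 / t ^ β + K * (1 / t ^ β)) :=
        mul_le_mul_of_nonneg_left (add_le_add hinv h1) hCr.le
      have h4 : 0 ≤ (R ^ 2 + 1 + 2 * Cr) * (1 / t ^ β) := by positivity
      rw [hA]
      linarith
    have h5 := mul_le_mul_of_nonneg_left (h2.trans hXB) hCr.le
    linarith
  · have hU : IsOpen (ball (0 : EuclideanSpace ℝ (Fin n)) R) := isOpen_ball
    have hb : Bornology.IsBounded (ball (0 : EuclideanSpace ℝ (Fin n)) R) := isBounded_ball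
    set w := w₀ * ε with hw
    have hw0 : 0 < w := by positivity
    have hwle : w ≤ w₀ := mul_le_of_le_one_right hw00.le hε.2
    have hw1 : w ≤ 1 := hwle.trans hw01
    set s := R₁ ^ 2 + w with hs
    have hsw : s + w < R₂ ^ 2 := by linarith
    set ℓ := s + w with hℓ
    have hℓR : ℓ ≤ R ^ 2 := hsw.le.trans (pow_le_pow_left₀ (by linarith) h₂R 2)
    have hℓε : ℓ ≤ (R₁ + ε) ^ 2 := by
      have : w ≤ R₁ / 2 * ε := mul_le_mul_of_nonneg_right hw02 hε0.le
      nlinarith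
    have hℓ0 : 0 < ℓ := by positivity
    have hsinh : 2 * μ ^ 2 * ℓ * R ^ 2 ≤ Real.sinh (2 * μ * t) ^ 2 := by
      have h1 := hK₀s μ t hμ ht0 ht1 ((le_max_left _ _).trans hlarge)
      have h2 := pow_le_pow_left₀ (by positivity) h1 2
      refine le_trans ?_ h2
      have h3 : 2 * μ ^ 2 * ℓ * R ^ 2 ≤ 2 * μ ^ 2 * R ^ 2 * R ^ 2 := by gcongr
      nlinarith [sq_nonneg (μ * R ^ 2)]
    have hint := Hi w ⟨hw0, hw1⟩ s (by linarith) hsw ℓ le_rfl μ b t Y P Z hμ ht h hsinh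
    have hext := He w ⟨hw0, hw1⟩ (by linarith) μ t Y P Z ht0 (h.mono ht.2.le)
    have hrough := Hr μ (t / 2) Y P Z hμ.le ⟨by linarith, by linarith⟩ (h.mono (by linarith [ht.2]))
    have hobs2 : obs R₁ R₂ Y (t / 2) ≤ obs R₁ R₂ Y t := h.obs_mono (by linarith)
    have iY := (h.h10Y (Ioo_subset_Icc_self ht)).integrableOn_sq hU hb
    have i1 : IntegrableOn (fun x => ccut s w x ^ 2 * Y t x ^ 2) (ball 0 R) :=
      integrableOn_bdd_mul hU hb ((contDiff_ccut (k := 0)).continuous.pow 2) iY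
    have i2 : IntegrableOn (fun x => cut (R₁ ^ 2 + w / 2) (w / 2) x * Y t x ^ 2) (ball 0 R) :=
      integrableOn_bdd_mul hU hb (contDiff_cut (k := 0)).continuous iY
    have hsplit : ∫ x in ball 0 R, Y t x ^ 2 ≤ (∫ x in ball 0 R, ccut s w x ^ 2 * Y t x ^ 2) +
        ∫ x in ball 0 R, cut (R₁ ^ 2 + w / 2) (w / 2) x * Y t x ^ 2 := by
      rw [← integral_add i1 i2]
      refine setIntegral_mono_on iY (i1.add i2) hU.measurableSet fun x _ => ?_
      rw [← add_mul]
      refine le_mul_of_one_le_left (sq_nonneg _) ?_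
      have hc0 : 0 ≤ cut (R₁ ^ 2 + w / 2) (w / 2) x := Real.smoothTransition.nonneg _
      rcases le_total (sqd 0 x) s with hx | hx
      · rw [ccut, cut_eq_zero hw0 hx]
        linarith
      · rw [cut_eq_one (half_pos hw0) (by linarith)]
        linarith [sq_nonneg (ccut s w x)]
    have hw4 : 1 / w ^ 4 ≤ 1 / w₀ ^ 4 * (1 / ε ^ 6) := by
      rw [hw, mul_pow, one_div_mul_one_div]
      refine one_div_le_one_div_of_le (by positivity) ?_
      exact mul_le_mul_of_nonneg_left (pow_le_pow_of_le_one hε0.le hε.2 (by norm_num))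
        (by positivity)
    have hw2 : 1 / w ^ 2 ≤ 1 / w₀ ^ 4 * (1 / ε ^ 6) :=
      (one_div_le_one_div_of_le (by positivity)
        (pow_le_pow_of_le_one hw0.le hw1 (by norm_num))).trans hw4
    have hθ := cth_pos hμ ht0
    have hθle := cth_le hμ ht0
    have hI : Ci / w ^ 4 * (1 + cth μ t) * Real.exp (cth μ t * ℓ) ≤ Ci / w₀ ^ 4 * B := by
      have h1 : 1 + cth μ t ≤ (1 + μ) * Real.exp (1 / (2 * t)) := by
        have h2 := Real.add_one_le_exp (1 / (2 * t))
        have h3 : 0 < 1 / (2 * t) := by positivity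
        nlinarith
      have h2 : Real.exp (cth μ t * ℓ) ≤ L * Real.exp (ℓ / (2 * t)) := by
        rw [hL, ← Real.exp_add]
        refine Real.exp_le_exp.2 ?_
        have h3 := mul_le_mul_of_nonneg_right hθle hℓ0.le
        have h4 := mul_le_mul_of_nonneg_left hℓε hμ.le
        have h5 : (μ + 1 / (2 * t)) * ℓ = μ * ℓ + ℓ / (2 * t) := by ring
        linarith
      have h3 : Real.exp (1 / (2 * t)) * Real.exp (ℓ / (2 * t)) ≤ X := by
        rw [← Real.exp_add]
        refine hexpX _ ?_
        have e : 1 / (2 * t) + ℓ / (2 * t) = (1 + ℓ) / 2 * (1 / t) := by field_simp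
        rw [e]
        have h4 : (1 + ℓ) / 2 * (1 / t) ≤ A * (1 / t) := by
          refine mul_le_mul_of_nonneg_right ?_ (by positivity)
          have : 0 ≤ Cr * (1 + K) := by positivity
          rw [hA]
          linarith
        exact h4.trans (mul_le_mul_of_nonneg_left hinv (by positivity))
      calc Ci / w ^ 4 * (1 + cth μ t) * Real.exp (cth μ t * ℓ)
          = Ci * (1 / w ^ 4) * (1 + cth μ t) * Real.exp (cth μ t * ℓ) := by ring
        _ ≤ Ci * (1 / w₀ ^ 4 * (1 / ε ^ 6)) * ((1 + μ) * Real.exp (1 / (2 * t))) *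
            (L * Real.exp (ℓ / (2 * t))) := by gcongr
        _ = Ci * (1 / w₀ ^ 4 * (1 / ε ^ 6)) * (1 + μ) * L *
            (Real.exp (1 / (2 * t)) * Real.exp (ℓ / (2 * t))) := by ring
        _ ≤ Ci * (1 / w₀ ^ 4 * (1 / ε ^ 6)) * (1 + μ) * L * X := by gcongr
        _ = _ := by rw [hB]; ring
    have hE2 : Ce / w ^ 2 ≤ Ce / w₀ ^ 4 * B := by
      calc Ce / w ^ 2 = Ce * (1 / w ^ 2) := by ring
        _ ≤ Ce * (1 / w₀ ^ 4 * (1 / ε ^ 6)) := mul_le_mul_of_nonneg_left hw2 hCe.le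
        _ = Ce / w₀ ^ 4 * (1 / ε ^ 6) := by ring
        _ ≤ Ce / w₀ ^ 4 * B := by
          refine mul_le_mul_of_nonneg_left ?_ (by positivity)
          have h1 : 1 ≤ (1 + μ) * L * X :=
            one_le_mul_of_one_le_of_one_le (one_le_mul_of_one_le_of_one_le (by linarith) hL1) hX1
          calc 1 / ε ^ 6 ≤ 1 / ε ^ 6 * ((1 + μ) * L * X) :=
                le_mul_of_one_le_right (by positivity) h1
            _ = B := by rw [hB]; ring
    have hE1 : Real.exp (-(μ ^ 2 * R₁ ^ 2 * t)) * (Cr * Real.exp (Cr * (1 / (t / 2) + μ))) ≤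
        Cr * B := by
      have h1 : Real.exp (-(μ ^ 2 * R₁ ^ 2 * t)) * Real.exp (Cr * (1 / (t / 2) + μ)) ≤ X := by
        rw [← Real.exp_add]
        refine hexpX _ ?_
        have h2 : Cr / R₁ ^ 2 ≤ μ * t :=
          ((le_max_right _ _).trans hlarge).trans (mul_le_mul_of_nonneg_left htβ hμ.le)
        rw [div_le_iff₀ (by positivity)] at h2
        have h3 := mul_le_mul_of_nonneg_left h2 hμ.le
        have h4 := mul_le_mul_of_nonneg_left hinv (by positivity : 0 ≤ 2 * Cr)
        have h5 : 0 ≤ (R ^ 2 + 1 + Cr * (1 + K)) * (1 / t ^ β) := by positivity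
        have h6 : Cr * (1 / (t / 2) + μ) = 2 * Cr * (1 / t) + μ * Cr := by
          field_simp
        rw [h6, hA]
        linarith
      calc _ = Cr * (Real.exp (-(μ ^ 2 * R₁ ^ 2 * t)) * Real.exp (Cr * (1 / (t / 2) + μ))) := by
            ring
        _ ≤ Cr * B := mul_le_mul_of_nonneg_left (h1.trans hXB) hCr.le
    refine hgoal (Ci / w ^ 4 * (1 + cth μ t) * Real.exp (cth μ t * ℓ) +
      (Real.exp (-(μ ^ 2 * R₁ ^ 2 * t)) * (Cr * Real.exp (Cr * (1 / (t / 2) + μ))) + Ce / w ^ 2))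
      ?_ (by linarith)
    have h1 := mul_le_mul_of_nonneg_left (hrough.trans (mul_le_mul_of_nonneg_left hobs2
      (by positivity : 0 ≤ Cr * Real.exp (Cr * (1 / (t / 2) + μ)))))
      (Real.exp_pos (-(μ ^ 2 * R₁ ^ 2 * t))).le
    linarith

end Assembly

section ParametricIntegral

variable {n : ℕ} {U : Set (EuclideanSpace ℝ (Fin n))} {k : Set ℝ}
  {G : ℝ → EuclideanSpace ℝ (Fin n) → ℝ} {V : Set (ℝ × EuclideanSpace ℝ (Fin n))}

theorem hasFDerivAt_slice (hV : IsOpen V)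
    (hG : ContDiffOn ℝ (⊤ : ℕ∞) (fun p : ℝ × EuclideanSpace ℝ (Fin n) => G p.1 p.2) V)
    {s : ℝ} {x : EuclideanSpace ℝ (Fin n)} (hx : (s, x) ∈ V) :
    HasFDerivAt (G s) ((fderiv ℝ (fun p : ℝ × EuclideanSpace ℝ (Fin n) => G p.1 p.2) (s, x)).comp
      (ContinuousLinearMap.inr ℝ ℝ (EuclideanSpace ℝ (Fin n)))) x := by
  have h1 := ((hG.contDiffAt (hV.mem_nhds hx)).differentiableAt (by simp)).hasFDerivAt
  exact h1.comp x (hasFDerivAt_prodMk_right s x)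

theorem contDiffOn_pd_slice (hV : IsOpen V)
    (hG : ContDiffOn ℝ (⊤ : ℕ∞) (fun p : ℝ × EuclideanSpace ℝ (Fin n) => G p.1 p.2) V)
    (i : Fin n) :
    ContDiffOn ℝ (⊤ : ℕ∞) (fun p : ℝ × EuclideanSpace ℝ (Fin n) => pd i (G p.1) p.2) V := by
  have h1 := (hG.fderiv_of_isOpen hV (m := (⊤ : ℕ∞)) (by simp)).clm_apply
    (contDiffOn_const (c := ((0:ℝ), EuclideanSpace.single i (1:ℝ))))
  refine h1.congr fun p hp => ?_
  rw [pd, (hasFDerivAt_slice hV hG hp).fderiv]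
  simp

theorem contDiffOn_integral_param (hU : IsOpen U) (hk : IsCompact k)
    (hG : ContDiffOn ℝ (⊤ : ℕ∞) (fun p : ℝ × EuclideanSpace ℝ (Fin n) => G p.1 p.2) (univ ×ˢ U))
    (h0 : ∀ s ∉ k, ∀ x ∈ U, G s x = 0) : ContDiffOn ℝ (⊤ : ℕ∞) (fun x => ∫ s, G s x) U := by
  have key := contDiffOn_convolution_right_with_param_comp (n := (⊤ : ℕ∞)) (μ := volume)
    (ContinuousLinearMap.lsmul ℝ ℝ) (v := fun _ : EuclideanSpace ℝ (Fin n) => (0:ℝ))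
    contDiffOn_const (f := fun _ : ℝ => (1:ℝ)) (g := fun x r => G (-r) x) (k := -k) hU hk.neg
    (fun x r hx hr => h0 _ (by simpa using hr) x hx) (locallyIntegrable_const _) ?_
  · refine key.congr fun x _ => ?_
    simp [convolution]
  · exact hG.comp (g := fun p : ℝ × EuclideanSpace ℝ (Fin n) => G p.1 p.2)
      (f := fun q : EuclideanSpace ℝ (Fin n) × ℝ => (-q.2, q.1))
      (contDiff_snd.neg.prodMk contDiff_fst).contDiffOn fun q hq => ⟨mem_univ _, hq.1⟩

theorem pd_integral_param (hU : IsOpen U) (hk : IsCompact k)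
    (hG : ContDiffOn ℝ (⊤ : ℕ∞) (fun p : ℝ × EuclideanSpace ℝ (Fin n) => G p.1 p.2) (univ ×ˢ U))
    (h0 : ∀ s ∉ k, ∀ x ∈ U, G s x = 0) (i : Fin n) {x : EuclideanSpace ℝ (Fin n)} (hx : x ∈ U) :
    pd i (fun x => ∫ s, G s x) x = ∫ s, pd i (G s) x := by
  have hV : IsOpen ((univ : Set ℝ) ×ˢ U) := isOpen_univ.prod hU
  set D : ℝ → EuclideanSpace ℝ (Fin n) → EuclideanSpace ℝ (Fin n) →L[ℝ] ℝ := fun s x =>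
    (fderiv ℝ (fun p : ℝ × EuclideanSpace ℝ (Fin n) => G p.1 p.2) (s, x)).comp
      (ContinuousLinearMap.inr ℝ ℝ (EuclideanSpace ℝ (Fin n))) with hD
  have hDd : ∀ s, ∀ z ∈ U, HasFDerivAt (G s) (D s z) z := fun s z hz =>
    hasFDerivAt_slice hV hG ⟨mem_univ _, hz⟩
  have hDc : ContinuousOn (fun p : ℝ × EuclideanSpace ℝ (Fin n) => D p.1 p.2) (univ ×ˢ U) :=
    (hG.fderiv_of_isOpen hV (m := (⊤ : ℕ∞)) (by simp)).continuousOn.clm_comp continuousOn_const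
  have hslice : ∀ z ∈ U, Continuous fun s => G s z := fun z hz =>
    hG.continuousOn.comp_continuous (f := fun s : ℝ => (s, z)) (by fun_prop)
      fun s => ⟨mem_univ _, hz⟩
  have hDslice : Continuous fun s => D s x :=
    hDc.comp_continuous (f := fun s : ℝ => (s, x)) (by fun_prop) fun s => ⟨mem_univ _, hx⟩
  have hsupp : ∀ z ∈ U, HasCompactSupport fun s => G s z := fun z hz =>
    HasCompactSupport.intro hk fun s hs => h0 s hs z hz
  have hD0 : ∀ s ∉ k, ∀ z ∈ U, D s z = 0 := fun s hs z hz => by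
    rw [← (hDd s z hz).fderiv]
    have h1 : G s =ᶠ[nhds z] fun _ => 0 := by
      filter_upwards [hU.mem_nhds hz] with w hw using h0 s hs w hw
    rw [h1.fderiv_eq]
    simp
  obtain ⟨δ, hδ, hδU⟩ := nhds_basis_closedBall.mem_iff.1 (hU.mem_nhds hx)
  obtain ⟨M, hM⟩ := (hk.prod (isCompact_closedBall x δ)).exists_bound_of_continuousOn
    (hDc.mono (prod_mono (subset_univ _) hδU))
  have key := hasFDerivAt_integral_of_dominated_of_fderiv_le (𝕜 := ℝ) (μ := volume)
    (F := fun z s => G s z) (F' := fun z s => D s z) (x₀ := x) (bound := k.indicator fun _ => M)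
    (closedBall_mem_nhds x hδ)
    (by filter_upwards [hU.mem_nhds hx] with z hz using (hslice z hz).aestronglyMeasurable)
    ((hslice x hx).integrable_of_hasCompactSupport (hsupp x hx)) hDslice.aestronglyMeasurable
    (Eventually.of_forall fun s z hz => by
      by_cases hs : s ∈ k
      · rw [indicator_of_mem hs]
        exact hM (s, z) ⟨hs, hz⟩
      · rw [indicator_of_notMem hs, hD0 s hs z (hδU hz), norm_zero])
    ((integrable_indicator_iff hk.measurableSet).2
      (integrableOn_const hk.measure_lt_top.ne))
    (Eventually.of_forall fun s z hz => hDd s z (hδU hz))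
  rw [pd, key.fderiv, ContinuousLinearMap.integral_apply]
  · refine integral_congr_ae (Eventually.of_forall fun s => ?_)
    simp only [pd, (hDd s x hx).fderiv]
  · exact hDslice.integrable_of_hasCompactSupport
      (HasCompactSupport.intro hk fun s hs => hD0 s hs x hx)

theorem lapl_integral_param (hU : IsOpen U) (hk : IsCompact k)
    (hG : ContDiffOn ℝ (⊤ : ℕ∞) (fun p : ℝ × EuclideanSpace ℝ (Fin n) => G p.1 p.2) (univ ×ˢ U))
    (h0 : ∀ s ∉ k, ∀ x ∈ U, G s x = 0) {x : EuclideanSpace ℝ (Fin n)} (hx : x ∈ U) :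
    lapl (fun x => ∫ s, G s x) x = ∫ s, lapl (G s) x := by
  have hV : IsOpen ((univ : Set ℝ) ×ˢ U) := isOpen_univ.prod hU
  have hpd0 : ∀ {H : ℝ → EuclideanSpace ℝ (Fin n) → ℝ}, (∀ s ∉ k, ∀ x ∈ U, H s x = 0) →
      ∀ i, ∀ s ∉ k, ∀ x ∈ U, pd i (H s) x = 0 := by
    intro H hH i s hs z hz
    have h1 : H s =ᶠ[nhds z] fun _ => 0 := by
      filter_upwards [hU.mem_nhds hz] with w hw using hH s hs w hw
    rw [pd_congr i h1, pd_const]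
  simp only [lapl_eq_sum_pd]
  rw [integral_finsetSum]
  · refine Finset.sum_congr rfl fun i _ => ?_
    rw [← pd_integral_param hU hk (contDiffOn_pd_slice hV hG i) (hpd0 h0 i) i hx]
    refine pd_congr i ?_
    filter_upwards [hU.mem_nhds hx] with z hz using pd_integral_param hU hk hG h0 i hz
  · intro i _
    have h2 := (contDiffOn_pd_slice (G := fun s => pd i (G s)) hV
      (contDiffOn_pd_slice hV hG i) i).continuousOn
    exact (h2.comp_continuous (f := fun s : ℝ => (s, x)) (by fun_prop)
      fun s => ⟨mem_univ _, hx⟩).integrable_of_hasCompactSupport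
        (HasCompactSupport.intro hk fun s hs => hpd0 (hpd0 h0 i) i s hs x hx)

end ParametricIntegral

section Mollification

variable {n : ℕ} {R μ T δ M t : ℝ} {k : ℝ → ℝ} {f y : ℝ → EuclideanSpace ℝ (Fin n) → ℝ}
  {x : EuclideanSpace ℝ (Fin n)}

/-- The mollification of `f` in time by the kernel `k`. -/
noncomputable def moll (k : ℝ → ℝ) (f : ℝ → EuclideanSpace ℝ (Fin n) → ℝ) (t : ℝ)
    (x : EuclideanSpace ℝ (Fin n)) : ℝ := ∫ s, k (t - s) * f s x

theorem moll_eq_convolution (k : ℝ → ℝ) (f : ℝ → EuclideanSpace ℝ (Fin n) → ℝ) (t : ℝ)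
    (x : EuclideanSpace ℝ (Fin n)) : moll k f t x =
      convolution k (fun s => f s x) (ContinuousLinearMap.lsmul ℝ ℝ) volume t := by
  rw [convolution_lsmul_swap]
  rfl

theorem continuous_left_of_uncurry
    (hf : Continuous fun p : ℝ × EuclideanSpace ℝ (Fin n) => f p.1 p.2)
    (x : EuclideanSpace ℝ (Fin n)) : Continuous fun s => f s x :=
  hf.comp (by fun_prop : Continuous fun s : ℝ => (s, x))

theorem hasDerivAt_moll (hk : ContDiff ℝ 1 k) (hc : HasCompactSupport k)
    (hf : Continuous fun p : ℝ × EuclideanSpace ℝ (Fin n) => f p.1 p.2) (t : ℝ)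
    (x : EuclideanSpace ℝ (Fin n)) :
    HasDerivAt (fun s => moll k f s x) (moll (deriv k) f t x) t := by
  simp only [moll_eq_convolution]
  exact hc.hasDerivAt_convolution_left _ hk
    (continuous_left_of_uncurry hf x).locallyIntegrable t

theorem continuous_moll (hk : Continuous k) (hc : HasCompactSupport k)
    (hf : Continuous fun p : ℝ × EuclideanSpace ℝ (Fin n) => f p.1 p.2) :
    Continuous fun p : ℝ × EuclideanSpace ℝ (Fin n) => moll k f p.1 p.2 := by
  have e : (fun p : ℝ × EuclideanSpace ℝ (Fin n) => moll k f p.1 p.2) =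
      fun p => ∫ s in tsupport k, k s * f (p.1 - s) p.2 := by
    funext p
    rw [moll_eq_convolution, convolution, setIntegral_eq_integral_of_forall_compl_eq_zero]
    · rfl
    · intro s hs
      rw [image_eq_zero_of_notMem_tsupport hs, zero_mul]
  rw [e]
  refine continuous_parametric_integral_of_continuous ?_ hc
  exact (hk.comp continuous_snd).mul (hf.comp
    (by fun_prop : Continuous fun q : (ℝ × EuclideanSpace ℝ (Fin n)) × ℝ => (q.1.1 - q.2, q.1.2)))

theorem moll_eq_zero (h : ∀ s, f s x = 0) : moll k f t x = 0 := by
  simp [moll, h]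

theorem abs_moll_le (hk : ∀ s, 0 ≤ k s) (h1 : ∫ s, k s = 1) (hM : ∀ s x, |f s x| ≤ M) :
    |moll k f t x| ≤ M := by
  have hi : Integrable k := by
    by_contra h
    rw [integral_undef h] at h1
    norm_num at h1
  have h2 := norm_integral_le_of_norm_le (f := fun s => k (t - s) * f s x)
    (g := fun s => k (t - s) * M) ((hi.comp_sub_left t).mul_const M)
    (Eventually.of_forall fun s => by
      rw [norm_mul, Real.norm_of_nonneg (hk _)]
      exact mul_le_mul_of_nonneg_left (hM _ _) (hk _))
  rwa [integral_mul_const, integral_sub_left_eq_self, h1, one_mul] at h2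

/-- The extension of a solution by constants in time and by zero in space. -/
noncomputable def timeExtend (R T : ℝ) (y : ℝ → EuclideanSpace ℝ (Fin n) → ℝ) (t : ℝ) :
    EuclideanSpace ℝ (Fin n) → ℝ :=
  (ball (0 : EuclideanSpace ℝ (Fin n)) R).indicator (y (max 0 (min t T)))

theorem timeExtend_of_mem (ht : t ∈ Icc 0 T) (hx : x ∈ ball (0 : EuclideanSpace ℝ (Fin n)) R) :
    timeExtend R T y t x = y t x := by
  rw [timeExtend, indicator_of_mem hx, min_eq_left ht.2, max_eq_right ht.1]

theorem IsHarmonicHeatSolution.eq_zero_of_mem_sphere (h : IsHarmonicHeatSolution n R μ T y)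
    (hT : 0 < T) (ht : t ∈ Icc 0 T) (hx : x ∈ sphere (0 : EuclideanSpace ℝ (Fin n)) R) :
    y t x = 0 := by
  have h1 : ContinuousOn (fun t => y t x) (Icc 0 T) :=
    h.continuousOn.comp (f := fun t : ℝ => (t, x)) (by fun_prop)
      fun t ht => ⟨ht, sphere_subset_closedBall hx⟩
  have h2 : EqOn (fun t => y t x) (fun _ => 0) (Ioo 0 T) := fun t ht => h.boundary t ht x hx
  exact h2.of_subset_closure h1 continuousOn_const Ioo_subset_Icc_self
    (by rw [closure_Ioo hT.ne]) ht

theorem clamp_mem_Icc (hT : 0 ≤ T) (t : ℝ) : max 0 (min t T) ∈ Icc 0 T :=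
  ⟨le_max_left _ _, max_le hT (min_le_right _ _)⟩

theorem IsHarmonicHeatSolution.continuous_timeExtend (h : IsHarmonicHeatSolution n R μ T y)
    (hT : 0 < T) (hR : 0 < R) :
    Continuous fun p : ℝ × EuclideanSpace ℝ (Fin n) => timeExtend R T y p.1 p.2 := by
  classical
  have e : (fun p : ℝ × EuclideanSpace ℝ (Fin n) => timeExtend R T y p.1 p.2) =
      (univ ×ˢ ball (0 : EuclideanSpace ℝ (Fin n)) R).piecewise
        (fun p : ℝ × EuclideanSpace ℝ (Fin n) => y (max 0 (min p.1 T)) p.2) fun _ => 0 := by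
    funext p
    simp [timeExtend, indicator, piecewise]
  rw [e]
  refine continuous_piecewise ?_ ?_ continuousOn_const
  · rintro ⟨s, x⟩ hp
    rw [frontier_univ_prod_eq, frontier_ball _ hR.ne'] at hp
    exact h.eq_zero_of_mem_sphere hT (clamp_mem_Icc hT.le s) hp.2
  · rw [closure_prod_eq, closure_univ, closure_ball _ hR.ne']
    exact h.continuousOn.comp (f := fun p : ℝ × EuclideanSpace ℝ (Fin n) =>
      (max 0 (min p.1 T), p.2)) (by fun_prop) fun p hp => ⟨clamp_mem_Icc hT.le _, hp.2⟩

theorem IsHarmonicHeatSolution.exists_abs_timeExtend_le (h : IsHarmonicHeatSolution n R μ T y)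
    (hT : 0 < T) : ∃ M : ℝ, ∀ t x, |timeExtend R T y t x| ≤ M := by
  obtain ⟨M, hM⟩ := (isCompact_Icc.prod (isCompact_closedBall _ _)).exists_bound_of_continuousOn
    h.continuousOn
  refine ⟨max M 0, fun t x => ?_⟩
  by_cases hx : x ∈ ball (0 : EuclideanSpace ℝ (Fin n)) R
  · rw [timeExtend, indicator_of_mem hx]
    exact (hM (_, x) ⟨clamp_mem_Icc hT.le t, ball_subset_closedBall hx⟩).trans (le_max_left _ _)
  · rw [timeExtend, indicator_of_notMem hx, abs_zero]
    exact le_max_right _ _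

section Kernel

variable (h : IsHarmonicHeatSolution n R μ T y) (hk : ContDiff ℝ (⊤ : ℕ∞) k)
  (hs : ∀ r, δ < |r| → k r = 0) (hδt : δ < t) (htT : t < T - δ)

include hδt htT in
theorem lt_abs_sub_of_notMem {s : ℝ} (hsI : s ∉ Ioo 0 T) : δ < |t - s| := by
  by_contra! h1
  rw [abs_le] at h1
  exact hsI ⟨by linarith, by linarith⟩

include h hk hs hδt htT

theorem IsHarmonicHeatSolution.contDiffOn_kernel_mul_timeExtend :
    ContDiffOn ℝ (⊤ : ℕ∞) (fun p : ℝ × EuclideanSpace ℝ (Fin n) =>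
      k (t - p.1) * timeExtend R T y p.1 p.2) (univ ×ˢ ball 0 R) := by
  rintro ⟨s, x⟩ ⟨-, hx⟩
  refine ContDiffAt.contDiffWithinAt ?_
  by_cases hsI : s ∈ Ioo 0 T
  · refine ContDiffAt.mul (by fun_prop) ?_
    have hV : Ioo 0 T ×ˢ ball (0 : EuclideanSpace ℝ (Fin n)) R ∈ nhds (s, x) :=
      (isOpen_Ioo.prod isOpen_ball).mem_nhds ⟨hsI, hx⟩
    refine (h.smoothOn.contDiffAt hV).congr_of_eventuallyEq ?_
    filter_upwards [hV] with p hp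
    exact timeExtend_of_mem (Ioo_subset_Icc_self hp.1) hp.2
  · have hV : {p : ℝ × EuclideanSpace ℝ (Fin n) | δ < |t - p.1|} ∈ nhds (s, x) := by
      refine (isOpen_lt continuous_const (by fun_prop)).mem_nhds ?_
      exact lt_abs_sub_of_notMem hδt htT hsI
    refine (contDiffAt_const (c := (0:ℝ))).congr_of_eventuallyEq ?_
    filter_upwards [hV] with p hp
    rw [hs _ hp, zero_mul]

theorem IsHarmonicHeatSolution.contDiffOn_moll :
    ContDiffOn ℝ (⊤ : ℕ∞) (moll k (timeExtend R T y) t) (ball 0 R) :=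
  contDiffOn_integral_param isOpen_ball (isCompact_Icc (a := 0) (b := T))
    (h.contDiffOn_kernel_mul_timeExtend hk hs hδt htT) fun s hsI x _ => by
      rw [hs _ (lt_abs_sub_of_notMem hδt htT fun h1 => hsI (Ioo_subset_Icc_self h1)), zero_mul]

theorem IsHarmonicHeatSolution.lapl_moll (hcont :
    Continuous fun p : ℝ × EuclideanSpace ℝ (Fin n) => timeExtend R T y p.1 p.2)
    (hx : x ∈ ball (0 : EuclideanSpace ℝ (Fin n)) R) :
    lapl (moll k (timeExtend R T y) t) x =
      moll (deriv k) (timeExtend R T y) t x + μ ^ 2 * sqd 0 x * moll k (timeExtend R T y) t x := by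
  have hk1 : Continuous (deriv k) := hk.continuous_deriv (by simp)
  have hs' : ∀ r, δ < |r| → deriv k r = 0 := fun r hr => by
    have : k =ᶠ[nhds r] fun _ => 0 := by
      filter_upwards [(isOpen_lt continuous_const continuous_abs).mem_nhds hr] with q hq
        using hs q hq
    rw [this.deriv_eq, deriv_const]
  have hk0 : ∀ s ∉ Ioo 0 T, k (t - s) = 0 := fun s hsI =>
    hs _ (lt_abs_sub_of_notMem hδt htT hsI)
  have hk'0 : ∀ s ∉ Ioo 0 T, deriv k (t - s) = 0 := fun s hsI =>
    hs' _ (lt_abs_sub_of_notMem hδt htT hsI)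
  have hfx := continuous_left_of_uncurry hcont x
  have hG := h.contDiffOn_kernel_mul_timeExtend hk hs hδt htT
  have hc : ∀ {q : ℝ → ℝ}, Continuous q → (∀ s ∉ Ioo 0 T, q (t - s) = 0) →
      Integrable fun s => q (t - s) * timeExtend R T y s x := fun hq hq0 =>
    Continuous.integrable_of_hasCompactSupport (by fun_prop)
      (HasCompactSupport.intro (isCompact_Icc (a := 0) (b := T)) fun s hsI => by
        rw [hq0 s fun h1 => hsI (Ioo_subset_Icc_self h1), zero_mul])
  have hi0 := hc hk.continuous hk0
  have hi1 := hc hk1 hk'0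
  unfold moll
  rw [lapl_integral_param isOpen_ball (isCompact_Icc (a := 0) (b := T)) hG
    (fun s hsI x _ => by rw [hk0 s fun h1 => hsI (Ioo_subset_Icc_self h1), zero_mul]) hx]
  set φ : ℝ → ℝ := fun s => k (t - s) * timeExtend R T y s x with hφ
  have hφd : ContDiff ℝ 1 φ := by
    refine (contDiffOn_univ.1 ?_).of_le (n := ((⊤ : ℕ∞) : WithTop ℕ∞)) (by simp)
    exact hG.comp (f := fun s : ℝ => (s, x)) (by fun_prop) fun s hsI => ⟨mem_univ _, hx⟩
  have hφc : HasCompactSupport φ :=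
    HasCompactSupport.intro (isCompact_Icc (a := 0) (b := T)) fun s hsI => by
      rw [hφ]
      simp only
      rw [hk0 s fun h1 => hsI (Ioo_subset_Icc_self h1), zero_mul]
  have hφi : Integrable (deriv φ) :=
    (hφd.continuous_deriv (by simp)).integrable_of_hasCompactSupport hφc.deriv
  have hφ0 : ∫ s, deriv φ s = 0 :=
    integral_eq_zero_of_hasDerivAt_of_integrable
      (fun s => (hφd.differentiable (by simp) s).hasDerivAt) hφi hi0
  have key : ∀ s, lapl (fun x => k (t - s) * timeExtend R T y s x) x =
      deriv φ s + deriv k (t - s) * timeExtend R T y s x + μ ^ 2 * sqd 0 x * φ s := by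
    intro s
    rw [lapl_const_mul]
    by_cases hsI : s ∈ Ioo 0 T
    · have h1 : lapl (timeExtend R T y s) x = lapl (y s) x := lapl_congr (by
        filter_upwards [isOpen_ball.mem_nhds hx] with z hz
          using timeExtend_of_mem (Ioo_subset_Icc_self hsI) hz)
      have h2 : (fun r => timeExtend R T y r x) =ᶠ[nhds s] fun r => y r x := by
        filter_upwards [isOpen_Ioo.mem_nhds hsI] with r hr
          using timeExtend_of_mem (Ioo_subset_Icc_self hr) hx
      have h3 : DifferentiableAt ℝ (fun r => y r x) s :=
        DifferentiableAt.comp s (g := fun p : ℝ × EuclideanSpace ℝ (Fin n) => y p.1 p.2)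
          (f := fun r => (r, x)) ((h.smoothOn.contDiffAt ((isOpen_Ioo.prod isOpen_ball).mem_nhds
            (mk_mem_prod hsI hx))).differentiableAt (by simp)) (by fun_prop)
      have h4 := h3.hasDerivAt.congr_of_eventuallyEq h2
      have h5 : HasDerivAt (fun r => k (t - r)) (deriv k (t - s) * -1) s :=
        (hk.differentiable (by simp) (t - s)).hasDerivAt.comp s
          ((hasDerivAt_id s).const_sub t)
      have h6 : deriv φ s = _ := (h5.mul h4).deriv
      have h7 := h.eqn s hsI x hx
      rw [h6, h1, hφ]
      simp only [sqd, sub_zero]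
      rw [timeExtend_of_mem (Ioo_subset_Icc_self hsI) hx]
      linear_combination (-k (t - s)) * h7
    · have h1 : deriv φ s = 0 := by
        have h2 : φ =ᶠ[nhds s] fun _ => 0 := by
          filter_upwards [(isOpen_lt continuous_const (by fun_prop :
            Continuous fun r : ℝ => |t - r|)).mem_nhds
              (lt_abs_sub_of_notMem hδt htT hsI)] with r hr
          simp only [hφ]
          rw [hs _ hr, zero_mul]
        rw [h2.deriv_eq, deriv_const]
      have h2 : φ s = 0 := by
        simp only [hφ]
        rw [hk0 s hsI, zero_mul]
      rw [h1, h2, hk0 s hsI, hk'0 s hsI]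
      simp
  simp only [key]
  have hi2 : Integrable fun s => deriv φ s + deriv k (t - s) * timeExtend R T y s x := hφi.add hi1
  rw [integral_add hi2 (hi0.const_mul _), integral_add hφi hi1, hφ0, zero_add,
    integral_const_mul]

end Kernel

end Mollification

section Limit

variable {n : ℕ} {R R₁ R₂ μ T δ M t : ℝ} {k : ℝ → ℝ} {y : ℝ → EuclideanSpace ℝ (Fin n) → ℝ}
  {x : EuclideanSpace ℝ (Fin n)}

theorem IsHarmonicHeatSolution.niceSol_moll (h : IsHarmonicHeatSolution n R μ T y) (hT : 0 < T)
    (hR : 0 < R) (hk : ContDiff ℝ (⊤ : ℕ∞) k) (hc : HasCompactSupport k)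
    (hs : ∀ r, δ < |r| → k r = 0) {t₀ b : ℝ} (ht₀ : δ < t₀) (hb : t₀ + b < T - δ) :
    NiceSol R μ b (fun τ => moll k (timeExtend R T y) (t₀ + τ))
      (fun τ => moll (deriv k) (timeExtend R T y) (t₀ + τ))
      (fun τ => moll (deriv (deriv k)) (timeExtend R T y) (t₀ + τ)) := by
  have hF := h.continuous_timeExtend hT hR
  have hderiv : ∀ {q : ℝ → ℝ}, ContDiff ℝ (⊤ : ℕ∞) q → ContDiff ℝ (⊤ : ℕ∞) (deriv q) :=
    fun hq => (contDiff_infty_iff_deriv.1 hq).2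
  have hk' := hderiv hk
  have hk'' := hderiv hk'
  have hs' : ∀ r, δ < |r| → deriv k r = 0 := fun r hr => by
    have : k =ᶠ[nhds r] fun _ => 0 := by
      filter_upwards [(isOpen_lt continuous_const continuous_abs).mem_nhds hr] with q hq
        using hs q hq
    rw [this.deriv_eq, deriv_const]
  have hcont : ∀ {q : ℝ → ℝ}, Continuous q → HasCompactSupport q →
      Continuous fun p : ℝ × EuclideanSpace ℝ (Fin n) =>
        moll q (timeExtend R T y) (t₀ + p.1) p.2 := fun hq hqc =>
    (continuous_moll hq hqc hF).comp
      (by fun_prop : Continuous fun p : ℝ × EuclideanSpace ℝ (Fin n) => (t₀ + p.1, p.2))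
  have hzero : ∀ x ∉ ball (0 : EuclideanSpace ℝ (Fin n)) R, ∀ s, timeExtend R T y s x = 0 :=
    fun x hx s => indicator_of_notMem hx _
  have hrange : ∀ τ ∈ Icc 0 b, δ < t₀ + τ ∧ t₀ + τ < T - δ := fun τ hτ =>
    ⟨by linarith [hτ.1], by linarith [hτ.2]⟩
  refine ⟨hcont hk.continuous hc, hcont hk'.continuous hc.deriv,
    hcont hk''.continuous hc.deriv.deriv, fun _ x hx => moll_eq_zero (hzero x hx),
    fun _ x hx => moll_eq_zero (hzero x hx), fun τ x => ?_, fun τ x => ?_, fun τ hτ => ?_,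
    fun τ hτ => ?_, fun τ hτ x hx => ?_, fun τ hτ x hx => ?_⟩
  · exact (hasDerivAt_moll (hk.of_le (by simp)) hc hF (t₀ + τ) x).comp_const_add t₀ τ
  · exact (hasDerivAt_moll (hk'.of_le (by simp)) hc.deriv hF (t₀ + τ) x).comp_const_add t₀ τ
  · exact (h.contDiffOn_moll hk hs (hrange τ hτ).1 (hrange τ hτ).2).of_le (WithTop.coe_le_coe.2 (le_top : (2 : ℕ∞) ≤ ⊤))
  · exact (h.contDiffOn_moll hk' hs' (hrange τ hτ).1 (hrange τ hτ).2).of_le (WithTop.coe_le_coe.2 (le_top : (2 : ℕ∞) ≤ ⊤))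
  · exact h.lapl_moll hk hs (hrange τ hτ).1 (hrange τ hτ).2 hF hx
  · exact h.lapl_moll hk' hs' (hrange τ hτ).1 (hrange τ hτ).2 hF hx

theorem tendsto_moll_normed {f : ℝ → EuclideanSpace ℝ (Fin n) → ℝ}
    (hf : Continuous fun p : ℝ × EuclideanSpace ℝ (Fin n) => f p.1 p.2)
    {φ : ℕ → ContDiffBump (0:ℝ)} (hφ : Tendsto (fun m => (φ m).rOut) atTop (nhds 0))
    {u : ℕ → ℝ} (hu : Tendsto u atTop (nhds t)) (x : EuclideanSpace ℝ (Fin n)) :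
    Tendsto (fun m => moll ((φ m).normed volume) f (u m) x) atTop (nhds (f t x)) := by
  simp only [moll_eq_convolution]
  have hx := continuous_left_of_uncurry hf x
  exact ContDiffBump.convolution_tendsto_right hφ
    (Eventually.of_forall fun _ => hx.aestronglyMeasurable) ((hx.tendsto t).comp tendsto_snd) hu

theorem tendsto_integral_moll_sq {f : ℝ → EuclideanSpace ℝ (Fin n) → ℝ}
    (hf : Continuous fun p : ℝ × EuclideanSpace ℝ (Fin n) => f p.1 p.2)
    (hM : ∀ t x, |f t x| ≤ M) {φ : ℕ → ContDiffBump (0:ℝ)}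
    (hφ : Tendsto (fun m => (φ m).rOut) atTop (nhds 0)) {u : ℕ → ℝ}
    (hu : Tendsto u atTop (nhds t)) {U : Set (EuclideanSpace ℝ (Fin n))}
    (hU : Bornology.IsBounded U) :
    Tendsto (fun m => ∫ x in U, moll ((φ m).normed volume) f (u m) x ^ 2) atTop
      (nhds (∫ x in U, f t x ^ 2)) := by
  refine tendsto_integral_of_dominated_convergence (fun _ => M ^ 2) (fun m => ?_)
    (integrableOn_const hU.measure_lt_top.ne) (fun m => Eventually.of_forall fun x => ?_)
    (Eventually.of_forall fun x => (tendsto_moll_normed hf hφ hu x).pow 2)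
  · exact ((continuous_of_uncurry (continuous_moll (φ m).continuous_normed
      (φ m).hasCompactSupport_normed hf) (u m)).pow 2).aestronglyMeasurable
  · rw [norm_pow]
    exact pow_le_pow_left₀ (norm_nonneg _)
      (abs_moll_le (φ m).nonneg_normed (φ m).integral_normed hM) 2

/-- Observability passes from regularised solutions to solutions. -/
theorem IsHarmonicHeatSolution.observability (h : IsHarmonicHeatSolution n R μ T y)
    (hR : 0 < R) (h₂R : R₂ ≤ R) {a β A K : ℝ} (ha : 0 ≤ a) (haT : a < T) (haT1 : T - a ≤ 1)
    (hK : 0 ≤ K) (H : ∀ (b t : ℝ) (Y P Z : ℝ → EuclideanSpace ℝ (Fin n) → ℝ), t ∈ Ioo 0 b →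
      t ≤ 1 → NiceSol R μ b Y P Z →
      ∫ x in ball 0 R, Y t x ^ 2 ≤ K * Real.exp (A / t ^ β) * obs R₁ R₂ Y t) :
    ∫ x in ball 0 R, y T x ^ 2 ≤ K * Real.exp (A / (T - a) ^ β) *
      ∫ t in Ioc 0 T, ∫ x in annulus n R₁ R₂, y t x ^ 2 := by
  have hT : 0 < T := ha.trans_lt haT
  have hF := h.continuous_timeExtend hT hR
  obtain ⟨M, hM⟩ := h.exists_abs_timeExtend_le (R := R) hT
  set δ : ℕ → ℝ := fun m => (T - a) / 6 * (1 / ((m:ℝ) + 1)) with hδ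
  have hδ0 : ∀ m, 0 < δ m := fun m => by
    have : 0 < T - a := by linarith
    positivity
  have hδ1 : ∀ m, 6 * δ m ≤ T - a := fun m => by
    have h1 : 1 / ((m:ℝ) + 1) ≤ 1 := by
      rw [div_le_one (by positivity)]
      linarith [m.cast_nonneg (α := ℝ)]
    have h2 := mul_le_mul_of_nonneg_left h1 (by linarith : 0 ≤ (T - a) / 6)
    simp only [hδ]
    linarith
  have hδlim : Tendsto δ atTop (nhds 0) := by
    simpa [hδ] using tendsto_one_div_add_atTop_nhds_zero_nat.const_mul ((T - a) / 6)
  set φ : ℕ → ContDiffBump (0:ℝ) := fun m =>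
    ⟨δ m / 2, δ m, half_pos (hδ0 m), half_lt_self (hδ0 m)⟩ with hφ
  have hφlim : Tendsto (fun m => (φ m).rOut) atTop (nhds 0) := hδlim
  set F := timeExtend R T y
  set g : ℕ → ℝ → ℝ := fun m t => ∫ x in annulus n R₁ R₂, moll ((φ m).normed volume) F t x ^ 2
    with hg
  have hFT : ∀ t ∈ Icc 0 T, ∀ U ⊆ ball (0 : EuclideanSpace ℝ (Fin n)) R, MeasurableSet U →
      ∫ x in U, F t x ^ 2 = ∫ x in U, y t x ^ 2 := fun t ht U hU hUm =>
    setIntegral_congr_fun hUm fun x hx => by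
      simp only [F, timeExtend_of_mem ht (hU hx)]
  have hnice : ∀ m, NiceSol R μ (T - a - 4 * δ m)
      (fun τ => moll ((φ m).normed volume) F (a + 2 * δ m + τ))
      (fun τ => moll (deriv ((φ m).normed volume)) F (a + 2 * δ m + τ))
      (fun τ => moll (deriv (deriv ((φ m).normed volume))) F (a + 2 * δ m + τ)) := fun m =>
    h.niceSol_moll hT hR (φ m).contDiff_normed (φ m).hasCompactSupport_normed
      (δ := δ m) (fun r hr => by
        by_contra h1
        have h2 : r ∈ Function.support ((φ m).normed volume) := h1
        rw [(φ m).support_normed_eq, mem_ball_zero_iff] at h2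
        exact lt_asymm hr h2) (by linarith [hδ0 m]) (by linarith [hδ0 m])
  have hgc : ∀ m, Continuous (g m) := fun m => by
    have h1 := ((hnice m).continuous_obs_density (R₁ := R₁) (R₂ := R₂)).comp
      (continuous_sub_right (a + 2 * δ m))
    refine h1.congr fun t => ?_
    simp [hg]
  have hineq : ∀ m, ∫ x in ball 0 R, moll ((φ m).normed volume) F (T - 3 * δ m) x ^ 2 ≤
      K * Real.exp (A / (T - a - 5 * δ m) ^ β) * ∫ t in Ioc 0 T, g m t := by
    intro m
    have hm0 := hδ0 m
    have hm1 := hδ1 m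
    have h1 := H _ (T - a - 5 * δ m) _ _ _ ⟨by linarith, by linarith⟩ (by linarith) (hnice m)
    have e : a + 2 * δ m + (T - a - 5 * δ m) = T - 3 * δ m := by ring
    simp only [e] at h1
    refine h1.trans (mul_le_mul_of_nonneg_left ?_ (by positivity))
    have h2 : obs R₁ R₂ (fun τ => moll ((φ m).normed volume) F (a + 2 * δ m + τ))
        (T - a - 5 * δ m) = ∫ t in (a + 2 * δ m)..(T - 3 * δ m), g m t := by
      rw [obs, intervalIntegral.integral_comp_add_left (g m), e, add_zero]
    rw [h2, ← intervalIntegral.integral_of_le hT.le]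
    exact intervalIntegral.integral_mono_interval (by linarith) (by linarith) (by linarith)
      (Eventually.of_forall fun t => integral_nonneg fun _ => sq_nonneg _)
      ((hgc m).intervalIntegrable _ _)
  have hleft := tendsto_integral_moll_sq hF hM hφlim (u := fun m => T - 3 * δ m) (t := T)
    (by simpa using (hδlim.const_mul 3).const_sub T)
    (isBounded_ball (x := (0 : EuclideanSpace ℝ (Fin n))) (r := R))
  have hgle : ∀ m t, ‖g m t‖ ≤ M ^ 2 * volume.real (annulus n R₁ R₂) := fun m t =>
    norm_setIntegral_le_of_norm_le_const isBounded_annulus.measure_lt_top fun x _ => by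
      rw [norm_pow]
      exact pow_le_pow_left₀ (norm_nonneg _)
        (abs_moll_le (φ m).nonneg_normed (φ m).integral_normed hM) 2
  have hright : Tendsto (fun m => ∫ t in Ioc 0 T, g m t) atTop
      (nhds (∫ t in Ioc 0 T, ∫ x in annulus n R₁ R₂, F t x ^ 2)) :=
    tendsto_integral_of_dominated_convergence (fun _ => M ^ 2 * volume.real (annulus n R₁ R₂))
      (fun m => (hgc m).aestronglyMeasurable) (integrableOn_const measure_Ioc_lt_top.ne)
      (fun m => Eventually.of_forall fun t => hgle m t)
      (Eventually.of_forall fun t =>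
        tendsto_integral_moll_sq hF hM hφlim tendsto_const_nhds isBounded_annulus)
  have hcost : Tendsto (fun m => K * Real.exp (A / (T - a - 5 * δ m) ^ β)) atTop
      (nhds (K * Real.exp (A / (T - a) ^ β))) := by
    have h1 : Tendsto (fun m => T - a - 5 * δ m) atTop (nhds (T - a)) := by
      simpa using (hδlim.const_mul 5).const_sub (T - a)
    have h2 := h1.rpow_const (p := β) (Or.inl (by linarith))
    have h3 : (T - a) ^ β ≠ 0 := (Real.rpow_pos_of_pos (by linarith) _).ne'
    exact ((Real.continuous_exp.tendsto _).comp (tendsto_const_nhds.div h2 h3)).const_mul K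
  have hlim := le_of_tendsto_of_tendsto' hleft (hcost.mul hright) hineq
  rw [hFT T ⟨hT.le, le_rfl⟩ _ Subset.rfl measurableSet_ball] at hlim
  refine hlim.trans_eq ?_
  congr 1
  exact setIntegral_congr_fun measurableSet_Ioc fun t ht =>
    hFT t (Ioc_subset_Icc_self ht) _ (annulus_subset_ball h₂R) isOpen_annulus.measurableSet

end Limit

/-- Observability of the harmonic heat equation from the annulus
`A = {R₁ < ‖x‖ < R₂}`, with cost `(c/ε⁶)(1+μ) e^{μ(R₁+ε)²} e^{2c_β/T^β}` for every
`T, μ > 0` and `ε ∈ (0,1]`; the constants `c_β` can be chosen so that `c_β → ∞`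
as `β → 1⁺`. -/
theorem statement8
    (d : ℕ) (hd : 2 ≤ d) (R R₁ R₂ : ℝ)
    (hR₁ : 0 < R₁) (h₁₂ : R₁ < R₂) (h₂R : R₂ ≤ R) :
    ∃ c : ℝ, 0 < c ∧ ∃ cβ : ℝ → ℝ,
      (∀ β : ℝ, 1 < β → 0 < cβ β) ∧
      Tendsto cβ (nhdsWithin 1 (Ioi 1)) atTop ∧
      ∀ β : ℝ, 1 < β →
      ∀ T : ℝ, 0 < T → ∀ μ : ℝ, 0 < μ → ∀ ε ∈ Ioc (0:ℝ) 1,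
      ∀ y : ℝ → EuclideanSpace ℝ (Fin d) → ℝ,
        IsHarmonicHeatSolution d R μ T y →
        (∫ x in ball (0 : EuclideanSpace ℝ (Fin d)) R, (y T x) ^ 2) ≤
          (c / ε ^ 6) * (1 + μ) * Real.exp (μ * (R₁ + ε) ^ 2) *
            Real.exp (2 * cβ β / T ^ β) *
            ∫ t in Ioc (0:ℝ) T,
              ∫ x in {x : EuclideanSpace ℝ (Fin d) | R₁ < ‖x‖ ∧ ‖x‖ < R₂}, (y t x) ^ 2 := by
  have hR : 0 < R := by linarith
  obtain ⟨c, hc, H⟩ := NiceSol.exists_observability hd hR₁ h₁₂ h₂R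
  choose! A hA H using H
  have hcβ : ∀ β, 1 < β → 0 < max (A β) (1 / (β - 1)) := fun β hβ =>
    lt_max_of_lt_left (hA β hβ)
  refine ⟨c * Real.exp (A 2), by positivity, fun β => max (A β) (1 / (β - 1)), hcβ, ?_, ?_⟩
  · refine tendsto_atTop_mono (fun β => le_max_right (A β) (1 / (β - 1))) ?_
    simp only [one_div]
    refine tendsto_inv_nhdsGT_zero.comp (tendsto_nhdsWithin_iff.2 ⟨?_, ?_⟩)
    · refine tendsto_nhdsWithin_of_tendsto_nhds ?_
      simpa using (continuous_sub_right (1:ℝ)).tendsto 1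
    · filter_upwards [self_mem_nhdsWithin] with β hβ using mem_Ioi.2 (sub_pos.2 (mem_Ioi.1 hβ))
  intro β hβ T hT μ hμ ε hε y h
  set J := ∫ t in Ioc (0:ℝ) T,
    ∫ x in {x : EuclideanSpace ℝ (Fin d) | R₁ < ‖x‖ ∧ ‖x‖ < R₂}, (y t x) ^ 2
  have hJ : 0 ≤ J := integral_nonneg fun _ => integral_nonneg fun _ => sq_nonneg _
  have hε0 := hε.1
  set K := c / ε ^ 6 * (1 + μ) * Real.exp (μ * (R₁ + ε) ^ 2) with hK
  have hK0 : 0 ≤ K := by positivity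
  have hTβ : 0 < T ^ β := Real.rpow_pos_of_pos hT _
  have hX : 1 ≤ Real.exp (2 * max (A β) (1 / (β - 1)) / T ^ β) :=
    Real.one_le_exp (div_nonneg (by linarith [hcβ β hβ]) hTβ.le)
  have hA2 : 1 ≤ Real.exp (A 2) := Real.one_le_exp (hA 2 (by norm_num)).le
  have e : c * Real.exp (A 2) / ε ^ 6 * (1 + μ) * Real.exp (μ * (R₁ + ε) ^ 2) =
      K * Real.exp (A 2) := by rw [hK]; ring
  rw [e]
  rcases le_total T 1 with hT1 | hT1
  · have h1 := h.observability hR h₂R le_rfl hT (by linarith) hK0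
      (fun b t Y P Z => H β hβ μ hμ ε hε b t Y P Z)
    rw [sub_zero] at h1
    refine h1.trans (mul_le_mul_of_nonneg_right ?_ hJ)
    refine mul_le_mul (le_mul_of_one_le_right hK0 hA2) (Real.exp_le_exp.2 ?_)
      (Real.exp_pos _).le (by positivity)
    refine div_le_div_of_nonneg_right ?_ hTβ.le
    linarith [le_max_left (A β) (1 / (β - 1)), hcβ β hβ]
  · have h1 := h.observability hR h₂R (a := T - 1) (by linarith) (by linarith) (by linarith) hK0
      (fun b t Y P Z => H 2 (by norm_num) μ hμ ε hε b t Y P Z)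
    rw [sub_sub_cancel, Real.one_rpow, div_one] at h1
    exact h1.trans (mul_le_mul_of_nonneg_right (le_mul_of_one_le_right (by positivity) hX) hJ)
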